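/- Let d ≥ 1, δ ∈ (0,1], p, q ∈ (1,∞), and let a : ℝ → 𝕊_δ be measurable. Then there is a constant N = N(d,δ,p,q) such that for every u ∈ C₀^∞(ℝ^{1+d}), ‖∂_t u‖_{𝕃_{q,p}} + ‖D²u‖_{𝕃_{q,p}} ≤ N ‖∂_t u + Σ_{i,j} a^{ij}(t) D_{ij}u‖_{𝕃_{q,p}}. -/

import Mathlib

open MeasureTheory Metric Set
open scoped ENNReal NNReal

noncomputable section

abbrev Spc (d : ℕ) : Type := EuclideanSpace ℝ (Fin d)

abbrev Pt (d : ℕ) : Type := ℝ × Spc d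

instance matrixMeasurableSpace (d : ℕ) : MeasurableSpace (Matrix (Fin d) (Fin d) ℝ) :=
  (inferInstance : MeasurableSpace (Fin d → Fin d → ℝ))

/-- Membership in `𝕊_δ`: symmetric `d×d` matrices with
`δ|ξ|² ≤ (aξ,ξ) ≤ δ⁻¹|ξ|²`. -/
def inS (d : ℕ) (δ : ℝ) (a : Matrix (Fin d) (Fin d) ℝ) : Prop :=
  a.IsSymm ∧ ∀ ξ : Fin d → ℝ,
    δ * (∑ i, ξ i ^ 2) ≤ (∑ i, ∑ j, a i j * ξ i * ξ j) ∧
    (∑ i, ∑ j, a i j * ξ i * ξ j) ≤ δ⁻¹ * (∑ i, ξ i ^ 2)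

/-- `{a,u} = a^{ij} a^{kr} u_{ik} u_{jr}`. -/
def bra (d : ℕ) (a u : Matrix (Fin d) (Fin d) ℝ) : ℝ :=
  ∑ i, ∑ j, ∑ k, ∑ r, a i j * a k r * u i k * u j r

/-- Frobenius norm of a `d×d` array. -/
def mnorm {d : ℕ} (m : Fin d → Fin d → ℝ) : ℝ :=
  Real.sqrt (∑ i, ∑ j, m i j ^ 2)

/-- Euclidean norm of a vector given as `Fin d → ℝ`. -/
def vnorm {d : ℕ} (v : Fin d → ℝ) : ℝ :=
  Real.sqrt (∑ i, v i ^ 2)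

/-- Parabolic cylinder `C_R(t,x) = (t, t+R²) × B_R(x)`. -/
def cyl (d : ℕ) (R t : ℝ) (x : Spc d) : Set (Pt d) :=
  Ioo t (t + R ^ 2) ×ˢ ball x R

/-- Time derivative `∂_t u`. -/
def Dt {d : ℕ} (u : Pt d → ℝ) (z : Pt d) : ℝ :=
  deriv (fun s => u (s, z.2)) z.1

/-- Spatial derivative `D_i u`. -/
def Dx {d : ℕ} (i : Fin d) (u : Pt d → ℝ) (z : Pt d) : ℝ :=
  fderiv ℝ (fun y => u (z.1, y)) z.2 (EuclideanSpace.single i 1)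

/-- Second spatial derivative `D_{ij} u = D_i D_j u`. -/
def Dxx {d : ℕ} (i j : Fin d) (u : Pt d → ℝ) : Pt d → ℝ :=
  Dx i (Dx j u)

/-- `u ∈ C₀^∞(ℝ^{1+d})`. -/
def CinfC {d : ℕ} (u : Pt d → ℝ) : Prop :=
  ContDiff ℝ (⊤ : ℕ∞) u ∧ HasCompactSupport u

/-- The kernel `p_{α,k}(s,r)`. -/
def pak (d : ℕ) (α k s r : ℝ) : ℝ :=
  if 0 < s then s ^ (-((d : ℝ) + 2 - α) / 2) * Real.exp (-(r ^ 2) / (k * s)) else 0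

/-- Parabolic distance to the origin `ρ(t,x) = |x| + √|t|`. -/
def prho {d : ℕ} (z : Pt d) : ℝ := ‖z.2‖ + Real.sqrt |z.1|

/-- Average of (the positive part of) `g` over `C`, valued in `ℝ≥0∞`. -/
def aveLin {d : ℕ} (C : Set (Pt d)) (g : Pt d → ℝ) : ℝ≥0∞ :=
  (volume C)⁻¹ * ∫⁻ z in C, ENNReal.ofReal (g z)

/-- Parabolic maximal function `𝕄_β g` (for `g ≥ 0`). -/
def maxF {d : ℕ} (β : ℝ) (g : Pt d → ℝ) (z : Pt d) : ℝ≥0∞ :=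
  ⨆ (ρ : ℝ) (_ : 0 < ρ) (t : ℝ) (x : Spc d) (_ : z ∈ cyl d ρ t x),
    ENNReal.ofReal (ρ ^ β) * aveLin (cyl d ρ t x) g

/-- Oscillation of a matrix-valued function over `C`. -/
def oscC {d : ℕ} (C : Set (Pt d)) (g : Pt d → Fin d → Fin d → ℝ) : ℝ :=
  ⨍ z₁ in C, ⨍ z₂ in C, mnorm (fun i j => g z₁ i j - g z₂ i j)

/-- Mixed norm `‖f‖_{𝕃_{q,p}}` (inner integration in `t`, outer in `x`). -/
def mixedNorm {d : ℕ} (q p : ℝ) (f : Pt d → ℝ) : ℝ :=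
  (∫ x : Spc d, (∫ t : ℝ, |f (t, x)| ^ q) ^ (p / q)) ^ (1 / p)

/-- Mixed norm on a set `Γ`. -/
def mixedNormOn {d : ℕ} (q p : ℝ) (Γ : Set (Pt d)) (f : Pt d → ℝ) : ℝ :=
  mixedNorm q p (Γ.indicator f)

/-- Normalized (averaged) mixed norm over the cylinder `C_R(t,x)`, in `ℝ≥0∞`. -/
def cylNormL {d : ℕ} (q p R t : ℝ) (x : Spc d) (f : Pt d → ℝ) : ℝ≥0∞ :=
  ((volume (ball x R))⁻¹ * ∫⁻ y in ball x R,
      ((volume (Ioo t (t + R ^ 2)))⁻¹ * ∫⁻ s in Ioo t (t + R ^ 2),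
        ENNReal.ofReal |f (s, y)| ^ q) ^ (p / q)) ^ (1 / p)

/-- Mixed norm on a set, valued in `ℝ≥0∞`. -/
def mixedNormLe {d : ℕ} (q p : ℝ) (Γ : Set (Pt d)) (f : Pt d → ℝ) : ℝ≥0∞ :=
  (∫⁻ x : Spc d, (∫⁻ t : ℝ, ENNReal.ofReal |Γ.indicator f (t, x)| ^ q) ^ (p / q)) ^ (1 / p)

/-- `ã_C(t)`: average of `a(t,·)` over the ball of the cylinder. -/
def aTilde {d : ℕ} (a : Pt d → Matrix (Fin d) (Fin d) ℝ) (R : ℝ) (x₀ : Spc d) (t : ℝ)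
    (i j : Fin d) : ℝ :=
  ⨍ y in ball x₀ R, a (t, y) i j

/-- The mean oscillation of `a` w.r.t. `x` over one cylinder. -/
def aSharpCyl {d : ℕ} (a : Pt d → Matrix (Fin d) (Fin d) ℝ) (R t₀ : ℝ) (x₀ : Spc d) : ℝ≥0∞ :=
  (volume (cyl d R t₀ x₀))⁻¹ * ∫⁻ z in cyl d R t₀ x₀,
    ENNReal.ofReal (mnorm (fun i j => a z i j - aTilde a R x₀ z.1 i j))

/-- `a^♯`. -/
def aSharp {d : ℕ} (a : Pt d → Matrix (Fin d) (Fin d) ℝ) : ℝ≥0∞ :=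
  ⨆ (R : ℝ) (_ : 0 < R) (t₀ : ℝ) (x₀ : Spc d), aSharpCyl a R t₀ x₀

/-- `a^♯_ρ` (only cylinders of radius `≤ ρa`). -/
def aSharpRho {d : ℕ} (a : Pt d → Matrix (Fin d) (Fin d) ℝ) (ρa : ℝ) : ℝ≥0∞ :=
  ⨆ (R : ℝ) (_ : 0 < R) (_ : R ≤ ρa) (t₀ : ℝ) (x₀ : Spc d), aSharpCyl a R t₀ x₀

/-- Homogeneous Morrey norm `‖g‖_{Ė_{p,β}}`. -/
def morreyP {d : ℕ} (p β : ℝ) (g : Pt d → ℝ) : ℝ≥0∞ :=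
  ⨆ (ρ : ℝ) (_ : 0 < ρ) (t : ℝ) (x : Spc d),
    ENNReal.ofReal (ρ ^ β) *
      ((volume (cyl d ρ t x))⁻¹ * ∫⁻ z in cyl d ρ t x, ENNReal.ofReal |g z| ^ p) ^ (1 / p)

/-- Homogeneous mixed-norm Morrey norm `‖g‖_{Ė_{q,p,β}}`. -/
def morreyQP {d : ℕ} (q p β : ℝ) (g : Pt d → ℝ) : ℝ≥0∞ :=
  ⨆ (ρ : ℝ) (_ : 0 < ρ) (t : ℝ) (x : Spc d),
    ENNReal.ofReal (ρ ^ β) * cylNormL q p ρ t x g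

/-- Inhomogeneous mixed-norm Morrey norm `‖g‖_{E_{q,p,β}}` (radii `ρ ∈ (0,1]`). -/
def morreyI {d : ℕ} (q p β : ℝ) (g : Pt d → ℝ) : ℝ≥0∞ :=
  ⨆ (ρ : ℝ) (_ : 0 < ρ) (_ : ρ ≤ 1) (t : ℝ) (x : Spc d),
    ENNReal.ofReal (ρ ^ β) * cylNormL q p ρ t x g

/-- `b̄_{q',p',ρb}` for a vector field `b`. -/
def bBar {d : ℕ} (q' p' : ℝ) (b : Pt d → Fin d → ℝ) (ρb : ℝ) : ℝ≥0∞ :=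
  ⨆ (R : ℝ) (_ : 0 < R) (_ : R ≤ ρb) (t : ℝ) (x : Spc d),
    ENNReal.ofReal R * cylNormL q' p' R t x (fun z => vnorm (b z))

/-- Test function supported in the open set `Q`. -/
def IsTest {d : ℕ} (Q : Set (Pt d)) (φ : Pt d → ℝ) : Prop :=
  ContDiff ℝ (⊤ : ℕ∞) φ ∧ HasCompactSupport φ ∧ tsupport φ ⊆ Q

/-- `ut` is the weak time derivative of `u` on `Q`. -/
def WeakDtOn {d : ℕ} (Q : Set (Pt d)) (u ut : Pt d → ℝ) : Prop :=
  ∀ φ, IsTest Q φ → ∫ z in Q, u z * Dt φ z = - ∫ z in Q, ut z * φ z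

/-- `ui` is the weak `i`-th spatial derivative of `u` on `Q`. -/
def WeakDxOn {d : ℕ} (Q : Set (Pt d)) (i : Fin d) (u ui : Pt d → ℝ) : Prop :=
  ∀ φ, IsTest Q φ → ∫ z in Q, u z * Dx i φ z = - ∫ z in Q, ui z * φ z

open ENNReal (div_ne_top div_le_of_le_mul div_lt_iff ofReal_coe_nnreal ofReal_rpow_of_nonneg mul_top ofReal_le_ofReal_iff rpow_ne_top_of_nonneg ofReal_rpow_of_pos mul_ne_top mul_rpow_of_nonneg rpow_one rpow_add_of_nonneg rpow_le_rpow ofReal_le_ofReal ofReal_toReal toReal_nonneg add_ne_top lintegral_Lp_add_le rpow_eq_zero_iff toReal_mono lintegral_mul_le_Lp_mul_Lq zero_rpow_of_pos continuous_rpow_const ofReal_add ofReal_ne_top toReal_rpow sum_ne_top)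
open Real (rpow_nonneg rpow_neg_one norm_eq_abs enorm_of_nonneg norm_of_nonneg enorm_rpow_of_nonneg mul_rpow rpow_natCast sqrt_le_iff dist_eq sqrt_nonneg sqrt_pos sqrt_eq_rpow sq_sqrt conjExponent pow_div_factorial_le_exp fourierInv_eq' exp_nonneg pi_pos exp_le_exp add_one_le_exp exp_pos sqrt_le_sqrt exp_le_one_iff continuous_exp exp_zero)
open Function (uncurry comp_def)
open Filter (atTop liminf)
open Complex (ofRealCLM norm_real ofReal_neg ofReal_exp sub_re abs_re_le_norm normSq re_ofReal_mul reCLM continuous_ofReal continuous_re imCLM sub_im im_ofReal_mul)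
open Matrix (mulVec of_apply)
open Finset (mul_sum sum_congr sum_nonneg sum_mul sum_le_sum prod_le_prod sum_sub_distrib sum_add_distrib abs_sum_le_sum_abs sum_neg_distrib induction_on sum_insert)

notation:max "Mtx" d:max => Matrix (Fin d) (Fin d) ℝ
notation "eR" => ENNReal.ofReal
notation "eX" => Real.exp
notation "rPi" => Real.pi
notation "EE" => ENNReal
theorem evAll {α : Type*} {p : α → Prop} {f : Filter α} (h : ∀ x, p x) : ∀ᶠ x in f, p x := Filter.Eventually.of_forall h


structure Dya (X : Type) [MeasurableSpace X] (μ : Measure X) (ι : Type) where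
  π : ℤ → X → ι
  meas : ∀ k i, MeasurableSet {x | π k x = i}
  nest : ∀ k x y, π (k+1) x = π (k+1) y → π k x = π k y
  v : ℤ → EE
  D : EE
  hv : ∀ k x, μ {y | π k y = π k x} = v k
  v0 : ∀ k, v k ≠ 0
  vt : ∀ k, v k ≠ ∞
  hD : ∀ k, v k ≤ D * v (k+1)
  Dt : D ≠ ∞
  vtop : ∀ C : EE, C ≠ ∞ → ∃ k0, ∀ k ≤ k0, C < v k

namespace Dya
variable {X : Type} [MeasurableSpace X] {μ : Measure X} {ι : Type}

def av (S : Dya X μ ι) (k : ℤ) (F : X → EE) (x : X) : EE := (S.v k)⁻¹ * ∫⁻ y in {y | S.π k y = S.π k x}, F y ∂μ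

def M (S : Dya X μ ι) (F : X → EE) (x : X) : EE := ⨆ k, S.av k F x

def St (S : Dya X μ ι) (F : X → EE) (l : EE) (k : ℤ) (x : X) : Prop := l < S.av k F x ∧ ∀ j < k, S.av j F x ≤ l

open Classical in
def w (S : Dya X μ ι) (F : X → EE) (l : EE) (x y : X) : EE := ∑' k, if S.St F l k x ∧ S.π k y = S.π k x then (S.v k)⁻¹ else 0

variable (S : Dya X μ ι)
lemma nest' {j k : ℤ} (h : j ≤ k) {x y : X} : S.π k x = S.π k y → S.π j x = S.π j y := by
  obtain ⟨n, rfl⟩ := Int.le.dest h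
  induction n with
  | zero => simp
  | succ n ih =>
    intro h'
    apply ih (by omega)
    apply S.nest
    push_cast at h'
    rw [← add_assoc] at h'
    exact h'
lemma av_congr {k : ℤ} {x y : X} (F : X → EE) (h : S.π k x = S.π k y) :
    S.av k F x = S.av k F y := by
  unfold av; rw [h]
lemma St_congr {k : ℤ} {x y : X} {F : X → EE} {l : EE} (h : S.π k x = S.π k y)
    (hs : S.St F l k x) : S.St F l k y := by
  refine ⟨by rw [← S.av_congr F h]; exact hs.1, fun j hj => ?_⟩
  rw [← S.av_congr F (S.nest' hj.le h)]; exact hs.2 j hj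
lemma St_unique {j k : ℤ} {x : X} {F : X → EE} {l : EE}
    (hj : S.St F l j x) (hk : S.St F l k x) : j = k := by
  rcases lt_trichotomy j k with h | h | h
  · exact absurd (hk.2 j h) (not_le.2 hj.1)
  · exact h
  · exact absurd (hj.2 k h) (not_le.2 hk.1)
lemma exists_St {x : X} {F : X → EE} {l : EE} (hF : ∫⁻ y, F y ∂μ ≠ ∞) (hl : l ≠ 0)
    (hlt : l ≠ ∞) (h : l < S.M F x) : ∃ k, S.St F l k x := by
  obtain ⟨k1, hk1⟩ := lt_iSup_iff.1 h
  obtain ⟨k0, hk0⟩ := S.vtop ((∫⁻ y, F y ∂μ) / l) (div_ne_top hF hl)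
  have hb : ∀ k, l < S.av k F x → k0 ≤ k := by
    intro k hk
    by_contra hlt'
    have h1 := hk0 k (by omega)
    have h2 : S.av k F x ≤ l := by
      unfold av
      calc _ ≤ (S.v k)⁻¹ * ∫⁻ y, F y ∂μ := by gcongr; exact Measure.restrict_le_self
        _ ≤ l := by
          rw [mul_comm, ← div_eq_mul_inv]
          apply div_le_of_le_mul
          rw [div_lt_iff (Or.inl hl) (Or.inl hlt)] at h1
          rw [mul_comm]; exact h1.le
    exact absurd hk (not_lt.2 h2)
  obtain ⟨k, hk, hk'⟩ := Int.exists_least_of_bdd (P := fun k => l < S.av k F x) ⟨k0, hb⟩ ⟨k1, hk1⟩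
  refine ⟨k, hk, fun j hj => ?_⟩
  by_contra hc
  have := hk' j (not_le.1 hc)
  omega
lemma w_of_St {k : ℤ} {x : X} {F : X → EE} {l : EE} (hs : S.St F l k x) (y : X) :
    S.w F l x y = {y | S.π k y = S.π k x}.indicator (fun _ => (S.v k)⁻¹) y := by
  classical
  unfold w
  rw [tsum_eq_single k]
  · simp [hs, indicator]
  · intro j hj
    rw [if_neg]
    rintro ⟨h, -⟩
    exact hj (S.St_unique h hs)
lemma w_of_not {x : X} {F : X → EE} {l : EE} (hs : ∀ k, ¬ S.St F l k x) (y : X) :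
    S.w F l x y = 0 := by
  unfold w
  simp [hs]
lemma w_symm (x y : X) (F : X → EE) (l : EE) : S.w F l x y = S.w F l y x := by
  unfold w
  congr 1; ext k
  congr 1
  apply propext
  constructor
  · rintro ⟨h1, h2⟩; exact ⟨S.St_congr h2.symm h1, h2.symm⟩
  · rintro ⟨h1, h2⟩; exact ⟨S.St_congr h2.symm h1, h2.symm⟩
lemma St_iff {x : X} {F : X → EE} {l : EE} (hF : ∫⁻ y, F y ∂μ ≠ ∞) (hl : l ≠ 0)
    (hlt : l ≠ ∞) : (∃ k, S.St F l k x) ↔ l < S.M F x :=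
  ⟨fun ⟨k, hk⟩ => lt_of_lt_of_le hk.1 (le_iSup (fun k => S.av k F x) k), S.exists_St hF hl hlt⟩
lemma meas_cell (k : ℤ) (x : X) : MeasurableSet {y | S.π k y = S.π k x} := S.meas k _
lemma w_int {x : X} {F : X → EE} {l : EE} (h : ∃ k, S.St F l k x) :
    ∫⁻ y, S.w F l x y ∂μ = 1 := by
  obtain ⟨k, hk⟩ := h
  simp_rw [S.w_of_St hk]
  rw [lintegral_indicator (S.meas_cell k x), setLIntegral_const, S.hv,
    ENNReal.inv_mul_cancel (S.v0 k) (S.vt k)]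
lemma w_intF {k : ℤ} {x : X} {F : X → EE} {l : EE} (hk : S.St F l k x)
    (hF : Measurable F) : ∫⁻ y, S.w F l x y * F y ∂μ = S.av k F x := by
  simp_rw [S.w_of_St hk, ← indicator_mul_left]
  rw [lintegral_indicator (S.meas_cell k x), lintegral_const_mul _ hF]
  rfl
lemma av_le {k : ℤ} {x : X} {F : X → EE} {l : EE} (hk : S.St F l k x) :
    S.av k F x ≤ S.D * l := by
  have h := hk.2 (k-1) (by omega)
  have hsub : {y | S.π k y = S.π k x} ⊆ {y | S.π (k-1) y = S.π (k-1) x} := fun y hy => S.nest' (by omega) hy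
  have hD := S.hD (k-1)
  rw [sub_add_cancel] at hD
  unfold av at h ⊢
  have h3 : (S.v k)⁻¹ ≤ S.D * (S.v (k-1))⁻¹ := by
    rw [← div_eq_mul_inv, ENNReal.le_div_iff_mul_le (Or.inl (S.v0 _)) (Or.inl (S.vt _)),
      mul_comm, ← div_eq_mul_inv]
    exact div_le_of_le_mul hD
  calc _ ≤ S.D * (S.v (k-1))⁻¹ * ∫⁻ y in {y | S.π (k-1) y = S.π (k-1) x}, F y ∂μ :=
        mul_le_mul' h3 (lintegral_mono_set hsub)
    _ ≤ S.D * l := by rw [mul_assoc]; gcongr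

variable [Countable ι]
lemma meas_comp (k : ℤ) {α : Type} [MeasurableSpace α] (g : ι → α) :
    Measurable (fun x => g (S.π k x)) := by
  intro s _
  have : (fun x => g (S.π k x)) ⁻¹' s = ⋃ i ∈ {i | g i ∈ s}, {x | S.π k x = i} := by ext x; simp
  rw [this]
  exact MeasurableSet.biUnion (Set.to_countable _) (fun i _ => S.meas k i)
lemma meas_av (k : ℤ) (F : X → EE) : Measurable (S.av k F) := S.meas_comp k (fun i => (S.v k)⁻¹ * ∫⁻ y in {y | S.π k y = i}, F y ∂μ)
lemma meas_M (F : X → EE) : Measurable (S.M F) := Measurable.iSup (fun k => S.meas_av k F)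
lemma meas_St (F : X → EE) (l : EE) (k : ℤ) : MeasurableSet {x | S.St F l k x} := by
  have : {x | S.St F l k x} = {x | l < S.av k F x} ∩ ⋂ j : ℤ, ⋂ _ : j < k, {x | S.av j F x ≤ l} := by ext x; simp [St]
  rw [this]
  exact (measurableSet_lt measurable_const (S.meas_av k F)).inter
    (MeasurableSet.iInter fun j => MeasurableSet.iInter fun _ => measurableSet_le (S.meas_av j F) measurable_const)
lemma meas_w (F : X → EE) (l : EE) : Measurable (fun z : X × X => S.w F l z.1 z.2) := by
  unfold w
  refine Measurable.tsum fun k => ?_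
  refine Measurable.ite ?_ measurable_const measurable_const
  refine MeasurableSet.inter (measurable_fst (S.meas_St F l k)) ?_
  have : {z : X × X | S.π k z.2 = S.π k z.1} =
      ⋃ i, ({x | S.π k x = i} ×ˢ {x | S.π k x = i}) := by
    ext z; simp
  change MeasurableSet {z : X × X | S.π k z.2 = S.π k z.1}
  rw [this]
  exact MeasurableSet.iUnion fun i => (S.meas k i).prod (S.meas k i)
lemma weak {F : X → EE} (hF : Measurable F) {l : EE} (hFi : ∫⁻ y, F y ∂μ ≠ ∞) (hl : l ≠ 0)
    (hlt : l ≠ ∞) [SFinite μ] : l * μ {x | l < S.M F x} ≤ ∫⁻ y, F y ∂μ := by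
  have hm : MeasurableSet {x | l < S.M F x} := measurableSet_lt measurable_const (S.meas_M F)
  calc l * μ {x | l < S.M F x} = ∫⁻ x in {x | l < S.M F x}, l ∂μ := by
        rw [setLIntegral_const]
    _ ≤ ∫⁻ x in {x | l < S.M F x}, ∫⁻ y, S.w F l x y * F y ∂μ ∂μ := by
        refine setLIntegral_mono' hm fun x hx => ?_
        obtain ⟨k, hk⟩ := S.exists_St hFi hl hlt hx
        rw [S.w_intF hk hF]; exact hk.1.le
    _ ≤ ∫⁻ x, ∫⁻ y, S.w F l x y * F y ∂μ ∂μ := setLIntegral_le_lintegral _ _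
    _ = ∫⁻ y, ∫⁻ x, S.w F l x y * F y ∂μ ∂μ := by
        rw [lintegral_lintegral_swap]
        exact ((S.meas_w F l).mul (hF.comp measurable_snd)).aemeasurable
    _ ≤ ∫⁻ y, F y ∂μ := by
        refine lintegral_mono fun y => ?_
        have : Measurable (fun x => S.w F l x y) := (S.meas_w F l).comp (measurable_id.prodMk measurable_const)
        dsimp only
        rw [lintegral_mul_const _ this]
        simp_rw [S.w_symm _ y]
        by_cases h : ∃ k, S.St F l k y
        · rw [S.w_int h, one_mul]
        · push Not at h
          simp [S.w_of_not h]

end Dya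
lemma pw1_fin {s : ℝ} (hs : -1 < s) (c : ℝ) (hc : 0 ≤ c) :
    ∫⁻ t in Ioo (0:ℝ) c, eR (t^s) = eR (c^(s+1)/(s+1)) := by
  have hi := (intervalIntegral.intervalIntegrable_rpow' hs (a := 0) (b := c))
  rw [intervalIntegrable_iff_integrableOn_Ioo_of_le hc] at hi
  rw [← ofReal_integral_eq_lintegral_ofReal hi]
  · rw [← integral_Ioc_eq_integral_Ioo, ← intervalIntegral.integral_of_le hc,
      integral_rpow (Or.inl hs), Real.zero_rpow (by linarith), sub_zero]
  · filter_upwards [self_mem_ae_restrict measurableSet_Ioo] with t ht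
    exact rpow_nonneg ht.1.le _
lemma pw1 {s : ℝ} (hs : -1 < s) (G : EE) :
    ∫⁻ t in Ioi (0:ℝ), eR (t^s) * ({t : ℝ | eR t < G}.indicator 1 t) =
      eR (1/(s+1)) * G^(s+1) := by
  have hs' : 0 < s + 1 := by linarith
  have hfin : ∀ c : ℝ≥0, ∫⁻ t in Ioi (0:ℝ), eR (t^s) *
      ({t : ℝ | eR t < (c:EE)}.indicator 1 t) =
      eR (1/(s+1)) * (c:EE)^(s+1) := by
    intro c
    have h1 : ∀ t : ℝ, eR (t^s) * ({t : ℝ | eR t < (c:EE)}.indicator 1 t)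
       = (Iio (c:ℝ)).indicator (fun t => eR (t^s)) t ∨ t ≤ 0 := by
      intro t
      by_cases ht : t ≤ 0
      · right; exact ht
      left
      push Not at ht
      have : eR t < (c:EE) ↔ t < c := by
        rw [← ofReal_coe_nnreal, ENNReal.ofReal_lt_ofReal_iff']
        constructor
        · exact fun h => h.1
        · exact fun h => ⟨h, ht.trans h⟩
      by_cases hh : t < c <;> simp [indicator, this, hh]
    rw [setLIntegral_congr_fun (g := (Iio (c:ℝ)).indicator (fun t => eR (t^s))) measurableSet_Ioi
      (fun t ht => (h1 t).resolve_right (not_le.2 ht)), setLIntegral_indicator measurableSet_Iio,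
      inter_comm, Ioi_inter_Iio, pw1_fin hs _ (NNReal.coe_nonneg c), div_eq_mul_one_div, mul_comm, ENNReal.ofReal_mul (by positivity)]
    congr 1
    rw [← ofReal_rpow_of_nonneg (NNReal.coe_nonneg c) hs'.le, ofReal_coe_nnreal]
  induction G with
  | coe c => exact hfin c
  | top =>
    rw [ENNReal.top_rpow_of_pos hs', mul_top (by simp [hs'])]
    rw [eq_top_iff]
    have h2 : ∀ c : ℝ≥0, eR (1/(s+1)) * (c:EE)^(s+1) ≤
      ∫⁻ t in Ioi (0:ℝ), eR (t^s) * ({t : ℝ | eR t < ∞}.indicator 1 t) := by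
      intro c
      rw [← hfin c]
      refine lintegral_mono fun t => mul_le_mul_right ?_ _
      refine indicator_le_indicator_of_subset ?_ (fun _ => zero_le_one) t
      intro t ht; exact lt_trans ht ENNReal.coe_lt_top
    refine le_of_forall_lt fun b hb => ?_
    lift b to ℝ≥0 using hb.ne
    obtain ⟨c, hc⟩ : ∃ c : ℝ≥0, b < (1/(s+1)).toNNReal * c^(s+1) := by
      have hpos : 0 < (1/(s+1)).toNNReal := by simp [hs']
      refine ⟨((b + 1) / (1/(s+1)).toNNReal)^(1/(s+1)), ?_⟩
      rw [← NNReal.rpow_mul, one_div_mul_cancel hs'.ne', NNReal.rpow_one, mul_div_cancel₀ _ hpos.ne']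
      exact lt_add_one b
    refine lt_of_lt_of_le ?_ (h2 c)
    rw [ENNReal.ofReal, ← ENNReal.coe_rpow_of_nonneg _ hs'.le, ← ENNReal.coe_mul]
    exact_mod_cast hc
lemma pw2 {s q : ℝ} (hs : s < -1) (hq : 0 < q) (F : EE) (hF : F ≠ ∞) :
    ∫⁻ t in Ioi (0:ℝ), eR (t^s) * ({t : ℝ | F ≤ eR t}.indicator (fun _ => F^q) t) ≤
      eR (1/(-s-1)) * F^(q+s+1) := by
  lift F to ℝ≥0 using hF
  by_cases h0 : F = 0
  · subst h0
    simp [hq]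
  have hFp : 0 < (F:ℝ) := by positivity
  calc _ = ∫⁻ t in Ioi (0:ℝ), (Ici (F:ℝ)).indicator (fun t => eR (t^s) * F^q) t := by
        refine setLIntegral_congr_fun measurableSet_Ioi fun t ht => ?_
        have : (F:EE) ≤ eR t ↔ F ≤ t := by rw [← ofReal_coe_nnreal, ofReal_le_ofReal_iff (le_of_lt ht)]
        by_cases hh : F ≤ t <;> simp [indicator, this, hh]
    _ ≤ ∫⁻ t, (Ici (F:ℝ)).indicator (fun t => eR (t^s) * F^q) t := setLIntegral_le_lintegral _ _
    _ = (∫⁻ t in Ioi (F:ℝ), eR (t^s)) * F^q := by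
        rw [lintegral_indicator measurableSet_Ici, setLIntegral_congr Ioi_ae_eq_Ici.symm,
          lintegral_mul_const']
        exact rpow_ne_top_of_nonneg hq.le (by simp)
    _ = eR (1/(-s-1)) * F^(q+s+1) := by
        rw [← ofReal_integral_eq_lintegral_ofReal (integrableOn_Ioi_rpow_of_lt hs hFp),
          integral_Ioi_rpow_of_lt hs hFp]
        · have : -(F:ℝ)^(s+1)/(s+1) = 1/(-s-1) * (F:ℝ)^(s+1) := by
            rw [neg_div, ← div_neg, neg_add', one_div, mul_comm, div_eq_mul_inv]
          rw [this, ENNReal.ofReal_mul (by apply one_div_nonneg.2; linarith), mul_assoc,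
            ← ofReal_rpow_of_pos hFp, ofReal_coe_nnreal,
            ← ENNReal.rpow_add _ _ (by simpa using h0) (by simp)]
          congr 2; ring
        · filter_upwards [self_mem_ae_restrict measurableSet_Ioi] with t ht
          exact rpow_nonneg (hFp.le.trans (le_of_lt ht)) _

namespace Dya
variable {X : Type} [MeasurableSpace X] {μ : Measure X} {ι : Type}
variable (S : Dya X μ ι)
lemma M_mono {F G : X → EE} (h : ∀ x, F x ≤ G x) (x : X) : S.M F x ≤ S.M G x := by
  refine iSup_mono fun k => ?_
  unfold av
  gcongr with y
  exact h y
lemma M_add {F G : X → EE} (hF : Measurable F) (x : X) :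
    S.M (fun y => F y + G y) x ≤ S.M F x + S.M G x := by
  refine iSup_le fun k => ?_
  unfold av
  rw [lintegral_add_left hF, mul_add]
  exact add_le_add (le_iSup (fun k => S.av k F x) k) (le_iSup (fun k => S.av k G x) k)
lemma M_const_le {F : X → EE} {c : EE} (h : ∀ x, F x ≤ c) (x : X) : S.M F x ≤ c := by
  refine iSup_le fun k => ?_
  unfold av
  calc _ ≤ (S.v k)⁻¹ * ∫⁻ y in {y | S.π k y = S.π k x}, c ∂μ := by gcongr with y; exact h y
    _ = c := by rw [setLIntegral_const, S.hv, mul_left_comm, ENNReal.inv_mul_cancel (S.v0 k) (S.vt k), mul_one]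

variable [Countable ι]
lemma weak' [SFinite μ] {F : X → EE} (hF : Measurable F) {l : EE} (hFi : ∫⁻ y, F y ∂μ ≠ ∞) (hl : l ≠ 0)
    (hlt : l ≠ ∞) : μ {x | l < S.M F x} ≤ 2 * l⁻¹ * ∫⁻ y, {y | l/2 < F y}.indicator F y ∂μ := by
  have hm : MeasurableSet {y | l/2 < F y} := measurableSet_lt measurable_const hF
  have hl2 : l/2 ≠ 0 := by simp [hl]
  have hl2t : l/2 ≠ ∞ := div_ne_top hlt (by simp)
  have hsub : {x | l < S.M F x} ⊆ {x | l/2 < S.M ({y | l/2 < F y}.indicator F) x} := by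
    intro x hx
    have h1 : S.M F x ≤ S.M ({y | l/2 < F y}.indicator F) x + l/2 := by
      refine (S.M_mono (G := fun y => ({y | l/2 < F y}.indicator F) y + l/2) ?_ x).trans
        ((S.M_add (hF.indicator hm) x).trans ?_)
      · intro y
        by_cases hy : l/2 < F y
        · simp [indicator, hy]
        · simp [indicator, hy]; exact not_lt.1 hy
      · gcongr; exact S.M_const_le (fun _ => le_rfl) x
    by_contra hc
    simp only [mem_ofPred_eq, not_lt] at hc hx
    refine absurd (hx.trans_le (h1.trans (add_le_add_left hc _))) ?_
    simp
  have hw := S.weak (hF.indicator hm) (l := l/2)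
    (ne_top_of_le_ne_top hFi (lintegral_mono (indicator_le_self _ _))) hl2 hl2t
  calc _ ≤ μ {x | l/2 < S.M ({y | l/2 < F y}.indicator F) x} := measure_mono hsub
    _ ≤ (l/2)⁻¹ * ∫⁻ y, {y | l/2 < F y}.indicator F y ∂μ := by
      rw [mul_comm, ← div_eq_mul_inv, ENNReal.le_div_iff_mul_le (Or.inl hl2) (Or.inl hl2t), mul_comm]
      exact hw
    _ = _ := by rw [ENNReal.inv_div (by simp) (by simp)]; rfl
lemma ae_le_M [SFinite μ] [TopologicalSpace X] [BorelSpace X] [μ.WeaklyRegular]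
    (hU : ∀ x, ∀ U : Set X, IsOpen U → x ∈ U → ∃ k, ∀ y, S.π k y = S.π k x → y ∈ U)
    {F : X → EE} (hF : Measurable F) (hFi : ∫⁻ y, F y ∂μ ≠ ∞) : ∀ᵐ x ∂μ, F x ≤ S.M F x := by
  have hlsc : ∀ G : X → EE, LowerSemicontinuous G → ∀ x, G x ≤ S.M G x := by
    intro G hG x
    refine le_of_forall_lt fun b hb => ?_
    obtain ⟨c, hbc, hc⟩ := exists_between hb
    obtain ⟨k, hk⟩ := hU x _ (hG.isOpen_preimage c) hc
    refine lt_of_lt_of_le hbc (le_trans ?_ (le_iSup (fun k => S.av k G x) k))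
    unfold av
    calc c = (S.v k)⁻¹ * ∫⁻ y in {y | S.π k y = S.π k x}, c ∂μ := by
          rw [setLIntegral_const, S.hv, mul_left_comm, ENNReal.inv_mul_cancel (S.v0 k) (S.vt k), mul_one]
      _ ≤ _ := by
          gcongr 1
          refine setLIntegral_mono' (S.meas_cell k x) fun y hy => ?_
          exact (hk y hy).le
  have key : ∀ l : EE, l ≠ 0 → l ≠ ∞ → μ {x | S.M F x + l < F x} = 0 := by
    intro l hl hlt
    have : ∀ ε : EE, ε ≠ 0 → ε ≠ ∞ → μ {x | S.M F x + l < F x} ≤ l⁻¹ * ε := by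
      intro ε hε hεt
      obtain ⟨G, hFG, hGl, hGi⟩ := exists_le_lowerSemicontinuous_lintegral_ge μ F hF hε
      have hGF : ∫⁻ y, (G y - F y) ∂μ ≤ ε := by
        rw [lintegral_sub hF hFi (evAll hFG)]
        exact tsub_le_iff_left.2 hGi
      have hmeas : Measurable (fun y => G y - F y) := hGl.measurable.sub hF
      have hw := S.weak hmeas (ne_top_of_le_ne_top hεt hGF) hl hlt
      calc _ ≤ μ {x | l < S.M (fun y => G y - F y) x} := by
            refine measure_mono fun x hx => ?_
            simp only [mem_ofPred_eq] at hx ⊢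
            have h1 : S.M F x + l < S.M F x + S.M (fun y => G y - F y) x := by
              refine hx.trans_le ((hFG x).trans ((hlsc G hGl x).trans ?_))
              refine le_trans (S.M_mono (fun y => ?_) x) (S.M_add hF x)
              exact le_add_tsub
            exact lt_of_add_lt_add_left h1
        _ ≤ l⁻¹ * ε := by
            rw [mul_comm l⁻¹, ← div_eq_mul_inv, ENNReal.le_div_iff_mul_le (Or.inl hl) (Or.inl hlt), mul_comm]
            exact hw.trans hGF
    refine le_antisymm (ENNReal.le_of_forall_pos_le_add fun e he _ => ?_) bot_le
    have := this (l * e) (by simp [hl, he.ne']) (mul_ne_top hlt (by simp))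
    rwa [← mul_assoc, ENNReal.inv_mul_cancel hl hlt, one_mul, ← zero_add (e:EE)] at this
  have hall : ∀ᵐ x ∂μ, ∀ n : ℕ, F x ≤ S.M F x + ((n:EE)+1)⁻¹ := by
    rw [ae_all_iff]
    intro n
    have := key ((n:EE)+1)⁻¹ (by simp) (by simp)
    rw [ae_iff]; simpa using this
  filter_upwards [hall] with x hx
  refine ENNReal.le_of_forall_pos_le_add fun e he _ => ?_
  obtain ⟨n, hn⟩ := ENNReal.exists_inv_nat_lt (show (e:EE) ≠ 0 by simp [he.ne'])
  refine (hx n).trans ?_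
  gcongr
  refine le_trans ?_ hn.le
  gcongr
  exact le_self_add

end Dya
lemma Dya.marc {X : Type} [MeasurableSpace X] {μ : Measure X} {ι : Type} [Countable ι]
    (S : Dya X μ ι) [SFinite μ] {p q : ℝ} (hp : 1 < p) (hpq : p < q) (A c : EE)
    {F G : X → EE} (hF : Measurable F) (hFt : ∀ x, F x ≠ ∞)
    (hFi : ∫⁻ y, F y ∂μ ≠ ∞) (hG : Measurable G)
    (h : ∀ l : ℝ, 0 < l → μ {x | 2 * eR l < G x} ≤
      A * eR (l^(-q)) * ∫⁻ x, {x | F x ≤ eR l}.indicator (fun x => F x^q) x ∂μ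
        + c * μ {x | eR l < S.M F x}) :
    ∫⁻ x, G x ^ p ∂μ ≤ eR (2^p * p) * (A * eR (1/(q-p)) + c * (2 * (eR (1/(p-1)) * 2^(p-1)))) * ∫⁻ x, F x ^ p ∂μ := by
  have hp0 : 0 < p := by linarith
  have hmI : ∀ {H : X → EE}, Measurable H → MeasurableSet {z : X × ℝ | eR z.2 < H z.1} := fun hH => measurableSet_lt (ENNReal.measurable_ofReal.comp measurable_snd) (hH.comp measurable_fst)
  have e1 : ∫⁻ x, G x ^ p ∂μ = eR (2^p * p) * ∫⁻ l in Ioi (0:ℝ), eR (l^(p-1)) *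
      μ {x | 2 * eR l < G x} := by
    have hpt : ∀ x, G x ^ p = eR (2^p * p) * ∫⁻ l in Ioi (0:ℝ), eR (l^(p-1)) *
        ({l : ℝ | eR l < G x / 2}.indicator 1 l) := by
      intro x
      rw [pw1 (by linarith), sub_add_cancel, ← mul_assoc, ← ENNReal.ofReal_mul (by positivity),
        mul_assoc, mul_one_div_cancel hp0.ne', mul_one, ENNReal.div_rpow_of_nonneg _ _ hp0.le,
        ← ofReal_rpow_of_pos (by norm_num), ENNReal.ofReal_ofNat, ENNReal.mul_div_cancel]
      · simp
      · simp
    have hm2 := hmI (hG.div_const 2)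
    have hmm : Measurable (fun z : X × ℝ => eR (z.2^(p-1)) *
        ({l : ℝ | eR l < G z.1 / 2}.indicator (1 : ℝ → EE) z.2)) := by
      refine Measurable.mul (by fun_prop) ?_
      exact (measurable_one (α := EE)).indicator hm2
    simp_rw [hpt]
    rw [lintegral_const_mul]
    · congr 1
      rw [lintegral_lintegral_swap hmm.aemeasurable]
      refine lintegral_congr fun l => ?_
      have hms : MeasurableSet {x | 2 * eR l < G x} := measurableSet_lt measurable_const hG
      rw [lintegral_const_mul, ← lintegral_indicator_one hms]
      · congr 1
        refine lintegral_congr fun x => ?_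
        have : eR l < G x / 2 ↔ 2 * eR l < G x := by rw [ENNReal.lt_div_iff_mul_lt (by simp) (by simp), mul_comm]
        simp [indicator, this]
      · exact (measurable_one (α := EE)).indicator (hm2.preimage measurable_prodMk_right)
    · exact hmm.lintegral_prod_right'
  have e2 : ∫⁻ l in Ioi (0:ℝ), eR (l^(p-1)) * (A * eR (l^(-q)) * ∫⁻ x, {x | F x ≤ eR l}.indicator (fun x => F x^q) x ∂μ) ≤ A * eR (1/(q-p)) * ∫⁻ x, F x ^ p ∂μ := by
    have hmm : Measurable (fun z : ℝ × X => eR (z.1^(p-1-q)) *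
        ({l : ℝ | F z.2 ≤ eR l}.indicator (fun _ => F z.2^q) z.1)) := by
      refine Measurable.mul (by fun_prop) ?_
      exact ((hF.comp measurable_snd).pow_const q).indicator (s := {z : ℝ × X | F z.2 ≤ eR z.1})
        (measurableSet_le (hF.comp measurable_snd) (ENNReal.measurable_ofReal.comp measurable_fst))
    calc _ = ∫⁻ l in Ioi (0:ℝ), A * ∫⁻ x, eR (l^(p-1-q)) *
        ({l : ℝ | F x ≤ eR l}.indicator (fun _ => F x^q) l) ∂μ := by
          refine setLIntegral_congr_fun measurableSet_Ioi fun l hl => ?_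
          rw [lintegral_const_mul, mul_assoc, mul_left_comm, ← mul_assoc (eR _),
            ← ENNReal.ofReal_mul (rpow_nonneg (le_of_lt hl) _), ← Real.rpow_add hl]
          · rfl
          · exact (hF.pow_const q).indicator (measurableSet_le hF measurable_const)
      _ = A * ∫⁻ x, (∫⁻ l in Ioi (0:ℝ), eR (l^(p-1-q)) *
        ({l : ℝ | F x ≤ eR l}.indicator (fun _ => F x^q) l)) ∂μ := by rw [lintegral_const_mul _ (hmm.lintegral_prod_right'), lintegral_lintegral_swap hmm.aemeasurable]
      _ ≤ A * ∫⁻ x, eR (1/(q-p)) * F x ^ p ∂μ := by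
          gcongr with x
          refine (pw2 (by linarith) (by linarith) (F x) (hFt x)).trans_eq ?_
          congr 3 <;> ring
      _ = _ := by rw [lintegral_const_mul _ (hF.pow_const p), mul_assoc]
  have e3 : ∫⁻ l in Ioi (0:ℝ), eR (l^(p-1)) * (c * μ {x | eR l < S.M F x}) ≤
      c * (2 * (eR (1/(p-1)) * 2^(p-1))) * ∫⁻ x, F x ^ p ∂μ := by
    have hmm : Measurable (fun z : ℝ × X => eR (z.1^(p-2)) *
        ({l : ℝ | eR l < 2 * F z.2}.indicator (1 : ℝ → EE) z.1) * F z.2) := by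
      refine Measurable.mul (Measurable.mul (by fun_prop) ?_) (hF.comp measurable_snd)
      exact (measurable_one (α := EE)).indicator ((hmI (hF.const_mul 2)).preimage measurable_swap)
    calc _ ≤ ∫⁻ l in Ioi (0:ℝ), c * (2 * ∫⁻ x, eR (l^(p-2)) *
        ({l : ℝ | eR l < 2 * F x}.indicator (1 : ℝ → EE) l) * F x ∂μ) := by
          refine setLIntegral_mono' measurableSet_Ioi fun l hl => ?_
          have hl' : (0:ℝ) < l := hl
          have hw := S.weak' hF hFi (l := eR l) (by simpa using hl') (by simp)
          calc _ ≤ eR (l^(p-1)) * (c * (2 * (eR l)⁻¹ * ∫⁻ y, {y | (eR l)/2 < F y}.indicator F y ∂μ)) := by gcongr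
            _ = c * (2 * (eR (l^(p-2)) * ∫⁻ y, {y | (eR l)/2 < F y}.indicator F y ∂μ)) := by
              have : eR (l^(p-2)) = eR (l^(p-1)) * (eR l)⁻¹ := by
                rw [← ENNReal.ofReal_inv_of_pos hl', ← ENNReal.ofReal_mul (by positivity), ← rpow_neg_one l,
                  ← Real.rpow_add hl']
                congr 2; ring
              rw [this]; ring
            _ ≤ _ := by
              rw [← lintegral_const_mul]
              · refine mul_le_mul_right (mul_le_mul_right (lintegral_mono fun x => ?_) _) _
                rw [mul_assoc]
                refine mul_le_mul_right ?_ _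
                have : (eR l)/2 < F x ↔ eR l < 2 * F x := by rw [div_lt_iff (by simp) (by simp), mul_comm]
                by_cases hh : eR l < 2 * F x <;> simp [indicator, this, hh]
              · exact hF.indicator (measurableSet_lt measurable_const hF)
      _ = c * (2 * ∫⁻ x, (∫⁻ l in Ioi (0:ℝ), eR (l^(p-2)) *
        ({l : ℝ | eR l < 2 * F x}.indicator (1 : ℝ → EE) l) * F x) ∂μ) := by
          rw [lintegral_const_mul, lintegral_const_mul, lintegral_lintegral_swap hmm.aemeasurable]
          · exact hmm.lintegral_prod_right'
          · exact hmm.lintegral_prod_right'.const_mul 2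
      _ = c * (2 * ∫⁻ x, (eR (1/(p-1)) * 2^(p-1)) * F x ^ p ∂μ) := by
          congr 2
          refine lintegral_congr fun x => ?_
          rw [lintegral_mul_const' _ _ (hFt x), pw1 (by linarith), show p - 2 + 1 = p - 1 by ring,
            mul_rpow_of_nonneg _ _ (by linarith), mul_assoc, mul_assoc, mul_assoc]
          congr 2
          conv_lhs => rw [← rpow_one (F x), ← ENNReal.rpow_mul]
          conv_lhs => rw [one_mul]
          rw [← rpow_add_of_nonneg _ _ (by linarith) (by norm_num)]
          congr 1; ring
      _ = _ := by rw [lintegral_const_mul _ (hF.pow_const p)]; ring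
  rw [e1, mul_assoc]
  gcongr
  calc _ ≤ ∫⁻ l in Ioi (0:ℝ), (eR (l^(p-1)) * (A * eR (l^(-q)) * ∫⁻ x, {x | F x ≤ eR l}.indicator (fun x => F x^q) x ∂μ) + eR (l^(p-1)) * (c * μ {x | eR l < S.M F x})) := by
        refine setLIntegral_mono' measurableSet_Ioi fun l hl => ?_
        rw [← mul_add]
        gcongr
        exact h l hl
    _ ≤ _ := by
        rw [lintegral_add_right', add_mul]
        · gcongr
        · refine AEMeasurable.mul (by fun_prop) (AEMeasurable.const_mul ?_ c)
          have := measurable_measure_prodMk_left (ν := μ) ((hmI (S.meas_M F)).preimage measurable_swap)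
          exact this.aemeasurable
lemma hold_w {Sg : Type} [MeasurableSpace Sg] {m : Measure Sg} {q : ℝ} (hq : 1 < q)
    {a f F : Sg → EE} (ha : AEMeasurable a m) (hf : AEMeasurable f m) (hF : AEMeasurable F m)
    (h : ∀ᵐ s ∂m, F s ≠ ∞ ∧ (F s = 0 → f s = 0)) :
    (∫⁻ s, a s * f s ∂m)^q ≤ (∫⁻ s, a s * F s ∂m)^(q-1) * ∫⁻ s, a s * (f s^q * (F s)^(1-q)) ∂m := by
  have hq0 : 0 < q := by linarith
  have hm : AEMeasurable (fun s => a s * (f s^q * (F s)^(1-q))) m := by fun_prop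
  have h1 : ∫⁻ s, a s * f s ∂m ≤ (∫⁻ s, a s * F s ∂m)^(1-1/q) * (∫⁻ s, a s * (f s^q * (F s)^(1-q)) ∂m)^(1/q) := by
    refine le_trans ?_ (ENNReal.lintegral_mul_norm_pow_le (ha.mul hF) hm ?_ (by positivity) (by ring))
    · refine lintegral_mono_ae ?_
      filter_upwards [h] with s hs
      by_cases h0 : F s = 0
      · simp [hs.2 h0]
      have hq1 : 0 ≤ 1 - 1/q := by rw [sub_nonneg, div_le_one hq0]; exact hq.le
      rw [Pi.mul_apply, mul_rpow_of_nonneg _ _ hq1, mul_rpow_of_nonneg _ _ (by positivity : 0 ≤ 1/q),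
        mul_rpow_of_nonneg _ _ (by positivity : 0 ≤ 1/q), ← ENNReal.rpow_mul, ← ENNReal.rpow_mul,
        mul_one_div_cancel hq0.ne', rpow_one]
      have e1 : a s ^ (1-1/q) * a s ^ (1/q) = a s := by rw [← rpow_add_of_nonneg _ _ hq1 (by positivity)]; simp
      have e2 : F s ^ (1-1/q) * F s ^ ((1-q)*(1/q)) = 1 := by
        rw [← ENNReal.rpow_add _ _ h0 hs.1]
        have : 1 - 1/q + (1-q)*(1/q) = 0 := by field_simp; ring
        rw [this, ENNReal.rpow_zero]
      calc a s * f s = (a s ^ (1-1/q) * a s ^ (1/q)) * f s * (F s ^ (1-1/q) * F s ^ ((1-q)*(1/q))) := by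
            rw [e1, e2, mul_one]
        _ ≤ _ := le_of_eq (by ring)
    · rw [sub_nonneg, div_le_one hq0]; exact hq.le
  calc _ ≤ ((∫⁻ s, a s * F s ∂m)^(1-1/q) * (∫⁻ s, a s * (f s^q * (F s)^(1-q)) ∂m)^(1/q))^q := by gcongr
    _ = _ := by
      rw [mul_rpow_of_nonneg _ _ hq0.le, ← ENNReal.rpow_mul, ← ENNReal.rpow_mul,
        one_div_mul_cancel hq0.ne', rpow_one, sub_mul, one_div_mul_cancel hq0.ne', one_mul]
lemma nq_norm {Y : Type} [MeasurableSpace Y] {ν : Measure Y} {q : ℝ} (hq : 1 < q) (f : Y → EE)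
    (hf : AEMeasurable f ν) (F : EE) (hFe : F = (∫⁻ y, f y^q ∂ν)^(1/q)) (hF : F ≠ ∞) :
    ∫⁻ y, f y^q * F^(1-q) ∂ν ≤ F := by
  have hq0 : 0 < q := by linarith
  have he : ∫⁻ y, f y^q ∂ν = F^q := by rw [hFe, ← ENNReal.rpow_mul, one_div_mul_cancel hq0.ne', rpow_one]
  rw [lintegral_mul_const'' _ (by fun_prop), he]
  by_cases h0 : F = 0
  · simp [h0, hq0]
  · rw [← ENNReal.rpow_add _ _ h0 hF]; simp
lemma nq_zero {Y : Type} [MeasurableSpace Y] {ν : Measure Y} {q : ℝ} (hq : 1 < q) (f : Y → EE)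
    (hf : AEMeasurable f ν) (h : (∫⁻ y, f y^q ∂ν)^(1/q) = 0) : ∀ᵐ y ∂ν, f y = 0 := by
  have hq0 : 0 < q := by linarith
  rw [ENNReal.rpow_eq_zero_iff_of_pos (by positivity), lintegral_eq_zero_iff' (by fun_prop)] at h
  filter_upwards [h] with y hy
  simpa [hq0, hq0.le, hq0.not_gt] using hy
lemma mink {Sg Y : Type} [MeasurableSpace Sg] [MeasurableSpace Y] {m : Measure Sg} {ν : Measure Y}
    [SFinite m] [SFinite ν] {q : ℝ} (hq : 1 < q) {a : Sg → EE} {f : Sg → Y → EE}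
    (ha : Measurable a) (hf : Measurable (fun z : Sg × Y => f z.1 z.2)) {F : Sg → EE} (hF : Measurable F)
    (hFe : ∀ s, F s = (∫⁻ y, f s y^q ∂ν)^(1/q)) (hFt : ∀ s, F s ≠ ∞) :
    ∫⁻ y, (∫⁻ s, a s * f s y ∂m)^q ∂ν ≤ (∫⁻ s, a s * F s ∂m)^q := by
  have hq0 : 0 < q := by linarith
  have hfs : ∀ s, Measurable (f s) := fun s => hf.comp measurable_prodMk_left
  have hfy : ∀ y, Measurable (fun s => f s y) := fun y => hf.comp measurable_prodMk_right
  have h0 : ∀ᵐ y ∂ν, ∀ᵐ s ∂m, F s = 0 → f s y = 0 := by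
    have hms : MeasurableSet {z : Sg × Y | F z.1 = 0 → f z.1 z.2 = 0} := by
      have : {z : Sg × Y | F z.1 = 0 → f z.1 z.2 = 0} = {z | F z.1 = 0}ᶜ ∪ {z | f z.1 z.2 = 0} := by ext z; simp [imp_iff_not_or]
      rw [this]
      exact ((hF.comp measurable_fst) (measurableSet_singleton 0)).compl.union (hf (measurableSet_singleton 0))
    rw [Measure.ae_ae_comm (p := fun y s => F s = 0 → f s y = 0) (hms.preimage measurable_swap)]
    refine evAll fun s => ?_
    by_cases hs : F s = 0
    · filter_upwards [nq_zero hq (f s) (hfs s).aemeasurable (by rw [← hFe, hs])] with y hy _ using hy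
    · simp [hs]
  have hmm : Measurable (fun z : Sg × Y => a z.1 * (f z.1 z.2^q * (F z.1)^(1-q))) := by fun_prop
  calc _ ≤ ∫⁻ y, (∫⁻ s, a s * F s ∂m)^(q-1) * ∫⁻ s, a s * (f s y^q * (F s)^(1-q)) ∂m ∂ν := by
        refine lintegral_mono_ae ?_
        filter_upwards [h0] with y hy
        refine hold_w hq ha.aemeasurable (hfy y).aemeasurable hF.aemeasurable ?_
        filter_upwards [hy] with s hs using ⟨hFt s, hs⟩
    _ = (∫⁻ s, a s * F s ∂m)^(q-1) * ∫⁻ s, ∫⁻ y, a s * (f s y^q * (F s)^(1-q)) ∂ν ∂m := by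
        rw [lintegral_const_mul, lintegral_lintegral_swap]
        · exact (hmm.comp measurable_swap).aemeasurable
        · exact (hmm.comp measurable_swap).lintegral_prod_right'
    _ ≤ (∫⁻ s, a s * F s ∂m)^(q-1) * ∫⁻ s, a s * F s ∂m := by
        gcongr with s
        rw [lintegral_const_mul _ (by have := hfs s; fun_prop)]
        gcongr
        exact nq_norm hq (f s) (hfs s).aemeasurable (F s) (hFe s) (hFt s)
    _ ≤ (∫⁻ s, a s * F s ∂m)^q := by
        conv_lhs => enter [2]; rw [← rpow_one (∫⁻ s, a s * F s ∂m)]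
        rw [← rpow_add_of_nonneg _ _ (by linarith) (by norm_num)]
        simp
lemma mschur {Sg Y : Type} [MeasurableSpace Sg] [MeasurableSpace Y] {m : Measure Sg} {ν : Measure Y}
    [SFinite m] [SFinite ν] {q : ℝ} (hq : 1 < q) {k : Y → Sg → Y → EE} {f : Sg → Y → EE}
    (hk : Measurable (fun z : Y × Sg × Y => k z.1 z.2.1 z.2.2))
    (hf : Measurable (fun z : Sg × Y => f z.1 z.2)) {F H : Sg → EE} (hF : Measurable F)
    (hFe : ∀ s, F s = (∫⁻ y, f s y^q ∂ν)^(1/q)) (hFt : ∀ s, F s ≠ ∞)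
    (hH1 : ∀ s y, ∫⁻ y', k y s y' ∂ν ≤ H s) (hH2 : ∀ s y', ∫⁻ y, k y s y' ∂ν ≤ H s) :
    ∫⁻ y, (∫⁻ s, ∫⁻ y', k y s y' * f s y' ∂ν ∂m)^q ∂ν ≤ (∫⁻ s, H s * F s ∂m)^q := by
  have hq0 : 0 < q := by linarith
  have hfs : ∀ s, Measurable (f s) := fun s => hf.comp measurable_prodMk_left
  have hky : ∀ y, Measurable (fun z : Sg × Y => k y z.1 z.2) := fun y => hk.comp measurable_prodMk_left
  have hkys : ∀ y s, Measurable (k y s) := fun y s => (hky y).comp measurable_prodMk_left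
  have h0 : ∀ᵐ z ∂(m.prod ν), F z.1 = 0 → f z.1 z.2 = 0 := by
    have hms : MeasurableSet {z : Sg × Y | F z.1 = 0 → f z.1 z.2 = 0} := by
      have : {z : Sg × Y | F z.1 = 0 → f z.1 z.2 = 0} = {z | F z.1 = 0}ᶜ ∪ {z | f z.1 z.2 = 0} := by ext z; simp [imp_iff_not_or]
      rw [this]
      exact ((hF.comp measurable_fst) (measurableSet_singleton 0)).compl.union (hf (measurableSet_singleton 0))
    rw [Measure.ae_prod_iff_ae_ae hms]
    refine evAll fun s => ?_
    by_cases hs : F s = 0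
    · filter_upwards [nq_zero hq (f s) (hfs s).aemeasurable (by rw [← hFe, hs])] with y hy _ using hy
    · simp [hs]
  have hmm : Measurable (fun z : Y × (Sg × Y) => k z.1 z.2.1 z.2.2 * (f z.2.1 z.2.2^q * (F z.2.1)^(1-q))) := by
    have h2 : Measurable (fun z : Y × (Sg × Y) => f z.2.1 z.2.2) := hf.comp measurable_snd
    fun_prop
  calc _ = ∫⁻ y, (∫⁻ z, k y z.1 z.2 * f z.1 z.2 ∂(m.prod ν))^q ∂ν := by
        refine lintegral_congr fun y => ?_
        exact congrArg (fun t => t^q) (lintegral_prod (fun z : Sg × Y => k y z.1 z.2 * f z.1 z.2) ((hky y).mul hf).aemeasurable).symm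
    _ ≤ ∫⁻ y, (∫⁻ z, k y z.1 z.2 * F z.1 ∂(m.prod ν))^(q-1) * ∫⁻ z, k y z.1 z.2 * (f z.1 z.2^q * (F z.1)^(1-q)) ∂(m.prod ν) ∂ν := by
        refine lintegral_mono fun y => ?_
        refine hold_w (F := fun z => F z.1) hq (hky y).aemeasurable hf.aemeasurable (hF.comp measurable_fst).aemeasurable ?_
        filter_upwards [h0] with s hs using ⟨hFt _, hs⟩
    _ ≤ ∫⁻ y, (∫⁻ s, H s * F s ∂m)^(q-1) * ∫⁻ z, k y z.1 z.2 * (f z.1 z.2^q * (F z.1)^(1-q)) ∂(m.prod ν) ∂ν := by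
        refine lintegral_mono fun y => mul_le_mul_left (rpow_le_rpow ?_ (by linarith)) _
        rw [lintegral_prod (fun z : Sg × Y => k y z.1 z.2 * F z.1) ((hky y).mul (hF.comp measurable_fst)).aemeasurable]
        refine lintegral_mono fun s => ?_
        dsimp only [Function.comp]
        rw [lintegral_mul_const _ (hkys y s)]
        exact mul_le_mul_left (hH1 s y) _
    _ = (∫⁻ s, H s * F s ∂m)^(q-1) * ∫⁻ z, ∫⁻ y, k y z.1 z.2 * (f z.1 z.2^q * (F z.1)^(1-q)) ∂ν ∂(m.prod ν) := by
        rw [lintegral_const_mul, lintegral_lintegral_swap]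
        · exact hmm.aemeasurable
        · exact hmm.lintegral_prod_right'
    _ ≤ (∫⁻ s, H s * F s ∂m)^(q-1) * ∫⁻ s, H s * F s ∂m := by
        refine mul_le_mul_right ?_ _
        rw [lintegral_prod _ (by exact (hmm.comp measurable_swap).lintegral_prod_right'.aemeasurable)]
        refine lintegral_mono fun s => ?_
        calc _ ≤ ∫⁻ y', H s * (f s y'^q * (F s)^(1-q)) ∂ν := by
              refine lintegral_mono fun y' => ?_
              dsimp only
              rw [lintegral_mul_const _ (by exact hk.comp (measurable_prodMk_right (y := (s, y'))))]
              exact mul_le_mul_left (hH2 s y') _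
          _ = H s * ∫⁻ y', (f s y'^q * (F s)^(1-q)) ∂ν := lintegral_const_mul _ (by have := hfs s; fun_prop)
          _ ≤ _ := mul_le_mul_right (nq_norm hq (f s) (hfs s).aemeasurable (F s) (hFe s) (hFt s)) _
    _ ≤ (∫⁻ s, H s * F s ∂m)^q := by
        conv_lhs => enter [2]; rw [← rpow_one (∫⁻ s, H s * F s ∂m)]
        rw [← rpow_add_of_nonneg _ _ (by linarith) (by norm_num)]
        simp

structure Good {X Y : Type} [MeasurableSpace X] [MeasurableSpace Y] (μ : Measure X) (ν : Measure Y)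
    (f : X × Y → ℝ) : Prop where
  meas : Measurable f
  bdd : ∃ R : ℝ, ∀ z, |f z| ≤ R
  supp : ∃ (A : Set X) (B : Set Y), MeasurableSet A ∧ MeasurableSet B ∧ μ A ≠ ∞ ∧ ν B ≠ ∞ ∧
    ∀ z, (z.1 ∉ A ∨ z.2 ∉ B) → f z = 0

def Tk {Z : Type} [MeasurableSpace Z] (m : Measure Z) (K : Z → Z → ℝ) (f : Z → ℝ) (z : Z) : ℝ := ∫ z', K z z' * f z' ∂m

def nq {X Y : Type} [MeasurableSpace Y] (q : ℝ) (ν : Measure Y) (f : X × Y → ℝ) (x : X) : EE := (∫⁻ y, ‖f (x,y)‖ₑ^q ∂ν)^(1/q)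

section
variable {X Y : Type} [MeasurableSpace X] [MeasurableSpace Y] {μ : Measure X} {ν : Measure Y}
lemma meas_nq [SFinite ν] {q : ℝ} {f : X × Y → ℝ} (hf : Measurable f) : Measurable (nq q ν f) := by
  unfold nq
  have : Measurable (fun z : X × Y => ‖f z‖ₑ^q) := by fun_prop
  exact this.lintegral_prod_right'.pow_const _
lemma nq_pow {q : ℝ} (hq : 1 < q) (f : X × Y → ℝ) (x : X) : nq q ν f x ^ q = ∫⁻ y, ‖f (x,y)‖ₑ^q ∂ν := by
  unfold nq
  rw [← ENNReal.rpow_mul, one_div_mul_cancel (by linarith), rpow_one]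
lemma Good.nq_le {q : ℝ} (hq : 1 < q) {f : X × Y → ℝ} (hf : Good μ ν f) :
    ∃ (A : Set X) (c : EE), MeasurableSet A ∧ μ A ≠ ∞ ∧ c ≠ ∞ ∧ ∀ x, nq q ν f x ≤ A.indicator (fun _ => c) x := by
  obtain ⟨R, hR⟩ := hf.bdd
  obtain ⟨A, B, hA, hB, hAm, hBm, h⟩ := hf.supp
  have hq0 : 0 < q := by linarith
  refine ⟨A, (eR R^q * ν B)^(1/q), hA, hAm, ?_, fun x => ?_⟩
  · exact rpow_ne_top_of_nonneg (by positivity) (mul_ne_top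
      (rpow_ne_top_of_nonneg hq0.le (by simp)) hBm)
  · by_cases hx : x ∈ A
    · simp only [indicator, hx, if_true]
      unfold nq
      gcongr
      calc _ ≤ ∫⁻ y, B.indicator (fun _ => eR R^q) y ∂ν := by
            refine lintegral_mono fun y => ?_
            by_cases hy : y ∈ B
            · simp only [indicator, hy, if_true]
              gcongr
              rw [← ofReal_norm, norm_eq_abs]
              exact ofReal_le_ofReal (hR _)
            · simp [h (x,y) (Or.inr hy), hq0]
        _ = _ := by rw [lintegral_indicator hB, setLIntegral_const]
    · unfold nq
      have : ∀ y, f (x,y) = 0 := fun y => h _ (Or.inl hx)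
      simp [this, hq0]
lemma Good.nq_ne_top {q : ℝ} (hq : 1 < q) {f : X × Y → ℝ} (hf : Good μ ν f) (x : X) : nq q ν f x ≠ ∞ := by
  obtain ⟨A, c, _, _, hc, h⟩ := hf.nq_le hq
  refine ne_top_of_le_ne_top hc ((h x).trans ?_)
  exact indicator_le_self _ _ _
lemma Good.nq_int {q : ℝ} (hq : 1 < q) {f : X × Y → ℝ} (hf : Good μ ν f) {p : ℝ} (hp : 0 < p) :
    ∫⁻ x, nq q ν f x ^ p ∂μ ≠ ∞ := by
  obtain ⟨A, c, hA, hAm, hc, h⟩ := hf.nq_le hq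
  refine ne_top_of_le_ne_top ?_ (lintegral_mono (g := A.indicator (fun _ => c^p)) fun x => ?_)
  · rw [lintegral_indicator hA, setLIntegral_const]
    exact mul_ne_top (rpow_ne_top_of_nonneg hp.le hc) hAm
  · refine (rpow_le_rpow (h x) hp.le).trans ?_
    by_cases hx : x ∈ A <;> simp [indicator, hx, hp]

end

section
variable {X Y : Type} [MeasurableSpace X] [MeasurableSpace Y] {μ : Measure X} {ν : Measure Y}
  {ι : Type} (S : Dya X μ ι)
lemma Dya.w_ne_top (F : X → EE) (l : EE) (x y : X) : S.w F l x y ≠ ∞ := by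
  by_cases h : ∃ k, S.St F l k x
  · obtain ⟨k, hk⟩ := h
    rw [S.w_of_St hk]
    refine ne_top_of_le_ne_top (b := (S.v k)⁻¹) (by simp [S.v0]) (indicator_le_self _ _ _)
  · push Not at h
    simp [S.w_of_not h]
lemma Dya.w_int_le (F : X → EE) (l : EE) (x : X) : ∫⁻ y, S.w F l x y ∂μ ≤ 1 := by
  by_cases h : ∃ k, S.St F l k x
  · rw [S.w_int h]
  · push Not at h
    simp [S.w_of_not h]

variable [Countable ι] [SFinite μ] [SFinite ν]
lemma mp_e : MeasurePreserving (fun z : (X × Y) × X => ((z.1.1, z.2), z.1.2)) ((μ.prod ν).prod μ) ((μ.prod μ).prod ν) := by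
  have h1 := measurePreserving_prodAssoc μ ν μ
  have h2 := (MeasurePreserving.id μ).prod (Measure.measurePreserving_swap (μ := ν) (ν := μ))
  have h3 := (measurePreserving_prodAssoc μ μ ν).symm
  exact h3.comp (h2.comp h1)
lemma triple_int (F : X → EE) (l : EE) {k : X × Y → ℝ} (hk : Measurable k) (hki : ∫⁻ z, ‖k z‖ₑ ∂(μ.prod ν) ≠ ∞)
    {Φ : (X × X) × Y → ℝ} (hΦ : Measurable Φ) (R : ℝ) (hR : ∀ z, |Φ z| ≤ R) :
    Integrable (fun z : (X × X) × Y => (S.w F l z.1.1 z.1.2).toReal * (k (z.1.1, z.2) * Φ z)) ((μ.prod μ).prod ν) := by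
  have hw := S.meas_w F l
  have hm : Measurable (fun z : (X × X) × Y => (S.w F l z.1.1 z.1.2).toReal * (k (z.1.1, z.2) * Φ z)) := by
    have h1 : Measurable (fun z : (X × X) × Y => S.w F l z.1.1 z.1.2) := hw.comp measurable_fst
    exact h1.ennreal_toReal.mul ((by fun_prop : Measurable fun z : (X × X) × Y => k (z.1.1, z.2)).mul hΦ)
  refine ⟨hm.aestronglyMeasurable, ?_⟩
  unfold HasFiniteIntegral
  rw [← (mp_e (μ := μ) (ν := ν)).map_eq, lintegral_map (by fun_prop) (mp_e (μ := μ) (ν := ν)).measurable, lintegral_prod _ (by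
    exact (hm.enorm.comp (mp_e (μ := μ) (ν := ν)).measurable).aemeasurable)]
  refine lt_of_le_of_lt (b := ∫⁻ z, ‖k z‖ₑ * eR R ∂(μ.prod ν)) ?_ ?_
  · refine lintegral_mono fun z => ?_
    calc _ ≤ ∫⁻ x, S.w F l z.1 x * (‖k z‖ₑ * eR R) ∂μ := by
          refine lintegral_mono fun x => ?_
          dsimp only
          rw [enorm_mul, enorm_mul]
          gcongr
          · rw [enorm_of_nonneg (by positivity), ofReal_toReal (S.w_ne_top _ _ _ _)]
          · rw [← ofReal_norm, norm_eq_abs]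
            exact ofReal_le_ofReal (hR _)
      _ = (∫⁻ x, S.w F l z.1 x ∂μ) * (‖k z‖ₑ * eR R) := by rw [lintegral_mul_const _ (by exact hw.comp measurable_prodMk_left)]
      _ ≤ _ := by
          refine (mul_le_mul_left (S.w_int_le F l z.1) _).trans ?_
          rw [one_mul]
  · rw [lintegral_mul_const _ (by fun_prop)]
    exact ENNReal.mul_lt_top hki.lt_top (by simp)
lemma triple_eq (F : X → EE) (l : EE) {k : X × Y → ℝ} (hk : Measurable k) (hki : ∫⁻ z, ‖k z‖ₑ ∂(μ.prod ν) ≠ ∞)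
    {Φ : (X × X) × Y → ℝ} (hΦ : Measurable Φ) (R : ℝ) (hR : ∀ z, |Φ z| ≤ R) :
    ∫ z, (S.w F l z.1.1 z.1.2).toReal * (k (z.1.1, z.2) * Φ z) ∂((μ.prod μ).prod ν) =
      ∫ z, k z * (∫ x, (S.w F l z.1 x).toReal * Φ ((z.1, x), z.2) ∂μ) ∂(μ.prod ν) := by
  have hi := triple_int S F l hk hki hΦ R hR
  have hi2 := (mp_e (μ := μ) (ν := ν)).integrable_comp_of_integrable hi
  rw [← (mp_e (μ := μ) (ν := ν)).map_eq, integral_map (mp_e (μ := μ) (ν := ν)).measurable.aemeasurable (by rw [(mp_e (μ := μ) (ν := ν)).map_eq]; exact hi.1)]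
  refine (integral_prod _ hi2).trans ?_
  refine integral_congr_ae (evAll fun z => ?_)
  dsimp only [Function.comp]
  rw [← integral_const_mul]
  refine integral_congr_ae (evAll fun x => ?_)
  dsimp only
  ring

def gpart (F : X → EE) (l : EE) (f : X × Y → ℝ) (z : X × Y) : ℝ := {x | S.M F x ≤ l}.indicator (fun _ => f z) z.1 + ∫ x, (S.w F l z.1 x).toReal * f (x, z.2) ∂μ
lemma w_real_int {F : X → EE} {l : EE} (x : X) : Integrable (fun y => (S.w F l x y).toReal) μ := by
  refine integrable_toReal_of_lintegral_ne_top ?_ ?_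
  · exact ((S.meas_w F l).comp measurable_prodMk_left).aemeasurable
  · exact ne_top_of_le_ne_top ENNReal.one_ne_top (S.w_int_le F l x)
lemma w_real_int_eq {F : X → EE} {l : EE} (hFi : ∫⁻ y, F y ∂μ ≠ ∞) (hl : l ≠ 0)
    (hlt : l ≠ ∞) (x : X) : ∫ y, (S.w F l x y).toReal ∂μ = {x | l < S.M F x}.indicator 1 x := by
  rw [integral_toReal]
  · by_cases h : ∃ k, S.St F l k x
    · rw [S.w_int h]
      rw [S.St_iff hFi hl hlt] at h
      simp [indicator, h]
    · have h' := h
      rw [S.St_iff hFi hl hlt] at h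
      push Not at h'
      simp [S.w_of_not h', indicator, h]
  · exact ((S.meas_w F l).comp measurable_prodMk_left).aemeasurable
  · exact evAll fun y => (S.w_ne_top F l x y).lt_top
lemma gpart_good {F : X → EE} {l : EE} (hF : Measurable F) (hFi : ∫⁻ y, F y ∂μ ≠ ∞) (hl : l ≠ 0)
    (hlt : l ≠ ∞) {f : X × Y → ℝ} (hf : Good μ ν f) : Good μ ν (gpart S F l f) := by
  obtain ⟨R, hR⟩ := hf.bdd
  have hR0 : ∀ z : X × Y, 0 ≤ R := fun z => (abs_nonneg _).trans (hR z)
  obtain ⟨A, B, hA, hB, hAm, hBm, h⟩ := hf.supp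
  have hw := S.meas_w F l
  have hfm := hf.meas
  refine ⟨?_, ⟨R + R, fun z => ?_⟩, A ∪ {x | l < S.M F x}, B, hA.union
    (measurableSet_lt measurable_const (S.meas_M F)), hB, ?_, hBm, fun z hz => ?_⟩
  · unfold gpart
    refine Measurable.add ?_ ?_
    · exact hf.meas.indicator (s := {z : X × Y | S.M F z.1 ≤ l}) (measurableSet_le ((S.meas_M F).comp measurable_fst) measurable_const)
    · refine StronglyMeasurable.measurable ?_
      refine StronglyMeasurable.integral_prod_right (f := fun (z : X × Y) x => (S.w F l z.1 x).toReal * f (x, z.2)) ?_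
      refine Measurable.stronglyMeasurable ?_
      refine Measurable.mul ?_ ?_
      · have : Measurable fun z : (X × Y) × X => S.w F l z.1.1 z.2 := hw.comp (by fun_prop : Measurable fun z : (X × Y) × X => (z.1.1, z.2))
        exact this.ennreal_toReal
      · fun_prop
  · unfold gpart
    refine (abs_add_le _ _).trans (add_le_add ?_ ?_)
    · by_cases hz : S.M F z.1 ≤ l
      · simp [indicator, hz, hR]
      · simp [indicator, hz, hR0 z]
    · rw [← norm_eq_abs]
      calc _ ≤ ∫ x, (S.w F l z.1 x).toReal * R ∂μ := by
            refine norm_integral_le_of_norm_le ((w_real_int S z.1).mul_const R) ?_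
            refine evAll fun x => ?_
            rw [norm_mul, norm_of_nonneg toReal_nonneg]
            exact mul_le_mul_of_nonneg_left (hR _) toReal_nonneg
        _ ≤ R := by
            rw [integral_mul_const, w_real_int_eq S hFi hl hlt]
            refine mul_le_of_le_one_left (hR0 z) ?_
            exact indicator_le_self' (fun _ _ => zero_le_one) z.1
  · refine ne_top_of_le_ne_top ?_ (measure_union_le _ _)
    refine add_ne_top.2 ⟨hAm, ?_⟩
    intro htop
    have := S.weak hF hFi hl hlt
    rw [htop, mul_top hl] at this
    exact hFi (top_le_iff.1 this)
  · unfold gpart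
    rcases hz with hz | hz
    · have h1 : z.1 ∉ A := fun h => hz (Or.inl h)
      have h2 : ¬ l < S.M F z.1 := fun h => hz (Or.inr h)
      rw [← S.St_iff hFi hl hlt] at h2
      push Not at h2
      simp [h z (Or.inl h1), S.w_of_not h2]
    · have h3 : ∀ x, f (x, z.2) = 0 := fun x => h (x, z.2) (Or.inr hz)
      simp [h z (Or.inr hz), h3]
lemma bpart_le {F : X → EE} {l : EE} (hF : Measurable F) (hFi : ∫⁻ y, F y ∂μ ≠ ∞) (hl : l ≠ 0)
    (hlt : l ≠ ∞) {f : X × Y → ℝ} (hf : Good μ ν f) {k : X × Y → ℝ} (hk : Measurable k)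
    (hki : ∫⁻ z, ‖k z‖ₑ ∂(μ.prod ν) ≠ ∞) :
    ‖∫ z, k z * f z ∂(μ.prod ν)‖ₑ ≤ ‖∫ z, k z * gpart S F l f z ∂(μ.prod ν)‖ₑ +
      ∫⁻ s, ∫⁻ y, (S.w F l s.1 s.2 * ‖k (s.1, y) - k (s.2, y)‖ₑ) * ‖f (s.1, y)‖ₑ ∂ν ∂(μ.prod μ) := by
  obtain ⟨R, hR⟩ := hf.bdd
  have hw := S.meas_w F l
  have hfm := hf.meas
  obtain ⟨R', hR'⟩ := (gpart_good S hF hFi hl hlt hf).bdd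
  have hgm := (gpart_good S hF hFi hl hlt hf).meas
  have hkint : Integrable k (μ.prod ν) := ⟨hk.aestronglyMeasurable, hki.lt_top⟩
  have ei : ∀ {h : X × Y → ℝ} (r : ℝ), Measurable h → (∀ z, |h z| ≤ r) → Integrable (fun z => k z * h z) (μ.prod ν) := by
    intro h r hm hr
    refine hkint.mul_bdd (c := r) hm.aestronglyMeasurable (evAll fun z => ?_)
    exact hr z
  have hsw : MeasurePreserving (fun z : (X × X) × Y => ((z.1.2, z.1.1), z.2)) ((μ.prod μ).prod ν) ((μ.prod μ).prod ν) := (Measure.measurePreserving_swap (μ := μ) (ν := μ)).prod (MeasurePreserving.id ν)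
  have i1 := triple_int S F l hk hki (Φ := fun z => f (z.1.1, z.2)) (by fun_prop) R (fun z => hR _)
  have i2 := triple_int S F l hk hki (Φ := fun z => f (z.1.2, z.2)) (by fun_prop) R (fun z => hR _)
  have i2' := hsw.integrable_comp_of_integrable i2
  have e1 := triple_eq S F l hk hki (Φ := fun z => f (z.1.1, z.2)) (by fun_prop) R (fun z => hR _)
  have e2 := triple_eq S F l hk hki (Φ := fun z => f (z.1.2, z.2)) (by fun_prop) R (fun z => hR _)
  have e2' : ∫ z, (S.w F l z.1.1 z.1.2).toReal * (k (z.1.1, z.2) * f (z.1.2, z.2)) ∂((μ.prod μ).prod ν) =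
      ∫ z, (S.w F l z.1.1 z.1.2).toReal * (k (z.1.2, z.2) * f (z.1.1, z.2)) ∂((μ.prod μ).prod ν) := by
    conv_lhs => rw [← hsw.map_eq]
    rw [integral_map hsw.measurable.aemeasurable (by rw [hsw.map_eq]; exact i2.1)]
    refine integral_congr_ae (evAll fun z => ?_)
    dsimp only
    rw [S.w_symm]
  have i3 : Integrable (fun z : (X × X) × Y => (S.w F l z.1.1 z.1.2).toReal * (k (z.1.2, z.2) * f (z.1.1, z.2))) ((μ.prod μ).prod ν) := by
    refine i2'.congr (evAll fun z => ?_)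
    simp only [Function.comp]
    rw [S.w_symm]
  have key : ∫ z, k z * f z ∂(μ.prod ν) = ∫ z, k z * gpart S F l f z ∂(μ.prod ν) +
      ∫ z, (S.w F l z.1.1 z.1.2).toReal * ((k (z.1.1, z.2) - k (z.1.2, z.2)) * f (z.1.1, z.2)) ∂((μ.prod μ).prod ν) := by
    have e3 : ∫ z, (S.w F l z.1.1 z.1.2).toReal * ((k (z.1.1, z.2) - k (z.1.2, z.2)) * f (z.1.1, z.2)) ∂((μ.prod μ).prod ν)
      = ∫ z, k z * (∫ x, (S.w F l z.1 x).toReal * f (z.1, z.2) ∂μ) ∂(μ.prod ν) -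
        ∫ z, k z * (∫ x, (S.w F l z.1 x).toReal * f (x, z.2) ∂μ) ∂(μ.prod ν) := by
      rw [← e1, ← e2, e2', ← integral_sub i1 i3]
      refine integral_congr_ae (evAll fun z => ?_)
      dsimp only
      ring
    have hav : ∀ z : X × Y, f z - (∫ x, (S.w F l z.1 x).toReal * f (z.1, z.2) ∂μ) = {x | S.M F x ≤ l}.indicator (fun _ => f z) z.1 := by
      intro z
      rw [integral_mul_const, w_real_int_eq S hFi hl hlt]
      by_cases hz : S.M F z.1 ≤ l
      · simp [indicator, hz, not_lt.2 hz]
      · simp [indicator, hz, not_le.1 hz]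
    have m1 : Measurable (fun z : X × Y => ∫ x, (S.w F l z.1 x).toReal * f (z.1, z.2) ∂μ) := by
      have : (fun z : X × Y => ∫ x, (S.w F l z.1 x).toReal * f (z.1, z.2) ∂μ) = fun z => f z - {z : X × Y | S.M F z.1 ≤ l}.indicator f z := by
        ext z
        have := hav z
        rw [show {z : X × Y | S.M F z.1 ≤ l}.indicator f z = {x | S.M F x ≤ l}.indicator (fun _ => f z) z.1 from rfl, ← this]
        ring
      rw [this]
      exact hfm.sub (hfm.indicator (measurableSet_le ((S.meas_M F).comp measurable_fst) measurable_const))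
    have b1 : ∀ z : X × Y, |∫ x, (S.w F l z.1 x).toReal * f (z.1, z.2) ∂μ| ≤ R := by
      intro z
      rw [integral_mul_const, w_real_int_eq S hFi hl hlt]
      by_cases hz : S.M F z.1 ≤ l
      · simp [indicator, not_lt.2 hz, (abs_nonneg _).trans (hR z)]
      · simpa [indicator, not_le.1 hz] using hR z
    have gd : ∀ z, (∫ x, (S.w F l z.1 x).toReal * f (x, z.2) ∂μ) = gpart S F l f z - (f z - (∫ x, (S.w F l z.1 x).toReal * f (z.1, z.2) ∂μ)) := by intro z; rw [hav]; unfold gpart; ring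
    rw [e3, ← integral_sub (ei R m1 b1), ← integral_add (ei R' hgm hR')]
    · refine integral_congr_ae (evAll fun z => ?_)
      dsimp only
      rw [gd]; ring
    · simp_rw [gd]
      refine (ei R m1 b1).sub (ei (R' + (R + R)) (hgm.sub (hfm.sub m1)) ?_)
      intro z
      refine (abs_sub _ _).trans (add_le_add (hR' z) ((abs_sub _ _).trans (add_le_add (hR z) (b1 z))))
    · simp_rw [gd]
      refine (ei (R' + (R + R)) (hgm.sub (hfm.sub m1)) ?_)
      intro z
      refine (abs_sub _ _).trans (add_le_add (hR' z) ((abs_sub _ _).trans (add_le_add (hR z) (b1 z))))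
  rw [key]
  refine (enorm_add_le _ _).trans (add_le_add le_rfl ?_)
  refine (enorm_integral_le_lintegral_enorm _).trans ?_
  rw [lintegral_prod]
  · refine lintegral_mono fun s => lintegral_mono fun y => ?_
    dsimp only
    rw [enorm_mul, enorm_mul, enorm_of_nonneg toReal_nonneg, ofReal_toReal (S.w_ne_top _ _ _ _), mul_assoc]
  · have h1 : Measurable (fun z : (X × X) × Y => S.w F l z.1.1 z.1.2) := hw.comp measurable_fst
    refine (Measurable.enorm (h1.ennreal_toReal.mul ?_)).aemeasurable
    fun_prop
end

section
variable {X Y : Type} [MeasurableSpace X] [MeasurableSpace Y] {μ : Measure X} {ν : Measure Y}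
  {ι : Type} (S : Dya X μ ι) [Countable ι] [SFinite μ] [SFinite ν]
lemma meas_Tk {Z : Type} [MeasurableSpace Z] {m : Measure Z} [SFinite m] {K : Z → Z → ℝ} (hK : Measurable (fun z : Z × Z => K z.1 z.2))
    {f : Z → ℝ} (hf : Measurable f) : Measurable (Tk m K f) := by
  refine StronglyMeasurable.measurable ?_
  refine StronglyMeasurable.integral_prod_right (f := fun z z' => K z z' * f z') ?_
  exact (hK.mul (hf.comp measurable_snd)).stronglyMeasurable

def Oms (F : X → EE) (l : EE) (Nb : ℤ → ι → Set X) : Set X := ⋃ j ∈ {j : ℤ × ι | ∃ x, S.π j.1 x = j.2 ∧ S.St F l j.1 x}, Nb j.1 j.2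
lemma Oms_meas (F : X → EE) (l : EE) {Nb : ℤ → ι → Set X} (hNb : ∀ k i, MeasurableSet (Nb k i)) :
    MeasurableSet (Oms S F l Nb) :=
  MeasurableSet.biUnion (Set.to_countable _) (fun _ _ => hNb _ _)
lemma Oms_le (F : X → EE) (l : EE) {Nb : ℤ → ι → Set X} (D' : EE) (hD' : ∀ k i, μ (Nb k i) ≤ D' * S.v k) :
    μ (Oms S F l Nb) ≤ D' * μ {x | l < S.M F x} := by
  set P := {j : ℤ × ι | ∃ x, S.π j.1 x = j.2 ∧ S.St F l j.1 x} with hP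
  have hPc : P.Countable := Set.to_countable _
  have hdisj : P.PairwiseDisjoint (fun j => {x | S.π j.1 x = j.2}) := by
    intro j hj j' hj' hne
    rw [Function.onFun, Set.disjoint_left]
    intro y hy hy'
    apply hne
    obtain ⟨x, hx, hxs⟩ := hj
    obtain ⟨x', hx', hxs'⟩ := hj'
    have h1 := S.St_congr (hx.trans (Eq.symm hy)) hxs
    have h2 := S.St_congr (hx'.trans (Eq.symm hy')) hxs'
    have h3 := S.St_unique h1 h2
    refine Prod.ext h3 ?_
    have hy1 : S.π j.1 y = j.2 := hy
    have hy2 : S.π j'.1 y = j'.2 := hy'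
    rw [← hy1, ← hy2, h3]
  calc _ ≤ ∑' j : P, μ (Nb j.1.1 j.1.2) := measure_biUnion_le _ hPc _
    _ ≤ ∑' j : P, D' * μ {x | S.π j.1.1 x = j.1.2} := by
        refine ENNReal.tsum_le_tsum fun j => ?_
        obtain ⟨x, hx, _⟩ := j.2
        have := S.hv j.1.1 x
        rw [hx] at this
        rw [this]
        exact hD' _ _
    _ = D' * μ (⋃ j ∈ P, {x | S.π j.1 x = j.2}) := by rw [ENNReal.tsum_mul_left, measure_biUnion hPc hdisj (fun j _ => S.meas _ _)]
    _ ≤ _ := by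
        gcongr
        refine iUnion₂_subset fun j hj y hy => ?_
        obtain ⟨x, hx, hxs⟩ := hj
        have h1 := S.St_congr (hx.trans (Eq.symm hy)) hxs
        exact h1.1.trans_le (le_iSup (fun k => S.av k F y) _)
lemma wF_int {F : X → EE} {l : EE} (hF : Measurable F) (hFi : ∫⁻ y, F y ∂μ ≠ ∞) (hl : l ≠ 0)
    (hlt : l ≠ ∞) (x : X) :
    ∫⁻ y, S.w F l x y * F y ∂μ ≤ {x | l < S.M F x}.indicator (fun _ => S.D * l) x := by
  by_cases h : ∃ k, S.St F l k x
  · have h' := h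
    rw [S.St_iff hFi hl hlt] at h'
    obtain ⟨k, hk⟩ := h
    rw [S.w_intF hk hF]
    simp only [indicator, mem_ofPred_eq, h', if_true]
    exact S.av_le hk
  · push Not at h
    simp [S.w_of_not h]
lemma g_bound {q : ℝ} (hq : 1 < q) {f : X × Y → ℝ} (hf : Good μ ν f) {l : EE} (hl : l ≠ 0) (hlt : l ≠ ∞)
    (hae : ∀ᵐ x ∂μ, nq q ν f x ≤ S.M (nq q ν f) x) (hFi : ∫⁻ y, nq q ν f y ∂μ ≠ ∞) :
    ∫⁻ z, ‖gpart S (nq q ν f) l f z‖ₑ^q ∂(μ.prod ν) ≤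
      ∫⁻ x, {x | nq q ν f x ≤ l}.indicator (fun x => nq q ν f x^q) x ∂μ + (S.D * l)^q * μ {x | l < S.M (nq q ν f) x} := by
  have hq0 : 0 < q := by linarith
  set F := nq q ν f with hFd
  have hF : Measurable F := meas_nq hf.meas
  have hfm := hf.meas
  have hg := gpart_good S hF hFi hl hlt hf
  have hgm := hg.meas
  have hO : MeasurableSet {x | l < S.M F x} := measurableSet_lt measurable_const (S.meas_M F)
  rw [lintegral_prod _ (by fun_prop), ← setLIntegral_const, ← lintegral_indicator hO, ← lintegral_add_right _ (measurable_const.indicator hO)]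
  refine lintegral_mono_ae ?_
  filter_upwards [hae] with x hx
  by_cases h : ∃ k, S.St F l k x
  · have h' := h
    rw [S.St_iff hFi hl hlt] at h'
    obtain ⟨k, hk⟩ := h
    refine le_trans ?_ le_add_self
    simp only [indicator, mem_ofPred_eq, h', if_true]
    have : ∀ y, ‖gpart S F l f (x,y)‖ₑ ≤ ∫⁻ x', S.w F l x x' * ‖f (x', y)‖ₑ ∂μ := by
      intro y
      unfold gpart
      simp only [indicator, mem_ofPred_eq, not_le.2 h', if_false, zero_add]
      refine (enorm_integral_le_lintegral_enorm _).trans (lintegral_mono fun x' => ?_)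
      rw [enorm_mul, enorm_of_nonneg toReal_nonneg, ofReal_toReal (S.w_ne_top _ _ _ _)]
    calc _ ≤ ∫⁻ y, (∫⁻ x', S.w F l x x' * ‖f (x', y)‖ₑ ∂μ)^q ∂ν := by
          gcongr with y; exact this y
      _ ≤ (∫⁻ x', S.w F l x x' * F x' ∂μ)^q := by
          refine mink hq (a := fun x' => S.w F l x x') (f := fun x' y => ‖f (x',y)‖ₑ) ((S.meas_w F l).comp measurable_prodMk_left) (by fun_prop) hF (fun s => rfl) ?_
          exact hf.nq_ne_top hq
      _ ≤ _ := by
          gcongr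
          rw [S.w_intF hk hF]; exact S.av_le hk
  · have h' := h
    rw [S.St_iff hFi hl hlt] at h'
    push Not at h
    refine le_trans ?_ le_self_add
    have h2 : F x ≤ l := hx.trans (not_lt.1 h')
    simp only [indicator, mem_ofPred_eq, h2, if_true]
    rw [hFd, nq_pow hq]
    unfold gpart
    rw [← hFd]
    simp [S.w_of_not h, indicator, not_lt.1 h']

end

set_option maxHeartbeats 2000000 in
theorem cz {X Y : Type} [MeasurableSpace X] [MeasurableSpace Y] {μ : Measure X} {ν : Measure Y}
    {ι : Type} (S : Dya X μ ι) [Countable ι] [SFinite μ] [SFinite ν]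
    [TopologicalSpace X] [BorelSpace X] [μ.WeaklyRegular]
    (hU : ∀ x, ∀ U : Set X, IsOpen U → x ∈ U → ∃ k, ∀ y, S.π k y = S.π k x → y ∈ U)
    {p q : ℝ} (hp : 1 < p) (hpq : p < q)
    {K : X × Y → X × Y → ℝ} (hK : Measurable (fun z : (X × Y) × (X × Y) => K z.1 z.2))
    (hKi : ∀ z, ∫⁻ z', ‖K z z'‖ₑ ∂(μ.prod ν) ≠ ∞)
    (A : EE) (hA : ∀ f, Good μ ν f → ∫⁻ z, ‖Tk (μ.prod ν) K f z‖ₑ^q ∂(μ.prod ν) ≤ A * ∫⁻ z, ‖f z‖ₑ^q ∂(μ.prod ν))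
    (Nb : ℤ → ι → Set X) (hNb : ∀ k i, MeasurableSet (Nb k i)) (D' : EE) (hD' : ∀ k i, μ (Nb k i) ≤ D' * S.v k)
    (H : X → X → X → EE) (hHm : Measurable (fun z : X × (X × X) => H z.1 z.2.1 z.2.2))
    (hH1 : ∀ k x x' x'', S.π k x' = S.π k x'' → x ∉ Nb k (S.π k x') → ∀ y, ∫⁻ y', ‖K (x,y) (x',y') - K (x,y) (x'',y')‖ₑ ∂ν ≤ H x x' x'')
    (hH2 : ∀ k x x' x'', S.π k x' = S.π k x'' → x ∉ Nb k (S.π k x') → ∀ y', ∫⁻ y, ‖K (x,y) (x',y') - K (x,y) (x'',y')‖ₑ ∂ν ≤ H x x' x'')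
    (B : EE) (hH3 : ∀ k x' x'', S.π k x' = S.π k x'' → ∫⁻ x in (Nb k (S.π k x'))ᶜ, H x x' x'' ∂μ ≤ B)
    {f : X × Y → ℝ} (hf : Good μ ν f) :
    ∫⁻ x, nq q ν (Tk (μ.prod ν) K f) x ^ p ∂μ ≤
      eR (2^p * p) * (A * eR (1/(q-p)) + (A * S.D^q + D' + B * S.D) * (2 * (eR (1/(p-1)) * 2^(p-1)))) * ∫⁻ x, nq q ν f x ^ p ∂μ := by
  have hq : 1 < q := hp.trans hpq
  have hq0 : 0 < q := by linarith
  have hfm := hf.meas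
  set F := nq q ν f with hFd
  have hF : Measurable F := meas_nq hf.meas
  have hFi : ∫⁻ y, F y ∂μ ≠ ∞ := by simpa using hf.nq_int hq (p := 1) one_pos
  have hae := S.ae_le_M hU hF hFi
  refine S.marc hp hpq A _ hF (hf.nq_ne_top hq) hFi (meas_nq (meas_Tk hK hf.meas)) fun l hl => ?_
  set L := eR l with hL
  have hL0 : L ≠ 0 := by simpa [hL] using hl
  have hLt : L ≠ ∞ := by simp [hL]
  have hg := gpart_good S hF hFi hL0 hLt hf
  set g := gpart S F L f
  have hTg : Measurable (nq q ν (Tk (μ.prod ν) K g)) := meas_nq (meas_Tk hK hg.meas)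
  have hwm := S.meas_w F L
  let Bf : X → EE := fun x => ∫⁻ s, (S.w F L s.1 s.2 * H x s.1 s.2) * F s.1 ∂(μ.prod μ)
  have hBm' : Measurable (fun z : X × (X × X) => (S.w F L z.2.1 z.2.2 * H z.1 z.2.1 z.2.2) * F z.2.1) := by refine ((hwm.comp measurable_snd).mul hHm).mul (by fun_prop)
  have hBm : Measurable Bf := hBm'.lintegral_prod_right'
  have hOm := Oms_meas S F L hNb
  have hw0 : ∀ x ∉ Oms S F L Nb, ∀ s : X × X, S.w F L s.1 s.2 ≠ 0 → ∃ k, S.π k s.1 = S.π k s.2 ∧ x ∉ Nb k (S.π k s.1) := by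
    intro x hx s hs
    by_cases h : ∃ k, S.St F L k s.1
    · obtain ⟨k, hk⟩ := h
      rw [S.w_of_St hk] at hs
      have h2 := mem_of_indicator_ne_zero hs
      refine ⟨k, Eq.symm h2, fun hc => hx ?_⟩
      exact mem_biUnion (show ((k, S.π k s.1) : ℤ × ι) ∈ _ from ⟨s.1, rfl, hk⟩) hc
    · push Not at h
      exact absurd (S.w_of_not h _) hs
  have c1 : ∀ x ∉ Oms S F L Nb, nq q ν (Tk (μ.prod ν) K f) x ≤ nq q ν (Tk (μ.prod ν) K g) x + Bf x := by
    intro x hx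
    let b : Y → EE := fun y => ∫⁻ s, ∫⁻ y', (S.w F L s.1 s.2 * ‖K (x,y) (s.1, y') - K (x,y) (s.2, y')‖ₑ) * ‖f (s.1, y')‖ₑ ∂ν ∂(μ.prod μ)
    have hkm : Measurable (fun z : Y × (X × X) × Y => S.w F L z.2.1.1 z.2.1.2 * ‖K (x,z.1) (z.2.1.1, z.2.2) - K (x,z.1) (z.2.1.2, z.2.2)‖ₑ) := by
      refine Measurable.mul (hwm.comp (by fun_prop : Measurable fun z : Y × (X × X) × Y => z.2.1)) (Measurable.enorm (Measurable.sub ?_ ?_))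
      · exact hK.comp (by fun_prop : Measurable fun z : Y × (X × X) × Y => ((x, z.1), (z.2.1.1, z.2.2)))
      · exact hK.comp (by fun_prop : Measurable fun z : Y × (X × X) × Y => ((x, z.1), (z.2.1.2, z.2.2)))
    have hb : ∫⁻ y, b y^q ∂ν ≤ (Bf x)^q := by
      refine mschur (Sg := X × X) (m := μ.prod μ) (ν := ν) hq (k := fun y (s : X × X) y' => S.w F L s.1 s.2 * ‖K (x,y) (s.1, y') - K (x,y) (s.2, y')‖ₑ)
        (f := fun (s : X × X) y' => ‖f (s.1, y')‖ₑ) (F := fun s : X × X => F s.1) (H := fun s : X × X => S.w F L s.1 s.2 * H x s.1 s.2) hkm (by fun_prop) (hF.comp measurable_fst) (fun s => rfl) (fun s => hf.nq_ne_top hq _) ?_ ?_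
      · intro s y
        by_cases h0 : S.w F L s.1 s.2 = 0
        · simp [h0]
        · obtain ⟨k, h1, h2⟩ := hw0 x hx s h0
          rw [lintegral_const_mul' _ _ (S.w_ne_top _ _ _ _)]
          gcongr
          exact hH1 k x _ _ h1 h2 y
      · intro s y
        by_cases h0 : S.w F L s.1 s.2 = 0
        · simp [h0]
        · obtain ⟨k, h1, h2⟩ := hw0 x hx s h0
          rw [lintegral_const_mul' _ _ (S.w_ne_top _ _ _ _)]
          gcongr
          exact hH2 k x _ _ h1 h2 y
    have hbm : Measurable b := by
      have h1 : Measurable (fun z : (Y × (X × X)) × Y => (S.w F L z.1.2.1 z.1.2.2 * ‖K (x,z.1.1) (z.1.2.1, z.2) - K (x,z.1.1) (z.1.2.2, z.2)‖ₑ) * ‖f (z.1.2.1, z.2)‖ₑ) := by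
        refine Measurable.mul ?_ (by fun_prop)
        exact hkm.comp (by fun_prop : Measurable fun z : (Y × (X × X)) × Y => (z.1.1, (z.1.2, z.2)))
      exact h1.lintegral_prod_right'.lintegral_prod_right'
    have hTgm : Measurable (fun y => ‖Tk (μ.prod ν) K g (x,y)‖ₑ) := ((meas_Tk hK hg.meas).comp measurable_prodMk_left).enorm
    calc _ ≤ (∫⁻ y, ((fun y => ‖Tk (μ.prod ν) K g (x,y)‖ₑ) + b) y^q ∂ν)^(1/q) := by
          unfold nq
          gcongr with y
          exact bpart_le S hF hFi hL0 hLt hf (hK.comp measurable_prodMk_left) (hKi (x,y))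
      _ ≤ (∫⁻ y, ‖Tk (μ.prod ν) K g (x,y)‖ₑ^q ∂ν)^(1/q) + (∫⁻ y, b y^q ∂ν)^(1/q) := lintegral_Lp_add_le hTgm.aemeasurable hbm.aemeasurable hq.le
      _ ≤ _ := by
          refine add_le_add le_rfl ?_
          refine (rpow_le_rpow hb (by positivity : 0 ≤ 1/q)).trans (le_of_eq ?_)
          rw [← ENNReal.rpow_mul, mul_one_div_cancel hq0.ne', rpow_one]
  have c2 : ∫⁻ x in (Oms S F L Nb)ᶜ, Bf x ∂μ ≤ B * S.D * L * μ {x | L < S.M F x} := by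
    calc _ = ∫⁻ s, ∫⁻ x in (Oms S F L Nb)ᶜ, (S.w F L s.1 s.2 * H x s.1 s.2) * F s.1 ∂μ ∂(μ.prod μ) := by
          exact lintegral_lintegral_swap hBm'.aemeasurable
      _ ≤ ∫⁻ s, (S.w F L s.1 s.2 * F s.1) * B ∂(μ.prod μ) := by
          refine lintegral_mono fun s => ?_
          dsimp only
          have hHs : Measurable fun x => H x s.1 s.2 := hHm.comp (measurable_prodMk_right (y := s))
          have : ∀ x, (S.w F L s.1 s.2 * H x s.1 s.2) * F s.1 = (S.w F L s.1 s.2 * F s.1) * H x s.1 s.2 := fun x => by ring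
          simp_rw [this]
          rw [lintegral_const_mul _ hHs]
          by_cases h0 : S.w F L s.1 s.2 = 0
          · simp [h0]
          gcongr
          by_cases h : ∃ k, S.St F L k s.1
          · obtain ⟨k, hk⟩ := h
            have h1 := h0
            rw [S.w_of_St hk] at h1
            have h2 := mem_of_indicator_ne_zero h1
            refine le_trans (lintegral_mono_set ?_) (hH3 k s.1 s.2 (Eq.symm h2))
            apply compl_subset_compl.2
            exact subset_biUnion_of_mem (u := fun j : ℤ × ι => Nb j.1 j.2) (show ((k, S.π k s.1) : ℤ × ι) ∈ {j : ℤ × ι | ∃ x, S.π j.1 x = j.2 ∧ S.St F L j.1 x} from ⟨s.1, rfl, hk⟩)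
          · push Not at h
            exact absurd (S.w_of_not h _) h0
      _ = (∫⁻ x, ∫⁻ x', S.w F L x x' * F x' ∂μ ∂μ) * B := by
          rw [lintegral_mul_const _ (by exact hwm.mul (hF.comp measurable_fst)), lintegral_prod_symm _ (by exact (hwm.mul (hF.comp measurable_fst)).aemeasurable)]
          congr 1
          refine lintegral_congr fun x => lintegral_congr fun x' => ?_
          dsimp only
          rw [S.w_symm]
      _ ≤ (∫⁻ x, {x | L < S.M F x}.indicator (fun _ => S.D * L) x ∂μ) * B := by
          gcongr with x
          exact wF_int S hF hFi hL0 hLt x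
      _ = _ := by rw [lintegral_indicator (measurableSet_lt measurable_const (S.meas_M F)), setLIntegral_const]; ring
  have c3 : μ {x | L < nq q ν (Tk (μ.prod ν) K g) x} ≤ eR (l^(-q)) * (A * (∫⁻ x, {x | F x ≤ L}.indicator (fun x => F x^q) x ∂μ + (S.D * L)^q * μ {x | L < S.M F x})) := by
    have hLq0 : L^q ≠ 0 := by simp [hL0, hLt, rpow_eq_zero_iff]
    have hLqt : L^q ≠ ∞ := rpow_ne_top_of_nonneg hq0.le hLt
    calc _ ≤ μ {x | L^q ≤ nq q ν (Tk (μ.prod ν) K g) x^q} := by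
          refine measure_mono fun x hx => ?_
          exact rpow_le_rpow (le_of_lt hx) hq0.le
      _ ≤ (∫⁻ x, nq q ν (Tk (μ.prod ν) K g) x^q ∂μ) / L^q := meas_ge_le_lintegral_div (hTg.pow_const q).aemeasurable hLq0 hLqt
      _ = eR (l^(-q)) * ∫⁻ z, ‖Tk (μ.prod ν) K g z‖ₑ^q ∂(μ.prod ν) := by
          rw [div_eq_mul_inv, mul_comm, ← ENNReal.rpow_neg, hL, ofReal_rpow_of_pos hl]
          congr 1
          have := meas_Tk (m := μ.prod ν) hK hg.meas
          rw [lintegral_prod _ (by fun_prop)]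
          refine lintegral_congr fun x => nq_pow hq _ x
      _ ≤ _ := by
          gcongr
          refine (hA g hg).trans ?_
          gcongr
          exact g_bound S hq hf hL0 hLt hae hFi
  have c4 : μ ({x | L < Bf x} ∩ (Oms S F L Nb)ᶜ) ≤ B * S.D * μ {x | L < S.M F x} := by
    calc _ = (μ.restrict (Oms S F L Nb)ᶜ) {x | L < Bf x} := by
          rw [Measure.restrict_apply (measurableSet_lt measurable_const hBm)]
      _ ≤ (μ.restrict (Oms S F L Nb)ᶜ) {x | L ≤ Bf x} := measure_mono fun x (hx : L < Bf x) => show L ≤ Bf x from hx.le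
      _ ≤ (∫⁻ x in (Oms S F L Nb)ᶜ, Bf x ∂μ) / L := meas_ge_le_lintegral_div hBm.aemeasurable hL0 hLt
      _ ≤ (B * S.D * L * μ {x | L < S.M F x}) / L := by gcongr
      _ = _ := by
          rw [show B * S.D * L * μ {x | L < S.M F x} = (B * S.D * μ {x | L < S.M F x}) * L by ring]
          exact ENNReal.mul_div_cancel_right hL0 hLt
  have hsub : {x | 2 * L < nq q ν (Tk (μ.prod ν) K f) x} ⊆ {x | L < nq q ν (Tk (μ.prod ν) K g) x} ∪
      (Oms S F L Nb ∪ ({x | L < Bf x} ∩ (Oms S F L Nb)ᶜ)) := by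
    intro x hx
    by_cases h1 : x ∈ Oms S F L Nb
    · exact Or.inr (Or.inl h1)
    by_cases h2 : L < nq q ν (Tk (μ.prod ν) K g) x
    · exact Or.inl h2
    · refine Or.inr (Or.inr ⟨?_, h1⟩)
      have h3 : 2 * L < L + Bf x := lt_of_lt_of_le hx ((c1 x h1).trans (add_le_add (not_lt.1 h2) le_rfl))
      rw [two_mul] at h3
      exact lt_of_add_lt_add_left h3
  refine (measure_mono hsub).trans ((measure_union_le _ _).trans ((add_le_add c3 ((measure_union_le _ _).trans (add_le_add (Oms_le S F L D' hD') c4))).trans (le_of_eq ?_)))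
  have e : eR (l^(-q)) * L^q = 1 := by rw [hL, ofReal_rpow_of_pos hl, ← ENNReal.ofReal_mul (by positivity), ← Real.rpow_add hl]; simp
  rw [mul_rpow_of_nonneg _ _ hq0.le, mul_add, mul_add]
  rw [show eR (l^(-q)) * (A * (S.D^q * L^q * μ {x | L < S.M F x})) = (eR (l^(-q)) * L^q) * (A * (S.D^q * μ {x | L < S.M F x})) by ring, e]
  ring

section
variable {X Y : Type} [MeasurableSpace X] [MeasurableSpace Y] {μ : Measure X} {ν : Measure Y}
lemma enorm_le_of_abs {x R : ℝ} (h : |x| ≤ R) : ‖x‖ₑ ≤ eR R := by rw [← ofReal_norm, norm_eq_abs]; exact ofReal_le_ofReal h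
lemma Good.lint [SFinite μ] [SFinite ν] {f : X × Y → ℝ} (hf : Good μ ν f) : ∫⁻ z, ‖f z‖ₑ ∂(μ.prod ν) ≠ ∞ := by
  obtain ⟨R, hR⟩ := hf.bdd
  obtain ⟨A, B, hA, hB, hAm, hBm, h⟩ := hf.supp
  refine ne_top_of_le_ne_top ?_ (lintegral_mono (g := (A ×ˢ B).indicator (fun _ => eR R)) fun z => ?_)
  · rw [lintegral_indicator (hA.prod hB), setLIntegral_const, Measure.prod_prod]
    exact mul_ne_top (by simp) (mul_ne_top hAm hBm)
  · by_cases hz : z ∈ A ×ˢ B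
    · simp only [indicator, hz, if_true]; exact enorm_le_of_abs (hR z)
    · rw [h z (by by_contra hc; push Not at hc; exact hz hc)]; simp
lemma Tk_bdd {Z : Type} [MeasurableSpace Z] {m : Measure Z} {K : Z → Z → ℝ} {C : EE} (hC : C ≠ ∞)
    (hK : ∀ z, ∫⁻ z', ‖K z z'‖ₑ ∂m ≤ C) {f : Z → ℝ} {R : ℝ} (hf : ∀ z, |f z| ≤ R) (z : Z) :
    |Tk m K f z| ≤ (C * eR R).toReal := by
  rw [← norm_eq_abs, ← toReal_enorm]
  refine toReal_mono (mul_ne_top hC (by simp)) ?_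
  calc _ ≤ ∫⁻ z', ‖K z z' * f z'‖ₑ ∂m := enorm_integral_le_lintegral_enorm _
    _ ≤ ∫⁻ z', ‖K z z'‖ₑ * eR R ∂m := by
        refine lintegral_mono fun z' => ?_
        rw [enorm_mul]
        exact mul_le_mul_right (enorm_le_of_abs (hf _)) _
    _ = (∫⁻ z', ‖K z z'‖ₑ ∂m) * eR R := lintegral_mul_const' _ _ (by simp)
    _ ≤ _ := by gcongr; exact hK z
lemma Tk_adj [SFinite μ] [SFinite ν] {K : X × Y → X × Y → ℝ} (hK : Measurable (fun z : (X × Y) × (X × Y) => K z.1 z.2)) {C : EE} (hC : C ≠ ∞)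
    (hKi : ∀ z, ∫⁻ z', ‖K z z'‖ₑ ∂(μ.prod ν) ≤ C) {f g : X × Y → ℝ} (hf : Good μ ν f) (hg : Good μ ν g) :
    ∫ z, Tk (μ.prod ν) K f z * g z ∂(μ.prod ν) = ∫ z, f z * Tk (μ.prod ν) (fun z z' => K z' z) g z ∂(μ.prod ν) := by
  obtain ⟨R, hR⟩ := hf.bdd
  have hfm := hf.meas
  have hgm := hg.meas
  have hi : Integrable (uncurry fun z z' => K z z' * f z' * g z) ((μ.prod ν).prod (μ.prod ν)) := by
    have hm : Measurable (uncurry fun z z' => K z z' * f z' * g z) := (hK.mul (by fun_prop)).mul (by fun_prop)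
    refine ⟨hm.aestronglyMeasurable, ?_⟩
    unfold HasFiniteIntegral
    rw [lintegral_prod _ hm.enorm.aemeasurable]
    refine lt_of_le_of_lt (b := ∫⁻ z, (C * eR R) * ‖g z‖ₑ ∂(μ.prod ν)) (lintegral_mono fun z => ?_) ?_
    · dsimp only [uncurry]
      calc _ ≤ ∫⁻ z', ‖K z z'‖ₑ * (eR R * ‖g z‖ₑ) ∂(μ.prod ν) := by
            refine lintegral_mono fun z' => ?_
            rw [enorm_mul, enorm_mul, mul_assoc]
            gcongr
            exact enorm_le_of_abs (hR _)
        _ = (∫⁻ z', ‖K z z'‖ₑ ∂(μ.prod ν)) * (eR R * ‖g z‖ₑ) := lintegral_mul_const' _ _ (by finiteness)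
        _ ≤ _ := by rw [mul_assoc]; gcongr; exact hKi z
    · rw [lintegral_const_mul _ hgm.enorm]
      exact (mul_ne_top (by finiteness) hg.lint).lt_top
  calc _ = ∫ z, ∫ z', K z z' * f z' * g z ∂(μ.prod ν) ∂(μ.prod ν) := by
        refine integral_congr_ae (evAll fun z => ?_)
        dsimp only
        rw [integral_mul_const]; rfl
    _ = _ := integral_integral_swap hi
    _ = _ := by
        refine integral_congr_ae (evAll fun z => ?_)
        dsimp only [Tk]
        rw [← integral_const_mul]
        congr 1; ext z'; ring
lemma mixed_holder [SFinite μ] [SFinite ν] {p q p' q' : ℝ} (hp : p.HolderConjugate p') (hq : q.HolderConjugate q')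
    {f g : X × Y → ℝ} (hf : Measurable f) (hg : Measurable g) :
    ∫⁻ z, ‖f z‖ₑ * ‖g z‖ₑ ∂(μ.prod ν) ≤ (∫⁻ x, nq q ν f x ^p ∂μ)^(1/p) * (∫⁻ x, nq q' ν g x ^p' ∂μ)^(1/p') := by
  rw [lintegral_prod _ (by fun_prop)]
  refine le_trans (lintegral_mono fun x => ?_) (lintegral_mul_le_Lp_mul_Lq μ hp (meas_nq hf).aemeasurable (meas_nq hg).aemeasurable)
  exact lintegral_mul_le_Lp_mul_Lq ν hq (f := fun y => ‖f (x,y)‖ₑ) (g := fun y => ‖g (x,y)‖ₑ) (by fun_prop) (by fun_prop)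
lemma absorb {p p' : ℝ} (hp : p.HolderConjugate p') {I A J : EE} (hI : I ≠ ∞)
    (h : I ≤ J^(1/p) * (A*I)^(1/p')) : I ≤ A^(p-1) * J := by
  have hp0 := hp.pos
  have hp0' := hp.symm.pos
  by_cases h0 : I = 0
  · simp [h0]
  have e : I^(1/p) * I^(1/p') = I := by
    rw [← ENNReal.rpow_add _ _ h0 hI]
    have := hp.inv_add_inv_eq_one
    simp [this]
  have h1 : I^(1/p) ≤ J^(1/p) * A^(1/p') := by
    have hz : I^(1/p') ≠ 0 := by simp [rpow_eq_zero_iff, h0, hI]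
    have ht : I^(1/p') ≠ ∞ := rpow_ne_top_of_nonneg (by positivity) hI
    rw [← ENNReal.mul_le_mul_iff_left hz ht, e]
    refine h.trans (le_of_eq ?_)
    rw [mul_rpow_of_nonneg _ _ (by positivity)]; ring
  have h2 := rpow_le_rpow h1 hp0.le
  rw [mul_rpow_of_nonneg _ _ hp0.le, ← ENNReal.rpow_mul, ← ENNReal.rpow_mul, ← ENNReal.rpow_mul,
    one_div_mul_cancel hp0.ne', rpow_one, rpow_one] at h2
  refine h2.trans (le_of_eq ?_)
  rw [mul_comm, ← hp.div_conj_eq_sub_one]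
  congr 2; ring

end
theorem dual {X Y : Type} [MeasurableSpace X] [MeasurableSpace Y] {μ : Measure X} {ν : Measure Y}
    [SigmaFinite μ] [SigmaFinite ν] {p q p' q' : ℝ} (hp : p.HolderConjugate p') (hq : q.HolderConjugate q')
    (hqp : q ≤ p) {K : X × Y → X × Y → ℝ} (hK : Measurable (fun z : (X × Y) × (X × Y) => K z.1 z.2)) {C : EE} (hC : C ≠ ∞)
    (hKi : ∀ z, ∫⁻ z', ‖K z z'‖ₑ ∂(μ.prod ν) ≤ C) (A : EE)
    (hA : ∀ g, Good μ ν g → ∫⁻ x, nq q' ν (Tk (μ.prod ν) (fun z z' => K z' z) g) x ^p' ∂μ ≤ A * ∫⁻ x, nq q' ν g x^p' ∂μ)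
    {f : X × Y → ℝ} (hf : Good μ ν f) :
    ∫⁻ x, nq q ν (Tk (μ.prod ν) K f) x ^ p ∂μ ≤ A^(p-1) * ∫⁻ x, nq q ν f x ^ p ∂μ := by
  have hp0 := hp.pos
  have hq0 := hq.pos
  have hq1 := hq.lt
  have hTm : Measurable (Tk (μ.prod ν) K f) := meas_Tk hK hf.meas
  set T := Tk (μ.prod ν) K f with hT
  have key : ∀ H : X × Y → ℝ, Good μ ν H → (∀ z, H z = 0 ∨ H z = T z) →
      ∫⁻ x, nq q ν H x^p ∂μ ≤ A^(p-1) * ∫⁻ x, nq q ν f x ^ p ∂μ := by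
    intro H hH hHT
    set N := nq q ν H with hN
    have hNm : Measurable N := meas_nq hH.meas
    have hNt : ∀ x, N x ≠ ∞ := hH.nq_ne_top hq1
    set g : X × Y → ℝ := fun z => SignType.sign (H z) * |H z|^(q-1) * (N z.1).toReal^(p-q) with hg
    have hHm := hH.meas
    have hge : ∀ z, ‖g z‖ₑ = ‖H z‖ₑ^(q-1) * N z.1^(p-q) := by
      intro z
      have h1 : ‖((SignType.sign (H z) : SignType) : ℝ) * |H z|^(q-1)‖ₑ = ‖H z‖ₑ^(q-1) := by
        rcases lt_trichotomy (H z) 0 with h | h | h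
        · rw [sign_neg h]; simp [enorm_rpow_of_nonneg (abs_nonneg (H z)) (by linarith : 0 ≤ q-1)]
        · rw [h]; simp [show q - 1 > 0 by linarith]
        · rw [sign_pos h]; simp [enorm_rpow_of_nonneg (abs_nonneg (H z)) (by linarith : 0 ≤ q-1)]
      simp only [hg]
      rw [enorm_mul, h1, enorm_rpow_of_nonneg toReal_nonneg (by linarith), enorm_of_nonneg toReal_nonneg, ofReal_toReal (hNt _)]
    have hHg : ∀ z, 0 ≤ H z * g z := by
      intro z
      simp only [hg]
      rw [← mul_assoc, ← mul_assoc, self_mul_sign]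
      positivity
    have hgm : Measurable g := by
      have : Measurable fun z => ((SignType.sign (H z) : SignType) : ℝ) := by
        have h1 : Measurable (fun x : ℝ => ((SignType.sign x : SignType) : ℝ)) := by
          have : (fun x : ℝ => ((SignType.sign x : SignType) : ℝ)) = fun x => if 0 < x then 1 else if x < 0 then -1 else 0 := by ext x; simp only [sign_apply]; split_ifs <;> simp
          rw [this]
          exact Measurable.ite measurableSet_Ioi measurable_const (Measurable.ite measurableSet_Iio measurable_const measurable_const)
        exact h1.comp hHm
      fun_prop
    have hg0 : ∀ z, H z = 0 → g z = 0 := fun z h => by simp [hg, h]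
    have hgg : Good μ ν g := by
      refine ⟨hgm, ?_, ?_⟩
      · obtain ⟨R, hR⟩ := hH.bdd
        obtain ⟨E, c, _, _, hc, h⟩ := hH.nq_le hq1
        refine ⟨(eR R^(q-1) * c^(p-q)).toReal, fun z => ?_⟩
        rw [← norm_eq_abs, ← toReal_enorm]
        refine toReal_mono ?_ ?_
        · refine mul_ne_top (rpow_ne_top_of_nonneg (by linarith) (by simp)) (rpow_ne_top_of_nonneg (by linarith) hc)
        · rw [hge]
          exact mul_le_mul' (rpow_le_rpow (enorm_le_of_abs (hR z)) (by linarith)) (rpow_le_rpow ((h _).trans (indicator_le_self _ _ _)) (by linarith))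
      · obtain ⟨A, B, hA, hB, hAm, hBm, h⟩ := hH.supp
        exact ⟨A, B, hA, hB, hAm, hBm, fun z hz => hg0 z (h z hz)⟩
    have hNp : ∀ x, N x^(p-q) * N x^q = N x^p := by
      intro x
      by_cases h0 : N x = 0
      · rw [h0, zero_rpow_of_pos hq0, zero_rpow_of_pos hp0, mul_zero]
      · rw [← ENNReal.rpow_add _ _ h0 (hNt x)]; congr 1; ring
    have e1 : ∀ x, nq q' ν g x ^ p' = N x^p := by
      intro x
      have h1 : ∀ y, ‖g (x,y)‖ₑ^q' = ‖H (x,y)‖ₑ^q * (N x^(p-q))^q' := by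
        intro y
        rw [hge, mul_rpow_of_nonneg _ _ hq.symm.pos.le, ← ENNReal.rpow_mul, hq.sub_one_mul_conj]
      have h2 : nq q' ν g x = N x^(p-1) := by
        unfold nq
        simp_rw [h1]
        rw [lintegral_mul_const' _ _ (rpow_ne_top_of_nonneg hq.symm.pos.le (rpow_ne_top_of_nonneg (by linarith) (hNt x))),
          ← nq_pow hq1, ← hN, mul_rpow_of_nonneg _ _ (by have := hq.symm.pos; positivity), ← ENNReal.rpow_mul, ← ENNReal.rpow_mul,
          mul_one_div_cancel hq.symm.pos.ne', rpow_one, mul_one_div, hq.div_conj_eq_sub_one]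
        by_cases h0 : N x = 0
        · rw [h0, zero_rpow_of_pos (show 0 < q - 1 by linarith), zero_rpow_of_pos (show 0 < p - 1 by linarith), zero_mul]
        · rw [← ENNReal.rpow_add _ _ h0 (hNt x)]; congr 1; ring
      rw [h2, ← ENNReal.rpow_mul, hp.sub_one_mul_conj]
    have e2 : ∫⁻ z, ‖H z * g z‖ₑ ∂(μ.prod ν) = ∫⁻ x, N x^p ∂μ := by
      rw [lintegral_prod _ (by fun_prop)]
      refine lintegral_congr fun x => ?_
      have : ∀ y, ‖H (x,y) * g (x,y)‖ₑ = N x^(p-q) * ‖H (x,y)‖ₑ^q := by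
        intro y
        rw [enorm_mul, hge]
        by_cases h0 : ‖H (x,y)‖ₑ = 0
        · rw [h0, zero_rpow_of_pos hq0, zero_mul, mul_zero]
        · rw [show ‖H (x,y)‖ₑ^q = ‖H (x,y)‖ₑ * ‖H (x,y)‖ₑ^(q-1) by
            nth_rewrite 2 [← rpow_one (‖H (x,y)‖ₑ)]
            rw [← ENNReal.rpow_add _ _ h0 enorm_ne_top]; congr 1; ring]
          ring
      simp_rw [this]
      rw [lintegral_const_mul' _ _ (rpow_ne_top_of_nonneg (by linarith) (hNt x)), ← nq_pow hq1, ← hN, hNp]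
    have hTgm : Measurable (Tk (μ.prod ν) (fun z z' => K z' z) g) := meas_Tk (K := fun z z' => K z' z) (hK.comp measurable_swap) hgm
    refine absorb hp (hH.nq_int hq1 hp0) ?_
    calc ∫⁻ x, N x^p ∂μ = eR (∫ z, H z * g z ∂(μ.prod ν)) := by
          rw [← e2, ofReal_integral_eq_lintegral_ofReal (f := fun z => H z * g z) ⟨(hHm.mul hgm).aestronglyMeasurable, ?_⟩ (evAll hHg)]
          · refine lintegral_congr fun z => ?_
            rw [enorm_of_nonneg (hHg z)]
          · unfold HasFiniteIntegral
            rw [e2]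
            exact (hH.nq_int hq1 hp0).lt_top
      _ = eR (∫ z, T z * g z ∂(μ.prod ν)) := by
          congr 2; ext z
          rcases hHT z with h | h
          · rw [hg0 z h]; simp
          · rw [h]
      _ = eR (∫ z, f z * Tk (μ.prod ν) (fun z z' => K z' z) g z ∂(μ.prod ν)) := by rw [hT, Tk_adj hK hC hKi hf hgg]
      _ ≤ ∫⁻ z, ‖f z * Tk (μ.prod ν) (fun z z' => K z' z) g z‖ₑ ∂(μ.prod ν) := by
          refine (ofReal_le_ofReal (le_abs_self _)).trans ?_
          rw [← norm_eq_abs, ofReal_norm]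
          exact enorm_integral_le_lintegral_enorm _
      _ ≤ _ := by
          simp_rw [enorm_mul]
          refine (mixed_holder hp hq hf.meas hTgm).trans ?_
          refine mul_le_mul_right (rpow_le_rpow ((hA g hgg).trans (le_of_eq ?_)) (by have := hp.symm.pos; positivity)) _
          simp_rw [e1]
  let E : ℕ → Set (X × Y) := fun n => spanningSets μ n ×ˢ spanningSets ν n
  have hE : ∀ n, MeasurableSet (E n) := fun n => (measurableSet_spanningSets μ n).prod (measurableSet_spanningSets ν n)
  have hEm : Monotone E := fun i j h => prod_mono (monotone_spanningSets μ h) (monotone_spanningSets ν h)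
  have hEu : ∀ z, ∃ n, z ∈ E n := by
    intro z
    obtain ⟨i, hi⟩ := mem_iUnion.1 (by rw [iUnion_spanningSets]; trivial : z.1 ∈ ⋃ i, spanningSets μ i)
    obtain ⟨j, hj⟩ := mem_iUnion.1 (by rw [iUnion_spanningSets]; trivial : z.2 ∈ ⋃ i, spanningSets ν i)
    exact ⟨max i j, monotone_spanningSets μ (le_max_left i j) hi, monotone_spanningSets ν (le_max_right i j) hj⟩
  have hgood : ∀ n, Good μ ν ((E n).indicator T) := by
    intro n
    obtain ⟨R, hR⟩ := hf.bdd
    refine ⟨hTm.indicator (hE n), ⟨(C * eR R).toReal, fun z => ?_⟩, ⟨spanningSets μ n, spanningSets ν n, measurableSet_spanningSets μ n, measurableSet_spanningSets ν n,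
      (measure_spanningSets_lt_top μ n).ne, (measure_spanningSets_lt_top ν n).ne, fun z hz => ?_⟩⟩
    · by_cases h : z ∈ E n
      · simp only [indicator, h, if_true]; exact Tk_bdd hC hKi hR z
      · simp only [indicator, h, if_false, abs_zero]; positivity
    · have : z ∉ E n := fun h => by
        rcases hz with h' | h'
        · exact h' h.1
        · exact h' h.2
      simp [indicator, this]
  have hmono : ∀ z, Monotone fun n => ‖(E n).indicator T z‖ₑ := by
    intro z i j hij
    by_cases h : z ∈ E i
    · simp [indicator, h, hEm hij h]
    · simp [indicator, h]
  have hlim : ∀ z, Filter.Tendsto (fun n => ‖(E n).indicator T z‖ₑ) atTop (nhds ‖T z‖ₑ) := by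
    intro z
    obtain ⟨n, hn⟩ := hEu z
    refine tendsto_const_nhds.congr' ?_
    filter_upwards [Filter.eventually_ge_atTop n] with i hi
    simp [indicator, hEm hi hn]
  have hl1 : ∀ x, Filter.Tendsto (fun n => nq q ν ((E n).indicator T) x) atTop (nhds (nq q ν T x)) := by
    intro x
    refine ((continuous_rpow_const (y := 1/q)).tendsto _).comp ?_
    refine lintegral_tendsto_of_tendsto_of_monotone (fun n => ?_) (evAll fun y => ?_) (evAll fun y => ?_)
    · have := (hgood n).meas
      fun_prop
    · intro i j hij; exact rpow_le_rpow (hmono _ hij) hq0.le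
    · exact ((continuous_rpow_const (y := q)).tendsto _).comp (hlim _)
  refine le_of_tendsto' (lintegral_tendsto_of_tendsto_of_monotone (f := fun n x => nq q ν ((E n).indicator T) x^p) (fun n => ?_) (evAll fun x => ?_) (evAll fun x => ?_)) (fun n => key _ (hgood n) fun z => ?_)
  · exact ((meas_nq (hgood n).meas).pow_const _).aemeasurable
  · intro i j hij
    refine rpow_le_rpow (rpow_le_rpow (lintegral_mono fun y => ?_) (by positivity)) hp0.le
    exact rpow_le_rpow (hmono _ hij) hq0.le
  · exact ((continuous_rpow_const (y := p)).tendsto _).comp (hl1 x)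
  · by_cases h : z ∈ E n
    · right; simp [indicator, h]
    · left; simp [indicator, h]

def Jc (E : Type) [NormedAddCommGroup E] [NormedSpace ℝ E] [MeasureSpace E] (m : ℝ) : EE := ∫⁻ x : E, eR ((1 + ‖x‖)^(-(Module.finrank ℝ E + m)))

section
variable {E : Type} [NormedAddCommGroup E] [NormedSpace ℝ E] [FiniteDimensional ℝ E] [MeasureSpace E] [BorelSpace E]
  [(volume : Measure E).IsAddHaarMeasure]
lemma Jc_ne {m : ℝ} (hm : 0 < m) : Jc E m ≠ ∞ := by
  have h := integrable_one_add_norm (E := E) (μ := volume) (r := Module.finrank ℝ E + m) (by linarith)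
  exact h.lintegral_lt_top.ne
lemma scal {m R : ℝ} (hR : 0 < R) :
    ∫⁻ x : E, eR ((R + ‖x‖)^(-(Module.finrank ℝ E + m))) = eR (R^(-m)) * Jc E m := by
  have hmap := Measure.map_addHaar_smul (volume : Measure E) hR.ne'
  set n := Module.finrank ℝ E
  have hmeas : Measurable fun x : E => eR ((R + ‖x‖)^(-((n:ℝ) + m))) := by fun_prop
  have h1 : ∫⁻ x, eR ((R + ‖x‖)^(-((n:ℝ) + m))) ∂(Measure.map (fun x : E => R • x) volume) =
      eR (R^(-((n:ℝ)+m))) * Jc E m := by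
    rw [lintegral_map hmeas (by fun_prop), Jc, ← lintegral_const_mul' _ _ (by simp)]
    refine lintegral_congr fun x => ?_
    rw [← ENNReal.ofReal_mul (by positivity), ← mul_rpow hR.le (by positivity), norm_smul, norm_of_nonneg hR.le]
    congr 2; ring
  rw [hmap, lintegral_smul_measure, smul_eq_mul] at h1
  have h2 : eR (R^(n:ℝ)) * eR |(R^n)⁻¹| = 1 := by rw [← ENNReal.ofReal_mul (by positivity), abs_of_nonneg (by positivity), rpow_natCast, mul_inv_cancel₀ (by positivity)]; simp
  have h3 := congrArg (fun a => eR (R^(n:ℝ)) * a) h1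
  rw [← mul_assoc, h2, one_mul, ← mul_assoc, ← ENNReal.ofReal_mul (by positivity), ← Real.rpow_add hR] at h3
  rw [h3]
  congr 3; ring
lemma scal' {m R : ℝ} (hR : 0 < R) (y : E) :
    ∫⁻ x : E, eR ((R + ‖x - y‖)^(-(Module.finrank ℝ E + m))) = eR (R^(-m)) * Jc E m := by
  rw [← scal hR]
  exact lintegral_sub_right_eq_self (fun x : E => eR ((R + ‖x‖)^(-(Module.finrank ℝ E + m)))) y

end

/-! dyadic structures -/
lemma floor_nest (b : ℕ) (hb : 0 < b) (k : ℤ) {x y : ℝ} (h : ⌊(b:ℝ)^(k+1) * x⌋ = ⌊(b:ℝ)^(k+1) * y⌋) :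
    ⌊(b:ℝ)^k * x⌋ = ⌊(b:ℝ)^k * y⌋ := by
  have hb' : (b:ℝ) ≠ 0 := by positivity
  have e : ∀ x : ℝ, (b:ℝ)^k * x = ((b:ℝ)^(k+1) * x) / (b:ℕ) := by intro x; rw [zpow_add_one₀ hb']; field_simp
  rw [e x, e y, Int.floor_div_natCast, Int.floor_div_natCast, h]
lemma floor_iff (b : ℕ) (hb : 0 < b) (k : ℤ) (y : ℝ) (n : ℤ) :
    ⌊(b:ℝ)^k * y⌋ = n ↔ y ∈ Ico (n * (b:ℝ)^(-k)) (n * (b:ℝ)^(-k) + (b:ℝ)^(-k)) := by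
  have hb' : (0:ℝ) < (b:ℝ)^k := by positivity
  rw [Int.floor_eq_iff, mem_Ico, zpow_neg]
  constructor
  · rintro ⟨h1, h2⟩
    constructor
    · rw [← div_eq_mul_inv, div_le_iff₀ hb']; linarith
    · rw [← add_one_mul, ← div_eq_mul_inv, lt_div_iff₀ hb']; linarith
  · rintro ⟨h1, h2⟩
    constructor
    · rw [← div_eq_mul_inv, div_le_iff₀ hb'] at h1; linarith
    · rw [← add_one_mul, ← div_eq_mul_inv, lt_div_iff₀ hb'] at h2; linarith
lemma floor_vol (b : ℕ) (hb : 0 < b) (k : ℤ) (n : ℤ) :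
    volume {y : ℝ | ⌊(b:ℝ)^k * y⌋ = n} = eR ((b:ℝ)^(-k)) := by
  have : {y : ℝ | ⌊(b:ℝ)^k * y⌋ = n} = Ico (n * (b:ℝ)^(-k)) (n * (b:ℝ)^(-k) + (b:ℝ)^(-k)) := by ext y; exact floor_iff b hb k y n
  rw [this, Real.volume_Ico]; congr 1; ring
lemma ofReal_zpow_top (C : EE) (hC : C ≠ ∞) (b : ℕ) (hb : 2 ≤ b) : ∃ k0 : ℤ, ∀ k ≤ k0, C < eR ((b:ℝ)^(-k)) := by
  obtain ⟨n, hn⟩ := pow_unbounded_of_one_lt C.toReal (show (1:ℝ) < b by exact_mod_cast hb)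
  refine ⟨-n, fun k hk => ?_⟩
  rw [ENNReal.lt_ofReal_iff_toReal_lt hC]
  refine hn.trans_le ?_
  rw [← zpow_natCast]
  exact zpow_le_zpow_right₀ (by exact_mod_cast (by omega : 1 ≤ b)) (by omega)

def dyaR : Dya ℝ volume ℤ where
  π k x := ⌊((4:ℕ):ℝ)^k * x⌋
  meas k i := by
    have : Measurable fun x : ℝ => ⌊((4:ℕ):ℝ)^k * x⌋ := by fun_prop
    exact this (measurableSet_singleton i)
  nest k x y h := floor_nest 4 (by norm_num) k h
  v k := eR (((4:ℕ):ℝ)^(-k))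
  D := 4
  hv k x := floor_vol 4 (by norm_num) k _
  v0 k := by simp; positivity
  vt k := by simp
  hD k := by
    rw [show (4:EE) = eR 4 by simp, ← ENNReal.ofReal_mul (by norm_num)]
    refine ofReal_le_ofReal (le_of_eq ?_)
    rw [show -k = -(k+1) + 1 by ring, zpow_add_one₀ (by norm_num)]; push_cast; ring
  Dt := by simp
  vtop C hC := ofReal_zpow_top C hC 4 (by norm_num)

def dyaS (d : ℕ) (hd : 1 ≤ d) : Dya (EuclideanSpace ℝ (Fin d)) volume (Fin d → ℤ) where
  π k x := fun i => ⌊((2:ℕ):ℝ)^k * x i⌋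
  meas k i := by
    have : Measurable fun (x : EuclideanSpace ℝ (Fin d)) (i : Fin d) => ⌊((2:ℕ):ℝ)^k * x i⌋ := by fun_prop
    exact this (measurableSet_singleton i)
  nest k x y h := by
    ext i
    exact floor_nest 2 (by norm_num) k (congrFun h i)
  v k := eR (((2:ℕ):ℝ)^(-k))^d
  D := 2^d
  hv k x := by
    have h := EuclideanSpace.volume_preserving_symm_measurableEquiv_toLp (Fin d)
    have e : {y : EuclideanSpace ℝ (Fin d) | (fun i => ⌊((2:ℕ):ℝ)^k * y i⌋) = fun i => ⌊((2:ℕ):ℝ)^k * x i⌋} =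
      (MeasurableEquiv.toLp 2 (Fin d → ℝ)).symm ⁻¹' (univ.pi fun i => {t : ℝ | ⌊((2:ℕ):ℝ)^k * t⌋ = ⌊((2:ℕ):ℝ)^k * x i⌋}) := by
      ext y
      simp only [mem_ofPred_eq, funext_iff, mem_preimage, mem_pi, mem_univ, true_implies]
      rfl
    rw [e, h.measure_preimage, volume_pi_pi]
    · simp_rw [floor_vol 2 (by norm_num : 0 < 2)]
      simp
    · refine (MeasurableSet.univ_pi fun i => ?_).nullMeasurableSet
      have : Measurable fun x : ℝ => ⌊((2:ℕ):ℝ)^k * x⌋ := by fun_prop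
      exact this (measurableSet_singleton _)
  v0 k := by
    refine pow_ne_zero _ ?_
    simp; positivity
  vt k := by finiteness
  hD k := by
    rw [← mul_pow]
    gcongr
    rw [show (2:EE) = eR 2 by simp, ← ENNReal.ofReal_mul (by norm_num)]
    refine ofReal_le_ofReal (le_of_eq ?_)
    rw [show -k = -(k+1) + 1 by ring, zpow_add_one₀ (by norm_num)]; push_cast; ring
  Dt := by finiteness
  vtop C hC := by
    obtain ⟨k0, h⟩ := ofReal_zpow_top (max C 1) (by simp [hC]) 2 (by norm_num)
    refine ⟨k0, fun k hk => ?_⟩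
    have h1 := h k hk
    have h2 := (le_max_right C 1).trans h1.le
    exact ((le_max_left C 1).trans_lt h1).trans_le (le_self_pow₀ h2 (by omega))

def Dya.prod {X Y : Type} [MeasurableSpace X] [MeasurableSpace Y] {μ : Measure X} {ν : Measure Y} [SFinite μ] [SFinite ν]
    {ι ι' : Type} (S : Dya X μ ι) (S' : Dya Y ν ι') : Dya (X × Y) (μ.prod ν) (ι × ι') where
  π k z := (S.π k z.1, S'.π k z.2)
  meas k i := by
    have : {x : X × Y | (S.π k x.1, S'.π k x.2) = i} = {x | S.π k x = i.1} ×ˢ {x | S'.π k x = i.2} := by ext x; simp [Prod.ext_iff]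
    rw [this]; exact (S.meas k _).prod (S'.meas k _)
  nest k x y h := by
    rw [Prod.ext_iff] at h ⊢
    exact ⟨S.nest k _ _ h.1, S'.nest k _ _ h.2⟩
  v k := S.v k * S'.v k
  D := S.D * S'.D
  hv k z := by
    have : {x : X × Y | (S.π k x.1, S'.π k x.2) = (S.π k z.1, S'.π k z.2)} = {x | S.π k x = S.π k z.1} ×ˢ {x | S'.π k x = S'.π k z.2} := by ext x; simp [Prod.ext_iff]
    rw [this, Measure.prod_prod, S.hv, S'.hv]
  v0 k := mul_ne_zero (S.v0 k) (S'.v0 k)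
  vt k := mul_ne_top (S.vt k) (S'.vt k)
  hD k := by
    calc _ ≤ (S.D * S.v (k+1)) * (S'.D * S'.v (k+1)) := mul_le_mul' (S.hD k) (S'.hD k)
      _ = _ := by ring
  Dt := mul_ne_top S.Dt S'.Dt
  vtop C hC := by
    obtain ⟨k0, h⟩ := S.vtop C hC
    obtain ⟨k1, h'⟩ := S'.vtop 1 (by simp)
    refine ⟨min k0 k1, fun k hk => ?_⟩
    have h1 := h k (hk.trans (min_le_left _ _))
    have h2 := h' k (hk.trans (min_le_right _ _))
    exact h1.trans_le (le_mul_of_one_le_right' h2.le)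

def cnr (d : ℕ) (k : ℤ) (j : Fin d → ℤ) : EuclideanSpace ℝ (Fin d) := WithLp.toLp 2 fun i => j i * (2:ℝ)^(-k)
lemma norm_le_card {d : ℕ} {x : EuclideanSpace ℝ (Fin d)} {r : ℝ} (h : ∀ i, |x i| ≤ r) : ‖x‖ ≤ d * r := by
  rcases Nat.eq_zero_or_pos d with rfl | hd
  · rw [Subsingleton.elim x 0]; simp
  have hr : 0 ≤ r := (abs_nonneg _).trans (h ⟨0, hd⟩)
  rw [EuclideanSpace.norm_eq]
  refine sqrt_le_iff.2 ⟨by positivity, ?_⟩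
  calc ∑ i, ‖x i‖^2 ≤ ∑ i : Fin d, r^2 := by
        gcongr with i; exact h i
    _ = d * r^2 := by simp
    _ ≤ (d * r)^2 := by
        have : (1:ℝ) ≤ d := by exact_mod_cast hd
        rw [mul_pow]; gcongr; nlinarith
lemma cell_S {d : ℕ} (hd : 1 ≤ d) (k : ℤ) (x : EuclideanSpace ℝ (Fin d)) : ‖x - cnr d k ((dyaS d hd).π k x)‖ ≤ d * (2:ℝ)^(-k) := by
  refine norm_le_card fun i => ?_
  have h := (floor_iff 2 (by norm_num) k (x i) _).1 rfl
  have : (x - cnr d k ((dyaS d hd).π k x)) i = x i - ⌊((2:ℕ):ℝ)^k * x i⌋ * (2:ℝ)^(-k) := rfl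
  rw [this, abs_le]
  have h1 := h.1
  have h2 := h.2
  push_cast at h1 h2 ⊢
  have : (0:ℝ) < 2^(-k) := by positivity
  constructor <;> linarith
lemma cell_R (k : ℤ) (t : ℝ) : |t - dyaR.π k t * (4:ℝ)^(-k)| ≤ (4:ℝ)^(-k) := by
  have h := (floor_iff 4 (by norm_num) k t _).1 rfl
  have e : dyaR.π k t = ⌊((4:ℕ):ℝ)^k * t⌋ := rfl
  rw [e, abs_le]
  have h1 := h.1
  have h2 := h.2
  push_cast at h1 h2 ⊢
  have : (0:ℝ) < 4^(-k) := by positivity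
  constructor <;> linarith
lemma zpow_small (b : ℝ) (hb : 1 < b) {e : ℝ} (he : 0 < e) : ∃ n : ℕ, ∀ k : ℕ, n ≤ k → b^(-(k:ℤ)) < e := by
  obtain ⟨n, hn⟩ := exists_pow_lt_of_lt_one he (inv_lt_one_of_one_lt₀ hb)
  refine ⟨n, fun k hk => lt_of_le_of_lt ?_ hn⟩
  rw [zpow_neg, zpow_natCast, ← inv_pow]
  exact pow_le_pow_of_le_one (by positivity) (inv_lt_one_of_one_lt₀ hb).le hk
lemma hU_S {d : ℕ} (hd : 1 ≤ d) (x : EuclideanSpace ℝ (Fin d)) (U : Set (EuclideanSpace ℝ (Fin d))) (hUo : IsOpen U) (hx : x ∈ U) :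
    ∃ k0 : ℕ, ∀ k : ℕ, k0 ≤ k → ∀ y, (dyaS d hd).π k y = (dyaS d hd).π k x → y ∈ U := by
  obtain ⟨e, he, hb⟩ := Metric.isOpen_iff.1 hUo x hx
  have hd' : (0:ℝ) < d := by exact_mod_cast hd
  obtain ⟨n, hn⟩ := zpow_small 2 (by norm_num) (show 0 < e / (2*d) by positivity)
  refine ⟨n, fun k hk y hy => hb ?_⟩
  have h1 := cell_S hd k x
  have h2 := cell_S hd k y
  rw [hy] at h2
  have h3 := hn k hk
  rw [lt_div_iff₀ (by positivity)] at h3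
  rw [mem_ball, dist_eq_norm]
  calc ‖y - x‖ = ‖(y - cnr d k ((dyaS d hd).π k x)) - (x - cnr d k ((dyaS d hd).π k x))‖ := by congr 1; abel
    _ ≤ _ := norm_sub_le _ _
    _ < e := by linarith
lemma hU_R (x : ℝ) (U : Set ℝ) (hUo : IsOpen U) (hx : x ∈ U) :
    ∃ k0 : ℕ, ∀ k : ℕ, k0 ≤ k → ∀ y, dyaR.π k y = dyaR.π k x → y ∈ U := by
  obtain ⟨e, he, hb⟩ := Metric.isOpen_iff.1 hUo x hx
  obtain ⟨n, hn⟩ := zpow_small 4 (by norm_num) (show 0 < e / 2 by positivity)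
  refine ⟨n, fun k hk y hy => hb ?_⟩
  have h1 := cell_R k x
  have h2 := cell_R k y
  rw [hy] at h2
  have h3 := hn k hk
  rw [mem_ball, dist_eq, abs_lt]
  rw [abs_le] at h1 h2
  constructor <;> linarith [h1.1, h1.2, h2.1, h2.2]

structure Ker (d : ℕ) (C : ℝ) (κ : ℝ → ℝ → Spc d → ℝ) : Prop where
  meas : Measurable fun z : ℝ × ℝ × Spc d => κ z.1 z.2.1 z.2.2
  g1 : ∀ t s x, |κ t s x| ≤ C * (√|t-s| + ‖x‖)^(-((d:ℝ)+2))
  g2 : ∀ t s s' x x', |s - s'| ≤ |t - s|/2 → ‖x - x'‖ ≤ (√|t-s| + ‖x‖)/2 →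
    |κ t s x - κ t s' x'| ≤ C * (‖x - x'‖ + √|s-s'|) * (√|t-s| + ‖x‖)^(-((d:ℝ)+3))
  g2' : ∀ t s t' x x', |t - t'| ≤ |t - s|/2 → ‖x - x'‖ ≤ (√|t-s| + ‖x‖)/2 →
    |κ t s x - κ t' s x'| ≤ C * (‖x - x'‖ + √|t-t'|) * (√|t-s| + ‖x‖)^(-((d:ℝ)+3))
  g3 : ∃ C3 : EE, C3 ≠ ∞ ∧ (∀ t, ∫⁻ s, ∫⁻ x, ‖κ t s x‖ₑ ≤ C3) ∧ (∀ s, ∫⁻ t, ∫⁻ x, ‖κ t s x‖ₑ ≤ C3)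

def KK {d : ℕ} (κ : ℝ → ℝ → Spc d → ℝ) (z z' : Spc d × ℝ) : ℝ := κ z.2 z'.2 (z.1 - z'.1)

def adj {d : ℕ} (κ : ℝ → ℝ → Spc d → ℝ) : ℝ → ℝ → Spc d → ℝ := fun t s x => κ s t (-x)
lemma KK_adj {d : ℕ} (κ : ℝ → ℝ → Spc d → ℝ) : KK (adj κ) = fun z z' => KK κ z' z := by ext z z'; simp [KK, adj]
lemma Ker.adj {d : ℕ} {C : ℝ} {κ : ℝ → ℝ → Spc d → ℝ} (h : Ker d C κ) : Ker d C (adj κ) := by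
  refine ⟨?_, ?_, ?_, ?_, ?_⟩
  · exact h.meas.comp (by fun_prop : Measurable fun z : ℝ × ℝ × Spc d => (z.2.1, z.1, -z.2.2))
  · intro t s x
    have := h.g1 s t (-x)
    rwa [norm_neg, abs_sub_comm s t] at this
  · intro t s s' x x' h1 h2
    have := h.g2' s t s' (-x) (-x') (by rwa [abs_sub_comm s t]) (by rwa [norm_neg, abs_sub_comm s t, ← neg_add', ← norm_neg, neg_neg, ← sub_eq_add_neg])
    rwa [norm_neg, abs_sub_comm s t, ← neg_add', norm_neg, ← sub_eq_add_neg] at this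
  · intro t s s' x x' h1 h2
    have := h.g2 s t s' (-x) (-x') (by rwa [abs_sub_comm s t]) (by rwa [norm_neg, abs_sub_comm s t, ← neg_add', ← norm_neg, neg_neg, ← sub_eq_add_neg])
    rwa [norm_neg, abs_sub_comm s t, ← neg_add', norm_neg, ← sub_eq_add_neg] at this
  · obtain ⟨C3, h0, h1, h2⟩ := h.g3
    have e : ∀ t s, ∫⁻ x, ‖_root_.adj κ t s x‖ₑ = ∫⁻ x, ‖κ s t x‖ₑ := fun t s => lintegral_neg_eq_self (fun x => ‖κ s t x‖ₑ)
    refine ⟨C3, h0, fun t => ?_, fun t => ?_⟩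
    · simp_rw [e]; exact h2 t
    · simp_rw [e]; exact h1 t

section
variable {d : ℕ} {C : ℝ} {κ : ℝ → ℝ → Spc d → ℝ}
lemma Ker.Cpos (h : Ker d C κ) : 0 ≤ C := by
  have := (abs_nonneg _).trans (h.g1 1 0 0)
  simpa using this
lemma Ker.measKK (h : Ker d C κ) : Measurable fun z : (Spc d × ℝ) × (Spc d × ℝ) => KK κ z.1 z.2 := h.meas.comp (by fun_prop : Measurable fun z : (Spc d × ℝ) × (Spc d × ℝ) => (z.1.2, z.2.2, z.1.1 - z.2.1))
lemma Ker.schur (h : Ker d C κ) : ∃ C3 : EE, C3 ≠ ∞ ∧ ∀ z, ∫⁻ z', ‖KK κ z z'‖ₑ ≤ C3 := by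
  obtain ⟨C3, h0, h1, h2⟩ := h.g3
  refine ⟨C3, h0, fun z => ?_⟩
  have hm : Measurable fun z' => ‖KK κ z z'‖ₑ := (h.measKK.comp measurable_prodMk_left).enorm
  rw [Measure.volume_eq_prod, lintegral_prod_symm _ hm.aemeasurable]
  refine le_trans (le_of_eq (lintegral_congr fun s => ?_)) (h1 z.2)
  exact lintegral_sub_left_eq_self (fun x => ‖κ z.2 s x‖ₑ) z.1
lemma rpow_half_le {a b m : ℝ} (ha : 0 < a) (hab : a ≤ 2 * b) (hm : 0 ≤ m) : b^(-m) ≤ 2^m * a^(-m) := by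
  have hb : 0 < b := by linarith
  rw [Real.rpow_neg hb.le, Real.rpow_neg ha.le, inv_le_comm₀ (by positivity) (by positivity), mul_inv, inv_inv, ← div_eq_inv_mul,
    div_le_iff₀ (by positivity), ← mul_rpow hb.le (by norm_num)]
  gcongr; linarith
lemma hor_pt (hd : 1 ≤ d) (h : Ker d C κ) {l c2 s s' t : ℝ} {c1 y y' x : Spc d} (hl : 0 < l) (h1 : ‖y - c1‖ ≤ d * l) (h2 : ‖y' - c1‖ ≤ d * l)
    (h3 : |s - c2| ≤ l^2) (h4 : |s' - c2| ≤ l^2) (hN : ¬ (‖x - c1‖ ≤ (2*d+1) * l ∧ |t - c2| ≤ (16 * d^2 + 1) * l^2)) :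
    |κ t s (x - y) - κ t s' (x - y')| ≤
      {t : ℝ | (4*d*l)^2 ≤ |t - s|}.indicator (fun t => C * ((2*d+2) * l) * (√|t-s| + ‖x - y‖)^(-((d:ℝ)+3))) t +
      {t : ℝ | |t - s| < (4*d*l)^2}.indicator (fun _ => C * 2^((d:ℝ)+2) * ((l + ‖x - y‖)^(-((d:ℝ)+2)) + (l + ‖x - y'‖)^(-((d:ℝ)+2)))) t := by
  have hC := h.Cpos
  have hd1 : (1:ℝ) ≤ d := by exact_mod_cast hd
  have hyy : ‖x - y - (x - y')‖ ≤ 2 * d * l := by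
    calc _ = ‖(y' - c1) - (y - c1)‖ := by congr 1; abel
      _ ≤ _ := norm_sub_le _ _
      _ ≤ _ := by linarith
  have hss : |s - s'| ≤ 2 * l^2 := by
    rw [abs_le] at *
    constructor <;> linarith [h3.1, h3.2, h4.1, h4.2]
  by_cases hr : (4*d*l)^2 ≤ |t - s|
  · simp only [indicator, mem_ofPred_eq, hr, not_lt.2 hr, if_true, if_false, add_zero]
    have hsq : 4*d*l ≤ √|t-s| := Real.le_sqrt_of_sq_le hr
    refine (h.g2 t s s' _ _ ?_ ?_).trans ?_
    · nlinarith [mul_self_le_mul_self (by norm_num : (0:ℝ) ≤ 1) hd1, mul_pos hl hl]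
    · linarith [norm_nonneg (x - y)]
    · gcongr
      have : √|s - s'| ≤ 2 * l := by
        rw [sqrt_le_iff]; constructor
        · positivity
        · nlinarith
      linarith
  · simp only [indicator, mem_ofPred_eq, hr, not_le.1 hr, if_true, if_false, zero_add]
    have htc : |t - c2| ≤ (16 * d^2 + 1) * l^2 := by
      calc |t - c2| ≤ |t - s| + |s - c2| := abs_sub_le _ _ _
        _ ≤ _ := by nlinarith [not_le.1 hr]
    have hx : (2*d+1) * l < ‖x - c1‖ := by by_contra hc; exact hN ⟨not_lt.1 hc, htc⟩
    have one : ∀ s y, ‖y - c1‖ ≤ d * l → |κ t s (x - y)| ≤ C * (2^((d:ℝ)+2) * (l + ‖x - y‖)^(-((d:ℝ)+2))) := by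
      intro s y hy
      have hxy : l ≤ ‖x - y‖ := by
        have : ‖x - c1‖ ≤ ‖x - y‖ + ‖y - c1‖ := by
          calc _ = ‖(x - y) + (y - c1)‖ := by congr 1; abel
            _ ≤ _ := norm_add_le _ _
        nlinarith
      refine (h.g1 t s _).trans ?_
      gcongr
      refine rpow_half_le (by positivity) ?_ (by positivity)
      have := sqrt_nonneg |t-s|
      linarith
    have e1 := one s y h1
    have e2 := one s' y' h2
    calc _ ≤ |κ t s (x - y)| + |κ t s' (x - y')| := abs_sub _ _
      _ ≤ _ := by linarith

def G1 (d : ℕ) (C l s : ℝ) (y : Spc d) (t : ℝ) (x : Spc d) : ℝ := {t : ℝ | (4*d*l)^2 ≤ |t - s|}.indicator (fun t => C * ((2*d+2) * l) * (√|t-s| + ‖x - y‖)^(-((d:ℝ)+3))) t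

def G2 (d : ℕ) (C l s : ℝ) (y y' : Spc d) (t : ℝ) (x : Spc d) : ℝ := {t : ℝ | |t - s| < (4*d*l)^2}.indicator (fun _ => C * 2^((d:ℝ)+2) * ((l + ‖x - y‖)^(-((d:ℝ)+2)) + (l + ‖x - y'‖)^(-((d:ℝ)+2)))) t
lemma scS (m R : ℝ) (y : Spc d) (hR : 0 < R) : ∫⁻ x : Spc d, eR ((R + ‖x - y‖)^(-((d:ℝ)+m))) = eR (R^(-m)) * Jc (Spc d) m := by
  have := scal' (E := Spc d) (m := m) hR y
  rwa [finrank_euclideanSpace_fin] at this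
lemma mG1 (d : ℕ) (C l s : ℝ) (y : Spc d) : Measurable fun z : Spc d × ℝ => G1 d C l s y z.2 z.1 := by
  have m1 : MeasurableSet {z : Spc d × ℝ | (4*d*l)^2 ≤ |z.2 - s|} := measurableSet_le (by fun_prop) (by fun_prop)
  exact Measurable.indicator (f := fun z : Spc d × ℝ => C * ((2*d+2) * l) * (√|z.2-s| + ‖z.1 - y‖)^(-((d:ℝ)+3))) (by fun_prop) m1
lemma mG2 (d : ℕ) (C l s : ℝ) (y y' : Spc d) : Measurable fun z : Spc d × ℝ => G2 d C l s y y' z.2 z.1 := by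
  have m1 : MeasurableSet {z : Spc d × ℝ | |z.2 - s| < (4*d*l)^2} := measurableSet_lt (by fun_prop) (by fun_prop)
  exact Measurable.indicator (f := fun z : Spc d × ℝ => C * 2^((d:ℝ)+2) * ((l + ‖z.1 - y‖)^(-((d:ℝ)+2)) + (l + ‖z.1 - y'‖)^(-((d:ℝ)+2)))) (by fun_prop) m1
lemma iG1 (hd : 1 ≤ d) {C l : ℝ} (hC : 0 ≤ C) (hl : 0 < l) (s : ℝ) (y : Spc d) : ∫⁻ t, ∫⁻ x, eR (G1 d C l s y t x) ≤
    eR (C * (2*d+2)) * (eR (2^((3:ℝ)/2)) * (eR ((4*d)⁻¹) * Jc ℝ (1/2))) * Jc (Spc d) 3 := by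
  have hd1 : (1:ℝ) ≤ d := by exact_mod_cast hd
  calc _ ≤ ∫⁻ t, eR (C * (2*d+2)) * (eR l * (eR (2^((3:ℝ)/2)) * eR (((4*d*l)^2 + ‖t-s‖)^(-((Module.finrank ℝ ℝ : ℝ) + 1/2))))) * Jc (Spc d) 3 := by
        refine lintegral_mono fun t => ?_
        by_cases ht : (4*d*l)^2 ≤ |t - s|
        · simp only [G1, indicator, mem_ofPred_eq, ht, if_true]
          have hp : 0 < |t - s| := lt_of_lt_of_le (by positivity) ht
          simp_rw [ENNReal.ofReal_mul (show 0 ≤ C * ((2*d+2)*l) by positivity)]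
          rw [lintegral_const_mul' _ _ (by simp), scS _ _ _ (sqrt_pos.2 hp), ← mul_assoc, ← mul_assoc (eR (C * (2*d+2)))]
          refine mul_le_mul' (mul_le_mul' (le_of_eq ?_) ?_) le_rfl
          · rw [← ENNReal.ofReal_mul (by positivity), mul_assoc]
          · rw [← ENNReal.ofReal_mul (by positivity)]
            refine ofReal_le_ofReal ?_
            rw [sqrt_eq_rpow, ← Real.rpow_mul hp.le]
            have := rpow_half_le (a := (4*d*l)^2 + ‖t-s‖) (b := |t-s|) (m := 3/2) (by positivity) (by rw [norm_eq_abs]; linarith) (by norm_num)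
            rw [show (1:ℝ)/2 * -3 = -(3/2) by norm_num, show -((Module.finrank ℝ ℝ : ℝ) + 1/2) = -(3/2) by norm_num]
            exact this
        · simp [G1, indicator, ht]
    _ = _ := by
        rw [lintegral_mul_const' _ _ (Jc_ne (by norm_num)), lintegral_const_mul' _ _ (by simp), lintegral_const_mul' _ _ (by simp), lintegral_const_mul' _ _ (by simp),
          scal' (by positivity)]
        have e : eR l * eR (((4*d*l)^2)^(-(1/2:ℝ))) = eR ((4*d)⁻¹) := by
          rw [← ENNReal.ofReal_mul hl.le]
          congr 1
          rw [Real.rpow_neg (by positivity), ← sqrt_eq_rpow, Real.sqrt_sq (by positivity)]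
          field_simp
        rw [← e]; ring
lemma iG2 (hd : 1 ≤ d) {C l : ℝ} (hC : 0 ≤ C) (hl : 0 < l) (s : ℝ) (y y' : Spc d) : ∫⁻ t, ∫⁻ x, eR (G2 d C l s y y' t x) ≤
    eR (2 * (4*d)^2) * (eR (C * 2^((d:ℝ)+2)) * (2 * Jc (Spc d) 2)) := by
  have hd1 : (1:ℝ) ≤ d := by exact_mod_cast hd
  have m2 : MeasurableSet {t : ℝ | |t - s| < (4*d*l)^2} := measurableSet_lt (by fun_prop) (by fun_prop)
  calc _ = ∫⁻ t, {t : ℝ | |t - s| < (4*d*l)^2}.indicator (fun _ => eR (C * 2^((d:ℝ)+2)) * (eR (l^(-2:ℝ)) * (2 * Jc (Spc d) 2))) t := by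
        refine lintegral_congr fun t => ?_
        by_cases ht : |t - s| < (4*d*l)^2
        · simp only [G2, indicator, mem_ofPred_eq, ht, if_true]
          simp_rw [ENNReal.ofReal_mul (show 0 ≤ C * 2^((d:ℝ)+2) by positivity)]
          rw [lintegral_const_mul' _ _ (by simp)]
          have : ∀ x : Spc d, eR ((l + ‖x - y‖)^(-((d:ℝ)+2)) + (l + ‖x - y'‖)^(-((d:ℝ)+2))) = eR ((l + ‖x - y‖)^(-((d:ℝ)+2))) + eR ((l + ‖x - y'‖)^(-((d:ℝ)+2))) := fun x => ofReal_add (by positivity) (by positivity)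
          simp_rw [this]
          rw [lintegral_add_left (by fun_prop), scS _ _ _ hl, scS _ _ _ hl]; ring
        · simp [G2, indicator, ht]
    _ = (eR (C * 2^((d:ℝ)+2)) * (eR (l^(-2:ℝ)) * (2 * Jc (Spc d) 2))) * eR (2 * (4*d*l)^2) := by
        rw [lintegral_indicator m2, setLIntegral_const]
        have : {t : ℝ | |t - s| < (4*d*l)^2} = ball s ((4*d*l)^2) := by ext t; simp [dist_eq]
        rw [this, Real.volume_ball]
    _ = _ := by
        have e : eR (l^(-2:ℝ)) * eR (2 * (4*d*l)^2) = eR (2 * (4*d)^2) := by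
          rw [← ENNReal.ofReal_mul (by positivity)]
          congr 1
          rw [Real.rpow_neg hl.le, Real.rpow_two]
          field_simp
        rw [← e]; ring
    _ ≤ _ := le_rfl

def Nbx (d : ℕ) (l c2 : ℝ) (c1 : Spc d) : Set (Spc d × ℝ) := {z : Spc d × ℝ | ‖z.1 - c1‖ ≤ (2*d+1) * l ∧ |z.2 - c2| ≤ (16 * d^2 + 1) * l^2}
lemma mNbx (d : ℕ) (l c2 : ℝ) (c1 : Spc d) : MeasurableSet (Nbx d l c2 c1) := by
  have a1 : MeasurableSet {z : Spc d × ℝ | ‖z.1 - c1‖ ≤ (2*d+1) * l} := measurableSet_le (by fun_prop) (by fun_prop)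
  have a2 : MeasurableSet {z : Spc d × ℝ | |z.2 - c2| ≤ (16 * d^2 + 1) * l^2} := measurableSet_le (by fun_prop) (by fun_prop)
  exact a1.inter a2

def Bh (d : ℕ) (C : ℝ) : EE := eR (C * (2*d+2)) * (eR (2^((3:ℝ)/2)) * (eR ((4*d)⁻¹) * Jc ℝ (1/2))) * Jc (Spc d) 3 +
    eR (2 * (4*d)^2) * (eR (C * 2^((d:ℝ)+2)) * (2 * Jc (Spc d) 2))
lemma Bh_ne (d : ℕ) (C : ℝ) : Bh d C ≠ ∞ := by
  have j1 := Jc_ne (E := Spc d) (m := 3) (by norm_num)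
  have j2 := Jc_ne (E := Spc d) (m := 2) (by norm_num)
  have j3 := Jc_ne (E := ℝ) (m := 1/2) (by norm_num)
  unfold Bh
  refine add_ne_top.2 ⟨mul_ne_top (mul_ne_top ofReal_ne_top (mul_ne_top ofReal_ne_top (mul_ne_top ofReal_ne_top j3))) j1,
    mul_ne_top ofReal_ne_top (mul_ne_top ofReal_ne_top (mul_ne_top (by simp) j2))⟩
lemma hor1a (hd : 1 ≤ d) (h : Ker d C κ) {l c2 s s' : ℝ} {c1 y y' : Spc d} (hl : 0 < l)
    (h1 : ‖y - c1‖ ≤ d * l) (h2 : ‖y' - c1‖ ≤ d * l) (h3 : |s - c2| ≤ l^2) (h4 : |s' - c2| ≤ l^2) (z : Spc d × ℝ) (hz : z ∈ (Nbx d l c2 c1)ᶜ) :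
    ‖KK κ z (y, s) - KK κ z (y', s')‖ₑ ≤ eR (G1 d C l s y z.2 z.1) + eR (G2 d C l s y y' z.2 z.1) :=
  (enorm_le_of_abs (hor_pt hd h hl h1 h2 h3 h4 hz)).trans ENNReal.ofReal_add_le
lemma hor1b {C l s : ℝ} {y y' : Spc d} : ∫⁻ z : Spc d × ℝ, (eR (G1 d C l s y z.2 z.1) + eR (G2 d C l s y y' z.2 z.1))
   = (∫⁻ t, ∫⁻ x, eR (G1 d C l s y t x)) + ∫⁻ t, ∫⁻ x, eR (G2 d C l s y y' t x) := by
  rw [lintegral_add_left (mG1 d C l s y).ennreal_ofReal, Measure.volume_eq_prod, lintegral_prod_symm _ (mG1 d C l s y).ennreal_ofReal.aemeasurable,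
          lintegral_prod_symm _ (mG2 d C l s y y').ennreal_ofReal.aemeasurable]
lemma hor1 (hd : 1 ≤ d) (h : Ker d C κ) {l c2 s s' : ℝ} {c1 y y' : Spc d} (hl : 0 < l)
    (h1 : ‖y - c1‖ ≤ d * l) (h2 : ‖y' - c1‖ ≤ d * l) (h3 : |s - c2| ≤ l^2) (h4 : |s' - c2| ≤ l^2) :
    ∫⁻ z in (Nbx d l c2 c1)ᶜ, ‖KK κ z (y, s) - KK κ z (y', s')‖ₑ ≤ Bh d C := by
  refine (setLIntegral_mono' (mNbx d l c2 c1).compl fun z hz => hor1a hd h hl h1 h2 h3 h4 z hz).trans ?_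
  refine (setLIntegral_le_lintegral _ _).trans ?_
  rw [hor1b]
  rw [Bh]
  exact add_le_add (iG1 hd h.Cpos hl s y) (iG2 hd h.Cpos hl s y y')
lemma hor2 (d : ℕ) (C : ℝ) {κ : ℝ → ℝ → Spc d → ℝ} (h : Ker d C κ) {x x' x'' : Spc d} (hx : 0 < ‖x - x'‖) (hxx : ‖x' - x''‖ ≤ ‖x - x'‖/2) (t : ℝ) :
    ∫⁻ s, ‖κ t s (x - x') - κ t s (x - x'')‖ₑ ≤ eR (C * ‖x' - x''‖ * ‖x - x'‖^(-((d:ℝ)+1))) * Jc ℝ (((d:ℝ)+1)/2) := by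
  have hC := h.Cpos
  calc _ ≤ ∫⁻ s, eR (C * ‖x' - x''‖) * eR ((‖x-x'‖^2 + ‖s - t‖)^(-((Module.finrank ℝ ℝ : ℝ) + ((d:ℝ)+1)/2))) := by
        refine lintegral_mono fun s => ?_
        rw [← ENNReal.ofReal_mul (by positivity)]
        refine enorm_le_of_abs ?_
        have e : ‖x - x' - (x - x'')‖ = ‖x' - x''‖ := by rw [← norm_neg]; congr 1; abel
        have := h.g2 t s s (x - x') (x - x'') (by simp; positivity) (by rw [e]; linarith [sqrt_nonneg |t-s|])
        rw [e] at this
        simp only [sub_self, abs_zero, Real.sqrt_zero, add_zero] at this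
        refine this.trans ?_
        gcongr
        have e2 : (√|t-s| + ‖x - x'‖)^(-((d:ℝ)+3)) = ((√|t-s| + ‖x - x'‖)^2)^(-(((d:ℝ)+3)/2)) := by rw [← Real.rpow_two, ← Real.rpow_mul (by positivity)]; congr 1; ring
        rw [e2, show -((Module.finrank ℝ ℝ : ℝ) + ((d:ℝ)+1)/2) = -(((d:ℝ)+3)/2) by simp; ring]
        refine Real.rpow_le_rpow_of_nonpos (by positivity) ?_ (by have : (0:ℝ) ≤ d := by positivity
                                                                  linarith)
        have := sq_sqrt (abs_nonneg (t-s))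
        rw [norm_eq_abs, abs_sub_comm s t]
        nlinarith [sqrt_nonneg |t-s|]
    _ = _ := by
        rw [lintegral_const_mul' _ _ (by simp), scal' (by positivity), ← mul_assoc, ← ENNReal.ofReal_mul (by positivity)]
        congr 3
        rw [← Real.rpow_two, ← Real.rpow_mul (by positivity)]; congr 1; ring

end

def LB {d : ℕ} (κ : ℝ → ℝ → Spc d → ℝ) (r : ℝ) (A : EE) : Prop :=
  ∀ f : Spc d × ℝ → ℝ, Measurable f → (∃ R : ℝ, ∀ z, |f z| ≤ R) → (∃ E : Set (Spc d × ℝ), MeasurableSet E ∧ volume E ≠ ∞ ∧ ∀ z ∉ E, f z = 0) →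
    ∫⁻ z, ‖Tk volume (KK κ) f z‖ₑ^r ≤ A * ∫⁻ z, ‖f z‖ₑ^r
lemma adj_adj {d : ℕ} (κ : ℝ → ℝ → Spc d → ℝ) : adj (adj κ) = κ := by ext; simp [adj]

section
variable {X : Type} [MeasurableSpace X] {μ : Measure X} [SFinite μ]
lemma lint_unit {g : X × Unit → EE} (hg : Measurable g) : ∫⁻ w, g w ∂(μ.prod (Measure.dirac ())) = ∫⁻ z, g (z,()) ∂μ := by
  rw [lintegral_prod _ hg.aemeasurable]
  simp
lemma tk_unit (K : X → X → ℝ) (F : X × Unit → ℝ) (z : X) :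
    Tk (μ.prod (Measure.dirac ())) (fun w w' => K w.1 w'.1) F (z,()) = Tk μ K (fun z => F (z,())) z := by
  unfold Tk
  have e : MeasurableEmbedding (fun x : X => (x,())) := measurableEmbedding_prod_mk_right ()
  rw [Measure.prod_dirac, e.integral_map]
lemma nq_unit {q : ℝ} (hq : 1 < q) (F : X × Unit → ℝ) (z : X) : nq q (Measure.dirac ()) F z = ‖F (z,())‖ₑ := by
  unfold nq
  rw [lintegral_dirac, ← ENNReal.rpow_mul, mul_one_div_cancel (by linarith), rpow_one]
lemma good_unit {F : X × Unit → ℝ} (h : Good μ (Measure.dirac ()) F) : Measurable (fun z => F (z,())) ∧ (∃ R : ℝ, ∀ z, |F (z,())| ≤ R) ∧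
    (∃ E : Set X, MeasurableSet E ∧ μ E ≠ ∞ ∧ ∀ z ∉ E, F (z,()) = 0) := by
  obtain ⟨R, hR⟩ := h.bdd
  obtain ⟨A, B, h1, h2, h3, h4, h5⟩ := h.supp
  exact ⟨h.meas.comp (by fun_prop), ⟨R, fun z => hR _⟩, A, h1, h3, fun z hz => h5 _ (Or.inl hz)⟩
lemma unit_good {f : X → ℝ} (h1 : Measurable f) (h2 : ∃ R : ℝ, ∀ z, |f z| ≤ R) (h3 : ∃ E : Set X, MeasurableSet E ∧ μ E ≠ ∞ ∧ ∀ z ∉ E, f z = 0) :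
    Good μ (Measure.dirac ()) (fun w => f w.1) := by
  obtain ⟨R, hR⟩ := h2
  obtain ⟨A, g1, g2, g3⟩ := h3
  exact ⟨h1.comp measurable_fst, ⟨R, fun z => hR _⟩, A, univ, g1, .univ, g2, by simp, fun z hz => g3 _ (by simpa using hz)⟩
end

section
variable {d : ℕ} {C : ℝ} {κ : ℝ → ℝ → Spc d → ℝ}
lemma LB.good {r : ℝ} {A : EE} (hr : 1 < r) (h : LB κ r A) (F : (Spc d × ℝ) × Unit → ℝ) (hF : Good volume (Measure.dirac ()) F) :
    ∫⁻ z, nq r (Measure.dirac ()) (Tk (volume.prod (Measure.dirac ())) (fun w w' => KK κ w.1 w'.1) F) z ^ r ≤ A * ∫⁻ z, nq r (Measure.dirac ()) F z ^ r := by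
  simp_rw [nq_unit hr, tk_unit]
  obtain ⟨g1, g2, g3⟩ := good_unit hF
  exact h _ g1 g2 g3
lemma LB.of {r s : ℝ} {A : EE} (hr : 1 < r) (h : ∀ F : (Spc d × ℝ) × Unit → ℝ, Good volume (Measure.dirac ()) F →
    ∫⁻ z, nq r (Measure.dirac ()) (Tk (volume.prod (Measure.dirac ())) (fun w w' => KK κ w.1 w'.1) F) z ^ s ≤ A * ∫⁻ z, nq r (Measure.dirac ()) F z ^ s) :
    LB κ s A := by
  intro f h1 h2 h3
  have := h _ (unit_good h1 h2 h3)
  simp_rw [nq_unit hr, tk_unit] at this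
  exact this
lemma lint_K1 (h : Ker d C κ) : ∃ C3 : EE, C3 ≠ ∞ ∧ ∀ z : (Spc d × ℝ) × Unit, ∫⁻ z', ‖KK κ z.1 z'.1‖ₑ ∂((volume : Measure (Spc d × ℝ)).prod (Measure.dirac ())) ≤ C3 := by
  obtain ⟨C3, h0, h1⟩ := h.schur
  refine ⟨C3, h0, fun z => ?_⟩
  rw [lint_unit (g := fun z' => ‖KK κ z.1 z'.1‖ₑ) ((h.measKK.comp (by fun_prop : Measurable fun z' : (Spc d × ℝ) × Unit => (z.1, z'.1))).enorm)]
  exact h1 z.1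
lemma meas_K1 (h : Ker d C κ) : Measurable fun z : ((Spc d × ℝ) × Unit) × ((Spc d × ℝ) × Unit) => KK κ z.1.1 z.2.1 := h.measKK.comp (by fun_prop : Measurable fun z : ((Spc d × ℝ) × Unit) × ((Spc d × ℝ) × Unit) => (z.1.1, z.2.1))
lemma LB.adj {r r' : ℝ} (hr : r'.HolderConjugate r) {A : EE} (hκ : Ker d C κ) (h : LB κ r A) : LB (adj κ) r' (A^(r'-1)) := by
  obtain ⟨C3, h0, h1⟩ := lint_K1 hκ.adj
  refine LB.of (r := r') hr.lt fun F hF => ?_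
  refine dual hr hr le_rfl (meas_K1 hκ.adj) h0 h1 A (fun g hg => ?_) hF
  have := h.good hr.symm.lt g hg
  simp only [KK_adj]
  exact this
lemma nbx_vol (d : ℕ) (l c2 : ℝ) (hl : 0 < l) (c1 : Spc d) : volume (Nbx d l c2 c1) ≤
   (eR ((2*d+1)^d) * volume (ball (0:Spc d) 1) * eR (2*(16*d^2+1))) * (eR l^d * eR (l^2)) := by
  have : Nbx d l c2 c1 = closedBall c1 ((2*d+1)*l) ×ˢ closedBall c2 ((16 * d^2 + 1) * l^2) := by ext z; simp [Nbx, dist_eq_norm]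
  rw [this, Measure.volume_eq_prod, Measure.prod_prod, Measure.addHaar_closedBall _ _ (by positivity), Real.volume_closedBall, mul_pow,
    ENNReal.ofReal_mul (by positivity), ← mul_assoc 2, ENNReal.ofReal_mul (p := 2*(16*(d:ℝ)^2+1)) (by positivity), ENNReal.ofReal_pow hl.le]
  simp only [finrank_euclideanSpace, Fintype.card_fin]
  rw [ENNReal.ofReal_pow hl.le]
  apply le_of_eq; ring
end

section
variable {d : ℕ} {C : ℝ} {κ : ℝ → ℝ → Spc d → ℝ}
lemma four_zpow (k : ℤ) : (4:ℝ)^(-k) = ((2:ℝ)^(-k))^2 := by rw [show (4:ℝ) = 2^2 by norm_num, ← zpow_natCast, ← zpow_natCast, zpow_comm]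

def dyaSR (d : ℕ) (hd : 1 ≤ d) : Dya (Spc d × ℝ) volume ((Fin d → ℤ) × ℤ) := (dyaS d hd).prod dyaR

def NbSR (d : ℕ) (k : ℤ) (i : (Fin d → ℤ) × ℤ) : Set (Spc d × ℝ) := Nbx d ((2:ℝ)^(-k)) (i.2 * (4:ℝ)^(-k)) (cnr d k i.1)
lemma hU_SR (hd : 1 ≤ d) (x : Spc d × ℝ) (U : Set (Spc d × ℝ)) (hUo : IsOpen U) (hx : x ∈ U) :
    ∃ k, ∀ y, (dyaSR d hd).π k y = (dyaSR d hd).π k x → y ∈ U := by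
  obtain ⟨u, v, hu, hv, hxu, hxv, huv⟩ := isOpen_prod_iff.1 hUo x.1 x.2 hx
  obtain ⟨k0, h0⟩ := hU_S hd x.1 u hu hxu
  obtain ⟨k1, h1⟩ := hU_R x.2 v hv hxv
  refine ⟨((max k0 k1 : ℕ) : ℤ), fun y hy => huv ⟨?_, ?_⟩⟩
  · exact h0 _ (le_max_left _ _) y.1 (Prod.ext_iff.1 hy).1
  · exact h1 _ (le_max_right _ _) y.2 (Prod.ext_iff.1 hy).2
lemma vol_NbSR (hd : 1 ≤ d) (k : ℤ) (i : (Fin d → ℤ) × ℤ) : volume (NbSR d k i) ≤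
    (eR ((2*d+1)^d) * volume (ball (0:Spc d) 1) * eR (2*(16*d^2+1))) * (dyaSR d hd).v k := by
  refine (nbx_vol d _ _ (by positivity) _).trans (le_of_eq ?_)
  congr 1
  rw [← four_zpow]
  show _ = eR (((2:ℕ):ℝ)^(-k))^d * eR (((4:ℕ):ℝ)^(-k))
  norm_num
lemma hor_SR (hd : 1 ≤ d) (h : Ker d C κ) (k : ℤ) (z' z'' : Spc d × ℝ) (he : (dyaSR d hd).π k z' = (dyaSR d hd).π k z'') :
    ∫⁻ z in (NbSR d k ((dyaSR d hd).π k z'))ᶜ, ‖KK κ z z' - KK κ z z''‖ₑ ≤ Bh d C := by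
  have e := Prod.ext_iff.1 he
  refine hor1 hd h (s := z'.2) (s' := z''.2) (y := z'.1) (y' := z''.1) (l := (2:ℝ)^(-k)) (by positivity) (cell_S hd k z'.1) ?_ ?_ ?_
  · have := cell_S hd k z''.1
    rw [e.1]
    exact this
  · have := cell_R k z'.2
    rw [← four_zpow]
    exact this
  · have := cell_R k z''.2
    rw [e.2, ← four_zpow]; exact this

def N1 (d : ℕ) (hd : 1 ≤ d) (C : ℝ) (A2 : EE) (r : ℝ) : EE := eR (2^r * r) * (A2 * eR (1/(2-r)) + (A2 * (dyaSR d hd).D^(2:ℝ) + (eR ((2*d+1)^d) * volume (ball (0:Spc d) 1) * eR (2*(16*d^2+1))) + Bh d C * (dyaSR d hd).D) * (2 * (eR (1/(r-1)) * 2^(r-1))))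
lemma cz_const_ne {a a2 D D' B e c : EE} {q r : ℝ} (ha : a ≠ ∞) (ha2 : a2 ≠ ∞) (hD : D ≠ ∞) (hD' : D' ≠ ∞) (hB : B ≠ ∞) (he : e ≠ ∞) (hc : c ≠ ∞) (hq : 1 < q) (hr : 1 < r) :
    a * (a2 * e + (a2 * D^q + D' + B * D) * (2 * (c * 2^(r-1)))) ≠ ∞ := by
  have h1 : D^q ≠ ∞ := rpow_ne_top_of_nonneg (by linarith) hD
  have h2 : (2:EE)^(r-1) ≠ ∞ := rpow_ne_top_of_nonneg (by linarith) (by simp)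
  refine mul_ne_top ha (add_ne_top.2 ⟨mul_ne_top ha2 he, mul_ne_top ?_ (mul_ne_top (by simp) (mul_ne_top hc h2))⟩)
  exact add_ne_top.2 ⟨add_ne_top.2 ⟨mul_ne_top ha2 h1, hD'⟩, mul_ne_top hB hD⟩
lemma N1_ne (hd : 1 ≤ d) (C : ℝ) {A2 : EE} (hA : A2 ≠ ∞) {r : ℝ} (hr : 1 < r) : N1 d hd C A2 r ≠ ∞ := by
  unfold N1
  refine cz_const_ne ofReal_ne_top hA (Dya.Dt _) ?_ (Bh_ne d C) ofReal_ne_top ofReal_ne_top (by norm_num) hr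
  exact mul_ne_top (mul_ne_top ofReal_ne_top measure_ball_lt_top.ne) ofReal_ne_top
lemma use1_lt (hd : 1 ≤ d) {A2 : EE} {r : ℝ} (hr : 1 < r) (hr2 : r < 2) (h : Ker d C κ) (h2 : LB κ 2 A2) : LB κ r (N1 d hd C A2 r) := by
  refine LB.of (r := 2) (by norm_num) fun F hF => ?_
  obtain ⟨C3, h0, h1⟩ := lint_K1 h
  refine cz (dyaSR d hd) (hU_SR hd) hr hr2 (meas_K1 h) (fun z => ((h1 z).trans_lt h0.lt_top).ne) A2 ?_ (NbSR d) ?_ _ (vol_NbSR hd)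
    (fun z z' z'' => ‖KK κ z z' - KK κ z z''‖ₑ) ?_ ?_ ?_ (Bh d C) (hor_SR hd h) hF
  · intro f hf
    have := h2.good (by norm_num) f hf
    simp_rw [nq_unit (by norm_num : (1:ℝ) < 2)] at this
    rw [lint_unit, lint_unit]
    · exact this
    · exact hf.meas.enorm.pow_const _
    · exact (meas_Tk (meas_K1 h) hf.meas).enorm.pow_const _
  · exact fun k i => mNbx _ _ _ _
  · exact ((h.measKK.comp (by fun_prop : Measurable fun z : (Spc d × ℝ) × (Spc d × ℝ) × (Spc d × ℝ) => (z.1, z.2.1))).sub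
      (h.measKK.comp (by fun_prop : Measurable fun z : (Spc d × ℝ) × (Spc d × ℝ) × (Spc d × ℝ) => (z.1, z.2.2)))).enorm
  · intro k x x' x'' _ _ y; simp
  · intro k x x' x'' _ _ y; simp
theorem use1 (hd : 1 ≤ d) (C : ℝ) {A2 : EE} (hA : A2 ≠ ∞) {r : ℝ} (hr : 1 < r) : ∃ N : EE, N ≠ ∞ ∧ ∀ κ : ℝ → ℝ → Spc d → ℝ, Ker d C κ → LB κ 2 A2 → LB κ r N := by
  rcases lt_trichotomy r 2 with h | h | h
  · exact ⟨_, N1_ne hd C hA hr, fun κ hκ h2 => use1_lt hd hr h hκ h2⟩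
  · subst h; exact ⟨A2, hA, fun κ _ h2 => h2⟩
  · have h22 : (2:ℝ).HolderConjugate 2 := Real.HolderConjugate.two_two
    have hc : r.HolderConjugate (r.conjExponent) := Real.HolderConjugate.conjExponent hr
    have hlt : r.conjExponent < 2 := by rw [conjExponent, div_lt_iff₀ (by linarith)]; linarith
    refine ⟨N1 d hd C (A2^((2:ℝ)-1)) r.conjExponent ^ (r-1), rpow_ne_top_of_nonneg (by linarith) (N1_ne hd C (rpow_ne_top_of_nonneg (by norm_num) hA) hc.symm.lt), fun κ hκ h2 => ?_⟩
    have a1 := LB.adj h22 hκ h2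
    have a2 := use1_lt hd hc.symm.lt hlt hκ.adj a1
    have a3 := LB.adj hc hκ.adj a2
    rwa [adj_adj] at a3
end

section
variable {d : ℕ} {C : ℝ} {κ : ℝ → ℝ → Spc d → ℝ}

def Hx (d : ℕ) (C : ℝ) (x x' x'' : Spc d) : EE := eR (C * ‖x' - x''‖ * ‖x - x'‖^(-((d:ℝ)+1))) * Jc ℝ (((d:ℝ)+1)/2)

def Nby (d : ℕ) (k : ℤ) (j : Fin d → ℤ) : Set (Spc d) := closedBall (cnr d k j) ((5*d+1) * (2:ℝ)^(-k))
lemma nby_geo (hd : 1 ≤ d) {k : ℤ} {x x' x'' : Spc d} (h : (dyaS d hd).π k x' = (dyaS d hd).π k x'') (hx : x ∉ Nby d k ((dyaS d hd).π k x')) :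
    (2:ℝ)^(-k) ≤ ‖x - x'‖ ∧ ‖x' - x''‖ ≤ 2 * d * (2:ℝ)^(-k) ∧ ‖x' - x''‖ ≤ ‖x - x'‖/2 := by
  have h1 := cell_S hd k x'
  have h2 := cell_S hd k x''
  rw [← h] at h2
  rw [Nby, mem_closedBall, not_le, dist_eq_norm] at hx
  have hl : (0:ℝ) < 2^(-k) := by positivity
  generalize (2:ℝ)^(-k) = l at *
  generalize cnr d k ((dyaS d hd).π k x') = c at *
  have a1 : ‖x - c‖ ≤ ‖x - x'‖ + ‖x' - c‖ := norm_sub_le_norm_sub_add_norm_sub _ _ _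
  have a2 : ‖x' - x''‖ ≤ ‖x' - c‖ + ‖x'' - c‖ := by
    have := norm_sub_le_norm_sub_add_norm_sub x' c x''
    rwa [norm_sub_rev c x''] at this
  have hd1 : (1:ℝ) ≤ d := by exact_mod_cast hd
  refine ⟨?_, ?_, ?_⟩ <;> nlinarith
lemma hx1 (hd : 1 ≤ d) (hκ : Ker d C κ) {k : ℤ} {x x' x'' : Spc d} (h : (dyaS d hd).π k x' = (dyaS d hd).π k x'') (hx : x ∉ Nby d k ((dyaS d hd).π k x'))
    (t : ℝ) : ∫⁻ s, ‖KK κ (x,t) (x',s) - KK κ (x,t) (x'',s)‖ₑ ≤ Hx d C x x' x'' := by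
  obtain ⟨h1, h2, h3⟩ := nby_geo hd h hx
  exact hor2 d C hκ (lt_of_lt_of_le (by positivity) h1) h3 t
lemma hx2 (hd : 1 ≤ d) (hκ : Ker d C κ) {k : ℤ} {x x' x'' : Spc d} (h : (dyaS d hd).π k x' = (dyaS d hd).π k x'') (hx : x ∉ Nby d k ((dyaS d hd).π k x'))
    (s : ℝ) : ∫⁻ t, ‖KK κ (x,t) (x',s) - KK κ (x,t) (x'',s)‖ₑ ≤ Hx d C x x' x'' := by
  obtain ⟨h1, h2, h3⟩ := nby_geo hd h hx
  have e : ∀ a b : Spc d, ‖-a - -b‖ = ‖a - b‖ := fun a b => by rw [← norm_neg]; congr 1; abel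
  have := hor2 d C hκ.adj (x := -x) (x' := -x') (x'' := -x'') (by rw [e]; exact lt_of_lt_of_le (by positivity) h1) (by rw [e, e]; exact h3) s
  rw [e, e] at this
  refine le_trans (le_of_eq (lintegral_congr fun t => ?_)) this
  simp only [KK, adj]
  congr 3 <;> congr 1 <;> abel

def Bx (d : ℕ) (C : ℝ) : EE := eR (C * (2*d) * 2^((d:ℝ)+1)) * Jc (Spc d) 1 * Jc ℝ (((d:ℝ)+1)/2)
lemma hx3 (hd : 1 ≤ d) (hC : 0 ≤ C) {k : ℤ} {x' x'' : Spc d} (h : (dyaS d hd).π k x' = (dyaS d hd).π k x'') :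
    ∫⁻ x in (Nby d k ((dyaS d hd).π k x'))ᶜ, Hx d C x x' x'' ≤ Bx d C := by
  have hl : (0:ℝ) < 2^(-k) := by positivity
  have hJ : Jc ℝ (((d:ℝ)+1)/2) ≠ ∞ := Jc_ne (by positivity)
  calc _ ≤ ∫⁻ x in (Nby d k ((dyaS d hd).π k x'))ᶜ, eR (C * (2*d) * 2^((d:ℝ)+1) * (2:ℝ)^(-k)) * eR (((2:ℝ)^(-k) + ‖x - x'‖)^(-((d:ℝ)+1))) * Jc ℝ (((d:ℝ)+1)/2) := by
        refine setLIntegral_mono' measurableSet_closedBall.compl fun x hx => ?_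
        obtain ⟨h1, h2, h3⟩ := nby_geo hd h hx
        unfold Hx
        rw [← ENNReal.ofReal_mul (by positivity)]
        refine mul_le_mul_left (ofReal_le_ofReal ?_) _
        have := rpow_half_le (a := (2:ℝ)^(-k) + ‖x - x'‖) (b := ‖x - x'‖) (m := (d:ℝ)+1) (by positivity) (by linarith) (by positivity)
        calc _ ≤ C * (2 * d * (2:ℝ)^(-k)) * (2 ^ ((d:ℝ)+1) * ((2:ℝ)^(-k) + ‖x - x'‖) ^ (-((d:ℝ)+1))) := by gcongr
          _ = _ := by ring
    _ ≤ ∫⁻ x : Spc d, eR (C * (2*d) * 2^((d:ℝ)+1) * (2:ℝ)^(-k)) * eR (((2:ℝ)^(-k) + ‖x - x'‖)^(-((d:ℝ)+1))) * Jc ℝ (((d:ℝ)+1)/2) := setLIntegral_le_lintegral _ _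
    _ = _ := by
        rw [lintegral_mul_const' _ _ hJ, lintegral_const_mul' _ _ (by simp), scS _ _ _ hl, ENNReal.ofReal_mul (by positivity), Bx]
        have : eR ((2:ℝ)^(-k)) * eR (((2:ℝ)^(-k))^(-1:ℝ)) = 1 := by rw [← ENNReal.ofReal_mul hl.le, rpow_neg_one, mul_inv_cancel₀ hl.ne']; simp
        calc _ = eR (C * (2*d) * 2^((d:ℝ)+1)) * (eR ((2:ℝ)^(-k)) * eR (((2:ℝ)^(-k))^(-1:ℝ))) * Jc (Spc d) 1 * Jc ℝ (((d:ℝ)+1)/2) := by ring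
          _ = _ := by rw [this, mul_one]
lemma Bx_ne (d : ℕ) (C : ℝ) : Bx d C ≠ ∞ := mul_ne_top (mul_ne_top ofReal_ne_top (Jc_ne (by norm_num))) (Jc_ne (by positivity))

def Dx' (d : ℕ) : EE := eR ((5*d+1)^d) * volume (ball (0:Spc d) 1)
lemma vol_Nby (hd : 1 ≤ d) (k : ℤ) (i : Fin d → ℤ) : volume (Nby d k i) ≤ Dx' d * (dyaS d hd).v k := by
  rw [Nby, Measure.addHaar_closedBall _ _ (by positivity), mul_pow, ENNReal.ofReal_mul (by positivity), Dx']
  show _ ≤ _ * eR (((2:ℕ):ℝ)^(-k))^d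
  rw [ENNReal.ofReal_pow (p := (2:ℝ)^(-k)) (by positivity)]
  simp only [finrank_euclideanSpace, Fintype.card_fin]
  push_cast
  apply le_of_eq; ring
lemma LB.mixed_base {q : ℝ} {A : EE} (h : LB κ q A) (f : Spc d × ℝ → ℝ) (hf : Good volume volume f) :
    ∫⁻ z, ‖Tk (volume.prod volume) (KK κ) f z‖ₑ^q ∂(volume.prod volume) ≤ A * ∫⁻ z, ‖f z‖ₑ^q ∂(volume.prod volume) := by
  obtain ⟨E, F, e1, e2, e3, e4, e5⟩ := hf.supp
  refine h f hf.meas hf.bdd ⟨E ×ˢ F, e1.prod e2, ?_, fun z hz => e5 z ?_⟩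
  · rw [Measure.volume_eq_prod, Measure.prod_prod]; exact mul_ne_top e3 e4
  · by_contra hc; push Not at hc; exact hz ⟨hc.1, hc.2⟩

def N2 (d : ℕ) (hd : 1 ≤ d) (C : ℝ) (A : EE) (p q : ℝ) : EE := eR (2^p * p) * (A * eR (1/(q-p)) + (A * (dyaS d hd).D^q + Dx' d + Bx d C * (dyaS d hd).D) * (2 * (eR (1/(p-1)) * 2^(p-1))))
lemma N2_ne (hd : 1 ≤ d) (C : ℝ) {A : EE} (hA : A ≠ ∞) {p q : ℝ} (hp : 1 < p) (hq : 1 < q) : N2 d hd C A p q ≠ ∞ := by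
  unfold N2
  exact cz_const_ne ofReal_ne_top hA (Dya.Dt _) (mul_ne_top ofReal_ne_top measure_ball_lt_top.ne) (Bx_ne d C) ofReal_ne_top ofReal_ne_top hq hp
lemma measHx (d : ℕ) (C : ℝ) : Measurable (fun z : Spc d × (Spc d × Spc d) => Hx d C z.1 z.2.1 z.2.2) := by unfold Hx; fun_prop
lemma use2_lt (hd : 1 ≤ d) {A : EE} {p q : ℝ} (hp : 1 < p) (hpq : p < q) (h : Ker d C κ) (h2 : LB κ q A) (f : Spc d × ℝ → ℝ) (hf : Good volume volume f) :
    ∫⁻ x, nq q volume (Tk (volume.prod volume) (KK κ) f) x ^ p ≤ N2 d hd C A p q * ∫⁻ x, nq q volume f x ^ p := by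
  obtain ⟨C3, h0, h1⟩ := h.schur
  have hC := h.Cpos
  exact cz (dyaS d hd) (fun x U hU hx => (hU_S hd x U hU hx).elim fun k hk => ⟨k, hk k le_rfl⟩) hp hpq h.measKK (fun z => ((h1 z).trans_lt h0.lt_top).ne) A
    h2.mixed_base (Nby d) (fun k i => measurableSet_closedBall) (Dx' d) (vol_Nby hd) (Hx d C) (measHx d C)
    (fun k x x' x'' g1 g2 y => hx1 hd h g1 g2 y) (fun k x x' x'' g1 g2 y => hx2 hd h g1 g2 y) (Bx d C) (fun k x' x'' g => hx3 hd hC g) hf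
theorem ker_bound (hd : 1 ≤ d) (C : ℝ) {A2 : EE} (hA : A2 ≠ ∞) {p q : ℝ} (hp : 1 < p) (hq : 1 < q) : ∃ N : EE, N ≠ ∞ ∧ ∀ κ : ℝ → ℝ → Spc d → ℝ,
    Ker d C κ → LB κ 2 A2 → ∀ f : Spc d × ℝ → ℝ, Good volume volume f →
    ∫⁻ x, nq q volume (Tk (volume.prod volume) (KK κ) f) x ^ p ≤ N * ∫⁻ x, nq q volume f x ^ p := by
  obtain ⟨A, hA1, hA3⟩ := use1 hd C hA hq
  rcases lt_trichotomy p q with h | h | h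
  · exact ⟨_, N2_ne hd C hA1 hp hq, fun κ hκ h2 => use2_lt hd hp h hκ (hA3 κ hκ h2)⟩
  · subst h
    refine ⟨A, hA1, fun κ hκ h2 f hf => ?_⟩
    have := (hA3 κ hκ h2).mixed_base f hf
    simp_rw [nq_pow hp]
    rw [← lintegral_prod (fun z => ‖Tk (volume.prod volume) (KK κ) f z‖ₑ^p), ← lintegral_prod (fun z => ‖f z‖ₑ^p)]
    · exact this
    · exact (hf.meas.enorm.pow_const _).aemeasurable
    · exact ((meas_Tk hκ.measKK hf.meas).enorm.pow_const _).aemeasurable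
  · have hcp : p.HolderConjugate (p.conjExponent) := Real.HolderConjugate.conjExponent hp
    have hcq : q.HolderConjugate (q.conjExponent) := Real.HolderConjugate.conjExponent hq
    have hlt : p.conjExponent < q.conjExponent := by rw [conjExponent, conjExponent, div_lt_div_iff₀ (by linarith) (by linarith)]; linarith
    refine ⟨N2 d hd C (A^(q.conjExponent-1)) p.conjExponent q.conjExponent ^ (p-1), rpow_ne_top_of_nonneg (by linarith)
      (N2_ne hd C (rpow_ne_top_of_nonneg (by linarith [hcq.symm.lt]) hA1) hcp.symm.lt hcq.symm.lt), fun κ hκ h2 f hf => ?_⟩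
    have a1 := LB.adj hcq.symm hκ (hA3 κ hκ h2)
    obtain ⟨C3, h0, h1⟩ := hκ.schur
    refine dual hcp hcq h.le hκ.measKK h0 h1 _ (fun g hg => ?_) hf
    have := use2_lt hd hcp.symm.lt hlt hκ.adj a1 g hg
    rwa [KK_adj] at this
end

def ee {d : ℕ} (x ξ : Spc d) : ℂ := Complex.exp (((2*rPi*inner ℝ ξ x : ℝ):ℂ) * Complex.I)

def mon {d n : ℕ} (I : Fin n → Fin d) (ξ : Spc d) : ℝ := ∏ l, ξ (I l)
lemma norm_ee {d : ℕ} (x ξ : Spc d) : ‖ee x ξ‖ = 1 := Complex.norm_exp_ofReal_mul_I _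

section
variable {d : ℕ}
open scoped SchwartzMap FourierTransform
lemma iter_exp_neg (n : ℕ) : iteratedDeriv n (fun y : ℝ => Complex.exp (-(y:ℂ))) = fun y : ℝ => (-1)^n * Complex.exp (-(y:ℂ)) := by
  induction n with
  | zero => simp
  | succ n ih =>
    rw [iteratedDeriv_succ, ih]
    ext y
    have h : HasDerivAt (fun y : ℝ => -(y:ℂ)) (-1) y := by exact (ofRealCLM.hasDerivAt (x := y)).neg
    have := (h.cexp.const_mul ((-1:ℂ)^n)).deriv
    rw [this]; ring
lemma cd_exp_neg : ContDiff ℝ (⊤:ℕ∞) (fun y : ℝ => Complex.exp (-(y:ℂ))) := (ofRealCLM.contDiff.neg).cexp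
lemma gauss_decay (k n : ℕ) : ∃ C : ℝ, ∀ x : Spc d, ‖x‖^k * ‖iteratedFDeriv ℝ n (fun x : Spc d => Complex.exp (-((‖x‖^2 : ℝ):ℂ))) x‖ ≤ C := by
  obtain ⟨m, C, hC, h⟩ := (Function.hasTemperateGrowth_norm_sq (H := Spc d)).norm_iteratedFDeriv_le_uniform n
  have key : ∀ x : Spc d, ‖iteratedFDeriv ℝ n (fun x : Spc d => Complex.exp (-((‖x‖^2 : ℝ):ℂ))) x‖ ≤ n.factorial * eX (-‖x‖^2) * ((C+1) * (1+‖x‖)^m)^n := by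
    intro x
    have := norm_iteratedFDeriv_comp_le (𝕜 := ℝ) (g := fun y : ℝ => Complex.exp (-(y:ℂ))) (f := fun x : Spc d => ‖x‖^2) (n := n) (N := (⊤:ℕ∞)) cd_exp_neg
      (contDiff_norm_sq ℝ) (by exact_mod_cast le_top) x (C := eX (-‖x‖^2)) (D := (C+1) * (1+‖x‖)^m) ?_ ?_
    · exact this
    · intro i _
      rw [norm_iteratedFDeriv_eq_norm_iteratedDeriv, iter_exp_neg]
      simp [Complex.norm_exp, ← Complex.ofReal_pow]
    · intro i hi1 hi
      have h1 : 1 ≤ (C+1) * (1+‖x‖)^m := by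
        have : (1:ℝ) ≤ (1+‖x‖)^m := one_le_pow₀ (by linarith [norm_nonneg x])
        nlinarith
      refine (h i hi x).trans ?_
      calc _ ≤ (C+1) * (1+‖x‖)^m := by gcongr; linarith
        _ ≤ _ := le_self_pow₀ h1 (by omega)
  obtain ⟨B, hB⟩ : ∃ B : ℝ, ∀ r : ℝ, 0 ≤ r → (1+r)^(k+m*n) * eX (-r^2) ≤ B := by
    refine ⟨(k+m*n).factorial * eX 2, fun r hr => ?_⟩
    have := pow_div_factorial_le_exp (1+r) (by linarith) (k+m*n)
    rw [div_le_iff₀ (by positivity)] at this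
    calc _ ≤ eX (1+r) * (k+m*n).factorial * eX (-r^2) := by gcongr
      _ = (k+m*n).factorial * eX (1+r + -r^2) := by rw [Real.exp_add (1+r)]; ring
      _ ≤ _ := by gcongr; nlinarith [sq_nonneg (r-1)]
  refine ⟨n.factorial * (C+1)^n * B, fun x => ?_⟩
  have hx := norm_nonneg x
  calc _ ≤ (1+‖x‖)^k * (n.factorial * eX (-‖x‖^2) * ((C+1) * (1+‖x‖)^m)^n) := by
        gcongr
        · linarith
        · exact key x
    _ = n.factorial * (C+1)^n * ((1+‖x‖)^(k+m*n) * eX (-‖x‖^2)) := by rw [mul_pow, pow_add, pow_mul]; ring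
    _ ≤ _ := by gcongr; exact hB _ hx

def gaussS (d : ℕ) : 𝓢(Spc d, ℂ) where
  toFun x := Complex.exp (-((‖x‖^2 : ℝ):ℂ))
  smooth' := cd_exp_neg.comp (contDiff_norm_sq ℝ)
  decay' := gauss_decay
lemma mon_tg {n : ℕ} (I : Fin n → Fin d) : Function.HasTemperateGrowth (fun ξ : Spc d => ((mon I ξ : ℝ):ℂ)) := by
  refine (Function.Complex.hasTemperateGrowth_ofReal).comp ?_
  induction n with
  | zero =>
    have : mon I = fun _ : Spc d => (1:ℝ) := by ext ξ; simp [mon]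
    rw [this]; exact Function.HasTemperateGrowth.const (E := Spc d) (1:ℝ)
  | succ n ih =>
    have : mon I = fun ξ : Spc d => ξ (I 0) * mon (fun l => I l.succ) ξ := by ext ξ; simp [mon, Fin.prod_univ_succ]
    rw [this]
    exact ((EuclideanSpace.proj (I 0) : Spc d →L[ℝ] ℝ).hasTemperateGrowth).mul (ih _)
lemma phi_decay {n : ℕ} (I : Fin n → Fin d) (N : ℕ) : ∃ C : ℝ, 0 ≤ C ∧ ∀ y : Spc d,
    (1+‖y‖)^N * ‖∫ ζ, ((mon I ζ : ℝ):ℂ) * Complex.exp (-((‖ζ‖^2 : ℝ):ℂ)) * ee y ζ‖ ≤ C := by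
  let Φ : 𝓢(Spc d, ℂ) := SchwartzMap.smulLeftCLM ℂ (fun ξ : Spc d => ((mon I ξ : ℝ):ℂ)) (gaussS d)
  have hΦ : ∀ ζ, Φ ζ = ((mon I ζ : ℝ):ℂ) * Complex.exp (-((‖ζ‖^2 : ℝ):ℂ)) := fun ζ => SchwartzMap.smulLeftCLM_apply_apply (mon_tg I) _ ζ
  have key := fun y => SchwartzMap.one_add_le_sup_seminorm_apply (𝕜 := ℂ) (m := (N,0)) (k := N) (n := 0) le_rfl le_rfl (𝓕⁻ Φ) y
  refine ⟨_, le_trans (by positivity) (key 0), fun y => ?_⟩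
  · refine le_trans (le_of_eq ?_) (key y)
    rw [norm_iteratedFDeriv_zero, SchwartzMap.fourierInv_coe, fourierInv_eq']
    congr 2
    refine integral_congr_ae (evAll fun ζ => ?_)
    simp only [hΦ, smul_eq_mul, ee]
    ring
end

def QQ {d : ℕ} (A : Mtx d) (ξ : Spc d) : ℝ := ∑ i, ∑ j, A i j * ξ i * ξ j

def SB {d : ℕ} (σ ρ : ℝ) (A : Mtx d) : Prop := A.IsSymm ∧ ∀ ξ : Spc d, (σ*ρ*‖ξ‖)^2 ≤ QQ A ξ ∧ QQ A ξ ≤ (ρ/σ*‖ξ‖)^2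

def kf {d n : ℕ} (I : Fin n → Fin d) (A : Mtx d) (x : Spc d) : ℂ := ∫ ξ, ((mon I ξ : ℝ):ℂ) * Complex.exp (-((QQ A ξ : ℝ):ℂ)) * ee x ξ

section
variable {d : ℕ}

open scoped MatrixOrder in
open scoped Matrix.Norms.L2Operator in
lemma psd_fac {A : Mtx d} (h : A.PosSemidef) : ∃ B : Mtx d, A = B.conjTranspose * B := CStarAlgebra.nonneg_iff_eq_star_mul_self.mp h.nonneg
lemma SB.factor {σ ρ : ℝ} (hσ : 0 < σ) (hρ : 0 < ρ) {A : Mtx d} (h : SB σ ρ A) :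
    ∃ L e : Spc d →ₗ[ℝ] Spc d, (∀ ζ, QQ A (L ζ) = ‖ζ‖^2) ∧ (∀ ζ, L (e ζ) = ζ) ∧ LinearMap.det L ≠ 0 ∧
      (∀ ζ, ‖L ζ‖ ≤ (σ*ρ)⁻¹ * ‖ζ‖) ∧ (∀ ζ, ‖e ζ‖ ≤ ρ/σ*‖ζ‖) := by
  have hps : A.PosSemidef := by
    refine Matrix.PosSemidef.of_dotProduct_mulVec_nonneg ?_ fun x => ?_
    · rw [Matrix.IsHermitian, Matrix.conjTranspose_eq_transpose_of_trivial]; exact h.1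
    · have := (sq_nonneg _).trans (h.2 (WithLp.toLp 2 x)).1
      refine this.trans (le_of_eq ?_)
      simp only [QQ, dotProduct, mulVec, mul_sum]
      refine sum_congr rfl fun i _ => sum_congr rfl fun j _ => ?_
      simp; ring
  obtain ⟨B, hB⟩ : ∃ B : Mtx d, A = B.conjTranspose * B := psd_fac hps
  let e : Spc d →ₗ[ℝ] Spc d := Matrix.toEuclideanLin B
  have he : ∀ ξ, QQ A ξ = ‖e ξ‖^2 := by
    intro ξ
    have h1 : ‖e ξ‖^2 = (B.mulVec ξ) ⬝ᵥ (B.mulVec ξ) := by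
      rw [EuclideanSpace.real_norm_sq_eq]
      simp [e, dotProduct, sq, Matrix.toLpLin_apply]
    have h2 : QQ A ξ = (ξ : Fin d → ℝ) ⬝ᵥ A.mulVec ξ := by
      simp only [QQ, dotProduct, mulVec, mul_sum]
      refine sum_congr rfl fun i _ => sum_congr rfl fun j _ => ?_
      ring
    rw [h1, h2, hB, ← Matrix.mulVec_mulVec, Matrix.dotProduct_mulVec, Matrix.vecMul_conjTranspose]
    simp
  have hl : ∀ ξ, σ*ρ*‖ξ‖ ≤ ‖e ξ‖ := fun ξ => by
    have := (h.2 ξ).1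
    rw [he] at this
    exact (sq_le_sq₀ (by positivity) (by positivity)).1 this
  have hu : ∀ ξ, ‖e ξ‖ ≤ ρ/σ*‖ξ‖ := fun ξ => by
    have := (h.2 ξ).2
    rw [he] at this
    exact (sq_le_sq₀ (by positivity) (by positivity)).1 this
  have hinj : Function.Injective e := by
    rw [injective_iff_map_eq_zero]
    intro ξ hξ
    have := hl ξ
    rw [hξ, norm_zero] at this
    have h3 : 0 < σ*ρ := by positivity
    have : ‖ξ‖ ≤ 0 := by by_contra hc; push Not at hc; nlinarith
    simpa using this
  let E := LinearEquiv.ofInjectiveEndo e hinj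
  have hE : ∀ ξ, E ξ = e ξ := fun ξ => rfl
  refine ⟨E.symm.toLinearMap, e, fun ζ => ?_, fun ζ => ?_, ?_, fun ζ => ?_, hu⟩
  · rw [he, ← hE]; simp
  · rw [← hE]; simp
  · exact (LinearEquiv.isUnit_det' E.symm).ne_zero
  · have := hl (E.symm ζ)
    rw [← hE, LinearEquiv.apply_symm_apply] at this
    rw [← div_eq_inv_mul, le_div_iff₀ (by positivity)]
    simpa [mul_comm] using this
lemma det_le {L : Spc d →ₗ[ℝ] Spc d} {ρ : ℝ} (hρ : 0 ≤ ρ) (h : ∀ ζ, ‖L ζ‖ ≤ ρ * ‖ζ‖) : |LinearMap.det L| ≤ ρ^d := by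
  have h1 := Measure.addHaar_image_linearMap (volume : Measure (Spc d)) L (closedBall 0 1)
  have h2 : L '' closedBall 0 1 ⊆ closedBall 0 ρ := by
    rintro _ ⟨ζ, hζ, rfl⟩
    rw [mem_closedBall_zero_iff] at hζ ⊢
    exact (h ζ).trans (mul_le_of_le_one_right hρ hζ)
  have h3 := measure_mono (μ := volume) h2
  rw [h1, Measure.addHaar_closedBall' _ _ hρ, finrank_euclideanSpace_fin] at h3
  have hb : volume (closedBall (0:Spc d) 1) ≠ 0 := (measure_closedBall_pos _ _ one_pos).ne'
  have hb' : volume (closedBall (0:Spc d) 1) ≠ ∞ := measure_closedBall_lt_top.ne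
  have := (ENNReal.mul_le_mul_iff_left hb hb').1 h3
  exact (ofReal_le_ofReal_iff (by positivity)).1 this
lemma mon_comp {n : ℕ} (I : Fin n → Fin d) (L : Spc d →ₗ[ℝ] Spc d) (ζ : Spc d) :
    mon I (L ζ) = ∑ J : Fin n → Fin d, (∏ l, (L (EuclideanSpace.single (J l) 1)) (I l)) * mon J ζ := by
  have h1 : ∀ i, (L ζ) i = ∑ j, (L (EuclideanSpace.single j 1)) i * ζ j := by
    intro i
    conv_lhs => rw [show ζ = ∑ j, ζ j • EuclideanSpace.single j (1:ℝ) by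
      ext k; simp [Finset.sum_apply, Pi.single_apply]]
    rw [map_sum]
    simp [mul_comm]
  simp only [mon, h1]
  rw [Finset.prod_univ_sum, Fintype.piFinset_univ]
  simp_rw [Finset.prod_mul_distrib]
lemma cov {L : Spc d →ₗ[ℝ] Spc d} (hL : LinearMap.det L ≠ 0) (f : Spc d → ℂ) : ∫ ξ, f ξ = |LinearMap.det L| • ∫ ζ, f (L ζ) := by
  have h1 := Measure.map_linearMap_addHaar_eq_smul_addHaar (volume : Measure (Spc d)) hL
  have hm : MeasurableEmbedding L := ((L.equivOfDetNeZero hL).toContinuousLinearEquiv).toHomeomorph.measurableEmbedding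
  rw [← hm.integral_map, h1, integral_smul_measure, ENNReal.toReal_ofReal (abs_nonneg _), smul_smul, abs_inv, mul_inv_cancel₀ (by simpa using hL), one_smul]
lemma gJ_int {n : ℕ} (J : Fin n → Fin d) (y : Spc d) : Integrable fun ζ : Spc d => ((mon J ζ : ℝ):ℂ) * Complex.exp (-((‖ζ‖^2 : ℝ):ℂ)) * ee y ζ := by
  have h1 := (SchwartzMap.smulLeftCLM ℂ (fun ξ : Spc d => ((mon J ξ : ℝ):ℂ)) (gaussS d)).integrable (μ := volume)
  have h2 : Integrable fun ζ : Spc d => ((mon J ζ : ℝ):ℂ) * Complex.exp (-((‖ζ‖^2 : ℝ):ℂ)) := by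
    refine h1.congr (evAll fun ζ => ?_)
    exact SchwartzMap.smulLeftCLM_apply_apply (mon_tg J) _ ζ
  refine h2.mul_bdd (c := 1) ?_ (evAll fun ζ => (norm_ee y ζ).le)
  unfold ee
  exact Continuous.aestronglyMeasurable (by fun_prop)
theorem kf_bound {n : ℕ} (m : ℕ) (I : Fin n → Fin d) {σ : ℝ} (hσ : 0 < σ) (hσ1 : σ ≤ 1) : ∃ C : ℝ, 0 ≤ C ∧ ∀ ρ : ℝ, 0 < ρ → ∀ A, SB σ ρ A → ∀ x : Spc d,
    (ρ + ‖x‖)^(d+n+m) * ‖kf I A x‖ ≤ C * ρ^m := by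
  choose c hc0 hc using fun J : Fin n → Fin d => phi_decay J (d+n+m)
  refine ⟨(σ⁻¹)^(d+n+m) * (σ⁻¹)^(d+n) * ∑ J, c J, by have := sum_nonneg fun J (_ : J ∈ Finset.univ) => hc0 J
                                                     positivity, fun ρ hρ A hA x => ?_⟩
  obtain ⟨L, e, h1, h2, h3, h4, h5⟩ := hA.factor hσ hρ
  let y := LinearMap.adjoint L x
  have hy : ‖x‖ ≤ ρ/σ * ‖y‖ := by
    have : ‖x‖ * ‖x‖ ≤ ρ/σ * ‖y‖ * ‖x‖ := by
      calc ‖x‖ * ‖x‖ = inner ℝ x x := by rw [real_inner_self_eq_norm_sq]; ring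
        _ = inner ℝ (e x) y := by rw [LinearMap.adjoint_inner_right, h2]
        _ ≤ ‖e x‖ * ‖y‖ := real_inner_le_norm _ _
        _ ≤ ρ/σ*‖x‖ * ‖y‖ := by gcongr; exact h5 x
        _ = _ := by ring
    rcases eq_or_lt_of_le (norm_nonneg x) with h | h
    · rw [← h]; positivity
    · exact le_of_mul_le_mul_right this h
  have hee : ∀ ζ, ee x (L ζ) = ee y ζ := fun ζ => by unfold ee; rw [LinearMap.adjoint_inner_right]
  have hk : kf I A x = |LinearMap.det L| • ∑ J : Fin n → Fin d, (((∏ l, (L (EuclideanSpace.single (J l) 1)) (I l) : ℝ)):ℂ) *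
      ∫ ζ, ((mon J ζ : ℝ):ℂ) * Complex.exp (-((‖ζ‖^2 : ℝ):ℂ)) * ee y ζ := by
    rw [kf, cov h3]
    congr 1
    simp_rw [h1, hee, mon_comp]
    simp_rw [← integral_const_mul]
    rw [← integral_finsetSum _ fun J _ => (gJ_int J y).const_mul _]
    congr 1; ext ζ
    push_cast
    rw [sum_mul, sum_mul]
    refine sum_congr rfl fun J _ => by ring
  have hs : 0 < σ*ρ := by positivity
  have hb : ‖kf I A x‖ ≤ ((σ*ρ)⁻¹)^(d+n) * ∑ J : Fin n → Fin d, ‖∫ ζ, ((mon J ζ : ℝ):ℂ) * Complex.exp (-((‖ζ‖^2 : ℝ):ℂ)) * ee y ζ‖ := by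
    rw [hk, norm_smul, pow_add, mul_assoc, norm_eq_abs, abs_abs]
    refine mul_le_mul (det_le (by positivity) h4) ?_ (norm_nonneg _) (by positivity)
    rw [mul_sum]
    refine (norm_sum_le _ _).trans (sum_le_sum fun J _ => ?_)
    rw [norm_mul]
    refine mul_le_mul_of_nonneg_right ?_ (norm_nonneg _)
    rw [norm_real, norm_prod]
    refine (prod_le_prod (fun _ _ => norm_nonneg _) fun l _ => ?_).trans (le_of_eq (by simp : ∏ l : Fin n, (σ*ρ)⁻¹ = _))
    refine (PiLp.norm_apply_le _ _).trans ((h4 _).trans ?_)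
    simp
  have hr : ρ + ‖x‖ ≤ ρ * σ⁻¹ * (1 + ‖y‖) := by
    have : ρ ≤ ρ * σ⁻¹ := le_mul_of_one_le_right hρ.le ((one_le_inv₀ hσ).2 hσ1)
    calc _ ≤ ρ * σ⁻¹ + ρ/σ * ‖y‖ := add_le_add this hy
      _ = _ := by ring
  calc _ ≤ (ρ * σ⁻¹ * (1 + ‖y‖))^(d+n+m) * (((σ*ρ)⁻¹)^(d+n) * ∑ J : Fin n → Fin d, ‖∫ ζ, ((mon J ζ : ℝ):ℂ) * Complex.exp (-((‖ζ‖^2 : ℝ):ℂ)) * ee y ζ‖) := by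
        gcongr
    _ = (ρ * σ⁻¹)^(d+n+m) * ((σ*ρ)⁻¹)^(d+n) * ∑ J : Fin n → Fin d, (1 + ‖y‖)^(d+n+m) * ‖∫ ζ, ((mon J ζ : ℝ):ℂ) * Complex.exp (-((‖ζ‖^2 : ℝ):ℂ)) * ee y ζ‖ := by rw [mul_pow, ← mul_sum]; ring
    _ ≤ (ρ * σ⁻¹)^(d+n+m) * ((σ*ρ)⁻¹)^(d+n) * ∑ J, c J := by
        gcongr with J _
        exact hc J y
    _ = _ := by
        rw [mul_pow, mul_inv, mul_pow, pow_add ρ (d+n) m]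
        have : ρ^(d+n) * ρ⁻¹^(d+n) = 1 := by rw [← mul_pow, mul_inv_cancel₀ hρ.ne', one_pow]
        linear_combination (ρ^m * σ⁻¹^(d+n+m) * σ⁻¹^(d+n) * ∑ J, c J) * this
end

section
variable {d : ℕ}
lemma gint (n : ℕ) {c : ℝ} (hc : 0 < c) : Integrable fun ξ : Spc d => ‖ξ‖^n * eX (-(c*‖ξ‖)^2) := by
  have h1 := (gaussS d).integrable_pow_mul (μ := volume) n
  have h2 := (h1.comp_smul hc.ne').const_mul ((c⁻¹)^n)
  refine h2.congr (evAll fun ξ => ?_)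
  have : ‖gaussS d (c • ξ)‖ = eX (-(c*‖ξ‖)^2) := by
    change ‖Complex.exp (-((‖c • ξ‖^2:ℝ):ℂ))‖ = _
    rw [← ofReal_neg, ← ofReal_exp, norm_real, norm_of_nonneg (exp_nonneg _), norm_smul, norm_of_nonneg hc.le]
  simp only [this, norm_smul, norm_of_nonneg hc.le, mul_pow]
  have h : c⁻¹^n * c^n = 1 := by rw [← mul_pow, inv_mul_cancel₀ hc.ne', one_pow]
  linear_combination ‖ξ‖ ^ n * eX (-(c^2*‖ξ‖^2)) * h
lemma mon_le {n : ℕ} (I : Fin n → Fin d) (ξ : Spc d) : |mon I ξ| ≤ ‖ξ‖^n := by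
  rw [mon, Finset.abs_prod]
  refine (prod_le_prod (fun _ _ => abs_nonneg _) fun l _ => PiLp.norm_apply_le ξ (I l)).trans (by simp)
lemma mon_snoc {n : ℕ} (I : Fin n → Fin d) (k : Fin d) (ξ : Spc d) : mon (Fin.snoc I k : Fin (n+1) → Fin d) ξ = mon I ξ * ξ k := by simp [mon, Fin.prod_univ_castSucc]
lemma mon_cont {n : ℕ} (I : Fin n → Fin d) : Continuous (mon I) := by unfold mon; fun_prop
lemma QQ_cont (A : Mtx d) : Continuous (QQ A) := by unfold QQ; fun_prop
lemma norm_cexp_neg (r : ℝ) : ‖Complex.exp (-(r:ℂ))‖ = eX (-r) := by rw [← ofReal_neg, ← ofReal_exp, norm_real, norm_of_nonneg (exp_nonneg _)]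

def ki {n : ℕ} (I : Fin n → Fin d) (A : Mtx d) (x ξ : Spc d) : ℂ := ((mon I ξ : ℝ):ℂ) * Complex.exp (-((QQ A ξ : ℝ):ℂ)) * ee x ξ
lemma ki_bd {n : ℕ} (I : Fin n → Fin d) {A : Mtx d} {σ ρ : ℝ} (h : SB σ ρ A) (x ξ : Spc d) : ‖ki I A x ξ‖ ≤ ‖ξ‖^n * eX (-(σ*ρ*‖ξ‖)^2) := by
  rw [ki, norm_mul, norm_mul, norm_ee, mul_one, norm_cexp_neg, norm_real]
  gcongr
  · exact mon_le I ξ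
  · exact (h.2 ξ).1
lemma ee_cont (x : Spc d) : Continuous (ee x) := by unfold ee; fun_prop
lemma ki_cont {n : ℕ} (I : Fin n → Fin d) (A : Mtx d) (x : Spc d) : Continuous (ki I A x) := by
  have := mon_cont I
  have := QQ_cont A
  have := ee_cont x
  unfold ki; fun_prop
lemma ki_int {n : ℕ} (I : Fin n → Fin d) {A : Mtx d} {σ ρ : ℝ} (hσ : 0 < σ) (hρ : 0 < ρ) (h : SB σ ρ A) (x : Spc d) : Integrable (ki I A x) :=
  (gint n (mul_pos hσ hρ)).mono' (ki_cont I A x).aestronglyMeasurable (evAll fun ξ => by simpa using ki_bd I h x ξ)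
lemma QQ_lin (A A' : Mtx d) (θ : ℝ) (ξ : Spc d) : QQ (A + θ • (A' - A)) ξ = QQ A ξ + θ * (QQ A' ξ - QQ A ξ) := by
  simp only [QQ, ← sum_sub_distrib, mul_sum, ← sum_add_distrib]
  refine sum_congr rfl fun i _ => sum_congr rfl fun j _ => ?_
  simp; ring
lemma SB.conv {A A' : Mtx d} {σ ρ : ℝ} (h : SB σ ρ A) (h' : SB σ ρ A') {θ : ℝ} (h0 : 0 ≤ θ) (h1 : θ ≤ 1) : SB σ ρ (A + θ • (A' - A)) := by
  refine ⟨?_, fun ξ => ?_⟩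
  · exact h.1.add ((h'.1.sub h.1).smul θ)
  · rw [QQ_lin]
    have a := h.2 ξ
    have b := h'.2 ξ
    constructor <;> nlinarith
lemma QQ_le (B : Mtx d) (ξ : Spc d) : |QQ B ξ| ≤ (∑ i, ∑ j, |B i j|) * ‖ξ‖^2 := by
  unfold QQ
  rw [sum_mul]
  refine (abs_sum_le_sum_abs _ _).trans (sum_le_sum fun i _ => ?_)
  rw [sum_mul]
  refine (abs_sum_le_sum_abs _ _).trans (sum_le_sum fun j _ => ?_)
  rw [abs_mul, abs_mul, mul_assoc, sq]
  gcongr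
  · exact PiLp.norm_apply_le ξ i
  · exact PiLp.norm_apply_le ξ j

def kd {n : ℕ} (I : Fin n → Fin d) (A A' : Mtx d) (x h : Spc d) (θ : ℝ) (ξ : Spc d) : ℂ := (-((QQ A' ξ - QQ A ξ : ℝ):ℂ) + ((2*rPi*inner ℝ ξ h:ℝ):ℂ)*Complex.I) * ki I (A + θ • (A' - A)) (x + θ • h) ξ
lemma ki_deriv {n : ℕ} (I : Fin n → Fin d) (A A' : Mtx d) (x h ξ : Spc d) (θ : ℝ) :
    HasDerivAt (fun θ : ℝ => ki I (A + θ • (A' - A)) (x + θ • h) ξ) (kd I A A' x h θ ξ) θ := by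
  have e1 : (fun θ : ℝ => ki I (A + θ • (A' - A)) (x + θ • h) ξ) = fun θ : ℝ => ((mon I ξ : ℝ):ℂ) *
      Complex.exp ((-((QQ A ξ + θ * (QQ A' ξ - QQ A ξ) : ℝ):ℂ)) + ((2*rPi*(inner ℝ ξ x + θ * inner ℝ ξ h) : ℝ):ℂ) * Complex.I) := by
    ext θ
    rw [ki, QQ_lin, ee, inner_add_right, inner_smul_right, Complex.exp_add]; ring
  have e2 : kd I A A' x h θ ξ = (-((QQ A' ξ - QQ A ξ : ℝ):ℂ) + ((2*rPi*inner ℝ ξ h:ℝ):ℂ)*Complex.I) * (((mon I ξ : ℝ):ℂ) *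
      Complex.exp ((-((QQ A ξ + θ * (QQ A' ξ - QQ A ξ) : ℝ):ℂ)) + ((2*rPi*(inner ℝ ξ x + θ * inner ℝ ξ h) : ℝ):ℂ) * Complex.I)) := by
    rw [kd]; congr 1; exact congrFun e1 θ
  rw [e1, e2]
  have a1 : HasDerivAt (fun θ : ℝ => ((QQ A ξ + θ * (QQ A' ξ - QQ A ξ) : ℝ):ℂ)) ((QQ A' ξ - QQ A ξ : ℝ):ℂ) θ := by
    have := (((hasDerivAt_id θ).mul_const (QQ A' ξ - QQ A ξ)).const_add (QQ A ξ)).ofReal_comp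
    simpa using this
  have a2 : HasDerivAt (fun θ : ℝ => ((2*rPi*(inner ℝ ξ x + θ * inner ℝ ξ h) : ℝ):ℂ)) ((2*rPi*inner ℝ ξ h:ℝ):ℂ) θ := by
    have := ((((hasDerivAt_id θ).mul_const (inner ℝ ξ h)).const_add (inner ℝ ξ x)).const_mul (2*rPi)).ofReal_comp
    simpa using this
  have := ((a1.neg.add (a2.mul_const Complex.I)).cexp.const_mul ((mon I ξ : ℝ):ℂ))
  refine HasDerivAt.congr_deriv this ?_
  simp only [Pi.add_apply, Pi.neg_apply]; ring
lemma kd_bd {n : ℕ} (I : Fin n → Fin d) {A A' : Mtx d} {σ ρ : ℝ} (h1 : SB σ ρ A) (h2 : SB σ ρ A') (x h ξ : Spc d) {θ : ℝ} (h0 : 0 ≤ θ) (hθ : θ ≤ 1) :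
    ‖kd I A A' x h θ ξ‖ ≤ (∑ i, ∑ j, |(A'-A) i j|) * (‖ξ‖^(n+2) * eX (-(σ*ρ*‖ξ‖)^2)) + 2*rPi*‖h‖ * (‖ξ‖^(n+1) * eX (-(σ*ρ*‖ξ‖)^2)) := by
  have hQ : QQ A' ξ - QQ A ξ = QQ (A' - A) ξ := by
    simp only [QQ, ← sum_sub_distrib]
    refine sum_congr rfl fun i _ => sum_congr rfl fun j _ => ?_
    simp; ring
  rw [kd, norm_mul]
  have b1 : ‖(-((QQ A' ξ - QQ A ξ : ℝ):ℂ) + ((2*rPi*inner ℝ ξ h:ℝ):ℂ)*Complex.I)‖ ≤ (∑ i, ∑ j, |(A'-A) i j|) * ‖ξ‖^2 + 2*rPi*‖h‖*‖ξ‖ := by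
    refine (norm_add_le _ _).trans (add_le_add ?_ ?_)
    · rw [norm_neg, norm_real, hQ]; exact QQ_le _ _
    · rw [norm_mul, Complex.norm_I, mul_one, norm_real, norm_mul, norm_mul]
      have := norm_inner_le_norm (𝕜 := ℝ) ξ h
      rw [norm_of_nonneg pi_pos.le, norm_of_nonneg (by norm_num : (0:ℝ) ≤ 2)]
      nlinarith [pi_pos]
  refine (mul_le_mul b1 (ki_bd I (h1.conv h2 h0 hθ) _ ξ) (norm_nonneg _) ?_).trans (le_of_eq (by ring))
  have := sum_nonneg fun i (_ : i ∈ Finset.univ) => sum_nonneg fun j (_ : j ∈ Finset.univ) => abs_nonneg ((A'-A) i j)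
  positivity
lemma kd_cont {n : ℕ} (I : Fin n → Fin d) (A A' : Mtx d) (x h : Spc d) : Continuous fun z : ℝ × Spc d => kd I A A' x h z.1 z.2 := by
  have := mon_cont I
  have := QQ_cont A
  have := QQ_cont A'
  unfold kd ki ee
  simp_rw [QQ_lin]
  fun_prop
lemma kd_integral {n : ℕ} (I : Fin n → Fin d) {A A' : Mtx d} {σ ρ : ℝ} (hσ : 0 < σ) (hρ : 0 < ρ) (h1 : SB σ ρ A) (h2 : SB σ ρ A') (x h : Spc d) {θ : ℝ} (h0 : 0 ≤ θ) (hθ : θ ≤ 1) :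
   ∫ ξ, kd I A A' x h θ ξ = - ∑ k, ∑ l, (((A'-A) k l:ℝ):ℂ) * kf (Fin.snoc (Fin.snoc I k : Fin (n+1) → Fin d) l : Fin (n+2) → Fin d) (A + θ • (A' - A)) (x + θ • h)
      + (2*rPi*Complex.I) * ∑ k, ((h k : ℝ):ℂ) * kf (Fin.snoc I k : Fin (n+1) → Fin d) (A + θ • (A' - A)) (x + θ • h) := by
  have hc := h1.conv h2 h0 hθ
  have hk : ∀ {m : ℕ} (J : Fin m → Fin d), kf J (A + θ • (A' - A)) (x + θ • h) = ∫ ξ, ki J (A + θ • (A' - A)) (x + θ • h) ξ := fun J => rfl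
  have hi : ∀ {m : ℕ} (J : Fin m → Fin d), Integrable (ki J (A + θ • (A' - A)) (x + θ • h)) := fun J => ki_int J hσ hρ hc _
  simp_rw [hk, ← integral_const_mul]
  have s1 : ∀ k : Fin d, (∑ l, ∫ ξ, (((A'-A) k l:ℝ):ℂ) * ki (Fin.snoc (Fin.snoc I k : Fin (n+1) → Fin d) l : Fin (n+2) → Fin d) (A + θ • (A' - A)) (x + θ • h) ξ)
     = ∫ ξ, ∑ l, (((A'-A) k l:ℝ):ℂ) * ki (Fin.snoc (Fin.snoc I k : Fin (n+1) → Fin d) l : Fin (n+2) → Fin d) (A + θ • (A' - A)) (x + θ • h) ξ := fun k =>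
    (integral_finsetSum _ fun l _ => (hi _).const_mul _).symm
  simp_rw [s1]
  rw [← integral_finsetSum _ fun k _ => integrable_finsetSum _ fun l _ => (hi _).const_mul _,
   ← integral_finsetSum _ fun k _ => (hi _).const_mul _, ← integral_neg, ← integral_const_mul, ← integral_add]
  · congr 1; ext ξ
    simp only [kd, ki, mon_snoc]
    have hQ : QQ A' ξ - QQ A ξ = ∑ k, ∑ l, (A'-A) k l * ξ k * ξ l := by
      simp only [QQ, ← sum_sub_distrib]
      refine sum_congr rfl fun i _ => sum_congr rfl fun j _ => ?_
      simp; ring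
    have hin : (inner ℝ ξ h : ℝ) = ∑ k, h k * ξ k := by simp [PiLp.inner_apply]
    rw [hQ, hin, add_mul]
    push_cast
    congr 1
    · rw [neg_mul, sum_mul]
      congr 1
      refine sum_congr rfl fun i _ => ?_
      rw [sum_mul]
      refine sum_congr rfl fun j _ => by ring
    · rw [mul_sum, mul_sum, sum_mul, sum_mul]
      refine sum_congr rfl fun i _ => by ring
  · exact (integrable_finsetSum _ fun k _ => integrable_finsetSum _ fun l _ => (hi _).const_mul _).neg
  · exact (integrable_finsetSum _ fun k _ => (hi _).const_mul _).const_mul _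
lemma kf_ftc {n : ℕ} (I : Fin n → Fin d) {A A' : Mtx d} {σ ρ : ℝ} (hσ : 0 < σ) (hρ : 0 < ρ) (h1 : SB σ ρ A) (h2 : SB σ ρ A') (x h : Spc d) :
   kf I A' (x + h) - kf I A x = ∫ θ in (0:ℝ)..1, ∫ ξ, kd I A A' x h θ ξ := by
  have e0 : kf I A' (x+h) - kf I A x = ∫ ξ, (ki I A' (x+h) ξ - ki I A x ξ) := by rw [integral_sub (ki_int I hσ hρ h2 _) (ki_int I hσ hρ h1 _)]; rfl
  have e1 : ∀ ξ, ki I A' (x+h) ξ - ki I A x ξ = ∫ θ in (0:ℝ)..1, kd I A A' x h θ ξ := by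
    intro ξ
    rw [intervalIntegral.integral_eq_sub_of_hasDerivAt (fun θ _ => ki_deriv I A A' x h ξ θ)]
    · simp
    · exact ((kd_cont I A A' x h).comp (by fun_prop : Continuous fun θ : ℝ => (θ, ξ))).intervalIntegrable _ _
  rw [e0]
  simp_rw [e1, intervalIntegral.integral_of_le zero_le_one]
  rw [integral_integral_swap]
  have hg : Integrable (fun ξ : Spc d => (∑ i, ∑ j, |(A'-A) i j|) * (‖ξ‖^(n+2) * eX (-(σ*ρ*‖ξ‖)^2)) + 2*rPi*‖h‖ * (‖ξ‖^(n+1) * eX (-(σ*ρ*‖ξ‖)^2))) := ((gint _ (mul_pos hσ hρ)).const_mul _).add ((gint _ (mul_pos hσ hρ)).const_mul _)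
  have hg2 := hg.comp_fst (volume.restrict (Ioc (0:ℝ) 1))
  refine hg2.mono' ((kd_cont I A A' x h).comp continuous_swap).aestronglyMeasurable ?_
  have : ∀ᵐ θ ∂(volume.restrict (Ioc (0:ℝ) 1)), θ ∈ Ioc (0:ℝ) 1 := ae_restrict_mem measurableSet_Ioc
  have := (Measure.quasiMeasurePreserving_snd (μ := (volume : Measure (Spc d))) (ν := volume.restrict (Ioc (0:ℝ) 1))).ae this
  filter_upwards [this] with z hz
  exact kd_bd I h1 h2 x h z.1 hz.1.le hz.2
theorem kf_diff {n : ℕ} (I : Fin n → Fin d) {σ : ℝ} (hσ : 0 < σ) (hσ1 : σ ≤ 1) : ∃ C : ℝ, 0 ≤ C ∧ ∀ ρ : ℝ, 0 < ρ → ∀ A A', SB σ ρ A → SB σ ρ A' →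
   ∀ M, (∀ k l, |(A'-A) k l| ≤ M) → ∀ x x' : Spc d, ‖x - x'‖ ≤ (ρ+‖x‖)/2 →
    (ρ + ‖x‖)^(d+n+2) * ‖kf I A x - kf I A' x'‖ ≤ C * (M + ‖x-x'‖*(ρ+‖x‖)) := by
  choose c1 hc1 hb1 using fun k : Fin d => kf_bound 0 (Fin.snoc I k : Fin (n+1) → Fin d) hσ hσ1
  choose c2 hc2 hb2 using fun (k l : Fin d) => kf_bound 0 (Fin.snoc (Fin.snoc I k : Fin (n+1) → Fin d) l : Fin (n+2) → Fin d) hσ hσ1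
  have p1 := sum_nonneg fun k (_ : k ∈ Finset.univ) => hc1 k
  have p2 := sum_nonneg fun k (_ : k ∈ Finset.univ) => sum_nonneg fun l (_ : l ∈ Finset.univ) => hc2 k l
  have hπ := pi_pos
  set S1 := ∑ k, c1 k
  set S2 := ∑ k, ∑ l, c2 k l
  refine ⟨2^(d+n+2) * (S2 + 2*rPi*S1), by positivity, fun ρ hρ A A' hA hA' M hM x x' hx => ?_⟩
  have hy0 : 0 < ρ + ‖x‖ := by positivity
  set y := ρ + ‖x‖
  have hx' : x' = x + (x' - x) := by abel
  have hh : ‖x' - x‖ = ‖x - x'‖ := norm_sub_rev _ _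
  rcases isEmpty_or_nonempty (Fin d) with hem | hne
  · have : x = x' := by ext i; exact hem.elim i
    have hAA : A = A' := by ext i; exact hem.elim i
    subst this; subst hAA
    have hS2 : S2 = 0 := by simp [S2]
    have hS1 : S1 = 0 := by simp [S1]
    simp [hS1, hS2]
  have hM0 : 0 ≤ M := (abs_nonneg _).trans (hM hne.some hne.some)
  have key : ∀ θ ∈ uIoc (0:ℝ) 1, ‖∫ ξ, kd I A A' x (x'-x) θ ξ‖ ≤ (S2 * M * (2/y)^(d+n+2) + 2*rPi*S1*‖x-x'‖*(2/y)^(d+n+1)) := by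
    intro θ hθ
    rw [uIoc_of_le zero_le_one] at hθ
    rw [kd_integral I hσ hρ hA hA' x _ hθ.1.le hθ.2]
    have hSB := hA.conv hA' hθ.1.le hθ.2
    have hyθ : y/2 ≤ ρ + ‖x + θ • (x'-x)‖ := by
      have a1 : ‖x‖ ≤ ‖x + θ • (x'-x)‖ + ‖θ • (x'-x)‖ := by
        have := norm_sub_le (x + θ • (x'-x)) (θ • (x'-x))
        simpa using this
      have a2 : ‖θ • (x'-x)‖ ≤ y/2 := by
        rw [norm_smul, hh, norm_of_nonneg hθ.1.le]
        exact (mul_le_of_le_one_left (norm_nonneg _) hθ.2).trans hx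
      linarith
    have conv : ∀ (N : ℕ) (c v : ℝ), 0 ≤ v → (ρ + ‖x + θ • (x'-x)‖)^N * v ≤ c → v ≤ c * (2/y)^N := by
      intro N c v hv hc
      have : (y/2)^N * v ≤ c := le_trans (by gcongr) hc
      have h1 : (y/2)^N * (2/y)^N = 1 := by rw [← mul_pow, div_mul_div_cancel₀ (by norm_num), div_self hy0.ne', one_pow]
      calc v = (y/2)^N * v * (2/y)^N := by linear_combination -v*h1
        _ ≤ _ := by gcongr
    refine (norm_add_le _ _).trans (add_le_add ?_ ?_)
    · rw [norm_neg]
      refine (norm_sum_le _ _).trans ?_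
      simp only [S2, sum_mul]
      refine sum_le_sum fun k _ => (norm_sum_le _ _).trans (sum_le_sum fun l _ => ?_)
      rw [norm_mul, norm_real]
      have := conv (d+(n+1+1)) _ _ (norm_nonneg _) (by simpa using hb2 k l ρ hρ _ hSB (x + θ • (x'-x)))
      calc _ ≤ M * (c2 k l * (2/y)^(d+n+2)) := mul_le_mul (hM k l) this (norm_nonneg _) hM0
        _ = _ := by ring
    · rw [norm_mul, show ‖(2*rPi*Complex.I : ℂ)‖ = 2*rPi by simp [abs_of_pos hπ]]
      have : ‖∑ k, (((x'-x) k : ℝ):ℂ) * kf (Fin.snoc I k : Fin (n+1) → Fin d) (A + θ • (A' - A)) (x + θ • (x'-x))‖ ≤ S1 * ‖x-x'‖ * (2/y)^(d+n+1) := by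
        refine (norm_sum_le _ _).trans ?_
        simp only [S1, sum_mul]
        refine sum_le_sum fun k _ => ?_
        rw [norm_mul, norm_real]
        have := conv (d+(n+1)) _ _ (norm_nonneg _) (by simpa using hb1 k ρ hρ _ hSB (x + θ • (x'-x)))
        calc _ ≤ ‖x-x'‖ * (c1 k * (2/y)^(d+n+1)) := mul_le_mul (hh ▸ PiLp.norm_apply_le _ k) this (norm_nonneg _) (norm_nonneg _)
          _ = _ := by ring
      calc _ ≤ 2*rPi * (S1 * ‖x-x'‖ * (2/y)^(d+n+1)) := by gcongr
        _ = _ := by ring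
  have := intervalIntegral.norm_integral_le_of_norm_le_const key
  rw [← kf_ftc I hσ hρ hA hA' x (x'-x), ← hx', norm_sub_rev] at this
  simp only [sub_zero, abs_one, mul_one] at this
  have hr : ∀ N : ℕ, y^N * (2/y)^N = 2^N := fun N => by rw [← mul_pow, mul_div_cancel₀ _ hy0.ne']
  calc _ ≤ y^(d+n+2) * (S2 * M * (2/y)^(d+n+2) + 2*rPi*S1*‖x-x'‖*(2/y)^(d+n+1)) := by gcongr
    _ = 2^(d+n+2) * S2 * M + 2^(d+n+1) * (2*rPi*S1) * (‖x-x'‖*y) := by rw [← hr (d+n+2), ← hr (d+n+1)]; ring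
    _ ≤ 2^(d+n+2) * (S2 + 2*rPi*S1) * M + 2^(d+n+2) * (S2 + 2*rPi*S1) * (‖x-x'‖*y) := by
        gcongr
        · linarith [mul_nonneg (mul_nonneg (by norm_num : (0:ℝ) ≤ 2) hπ.le) p1]
        · norm_num
        · omega
        · linarith
    _ = _ := by ring
end

section
variable {d : ℕ}
lemma SB.weak {A : Mtx d} {σ r r' : ℝ} (hσ : 0 < σ) (hr : 0 < r) (h1 : r/4 ≤ r') (h2 : r' ≤ 4*r) (h : SB σ (√r') A) : SB (σ/2) (√r) A := by
  have hr' : 0 ≤ r' := by linarith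
  refine ⟨h.1, fun ξ => ⟨le_trans ?_ (h.2 ξ).1, (h.2 ξ).2.trans ?_⟩⟩
  · rw [mul_pow, mul_pow, mul_pow, mul_pow, sq_sqrt hr.le, sq_sqrt hr']
    refine mul_le_mul_of_nonneg_right ?_ (sq_nonneg _)
    nlinarith [sq_nonneg σ]
  · rw [mul_pow, mul_pow, div_pow, div_pow, sq_sqrt hr.le, sq_sqrt hr']
    refine mul_le_mul_of_nonneg_right ?_ (sq_nonneg _)
    rw [div_pow, div_div_eq_mul_div]
    gcongr
    linarith
lemma exp_diff {η r r' : ℝ} (hη : 0 < η) (hr : 0 < r) (h : |r-r'| ≤ r/2) : |eX (-(η*r)) - eX (-(η*r'))| * r ≤ 2*|r-r'| := by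
  have key : ∀ a b : ℝ, r/2 ≤ a → a ≤ b → |eX (-(η*a)) - eX (-(η*b))| * r ≤ 2*(b-a) := by
    intro a b ha hab
    have hle : eX (-(η*b)) ≤ eX (-(η*a)) := exp_le_exp.2 (by nlinarith)
    rw [abs_of_nonneg (by linarith)]
    have e1 : eX (-(η*b)) = eX (-(η*a)) * eX (-(η*(b-a))) := by rw [← Real.exp_add]; ring_nf
    have e2 := add_one_le_exp (-(η*(b-a)))
    have e3 := add_one_le_exp (η*a)
    have e4 : eX (-(η*a)) * eX (η*a) = 1 := by rw [← Real.exp_add]; simp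
    have p := exp_pos (-(η*a))
    have h5 : eX (-(η*a)) * (η*a) ≤ 1 := by nlinarith
    have h6 : eX (-(η*a)) - eX (-(η*b)) ≤ eX (-(η*a)) * (η*(b-a)) := by rw [e1]; nlinarith
    calc _ ≤ eX (-(η*a)) * (η*(b-a)) * (2*a) := by
          refine mul_le_mul h6 (by linarith) hr.le ?_
          have : 0 ≤ b - a := by linarith
          positivity
      _ = (eX (-(η*a)) * (η*a)) * (2*(b-a)) := by ring
      _ ≤ 1 * (2*(b-a)) := mul_le_mul_of_nonneg_right h5 (by linarith)
      _ = _ := one_mul _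
  have hr' := abs_le.1 h
  rcases le_total r r' with h1 | h1
  · have := key r r' (by linarith) h1
    rwa [abs_sub_comm r r', abs_of_nonneg (by linarith : 0 ≤ r' - r)]
  · have := key r' r (by linarith) h1
    rw [abs_sub_comm] at this
    rwa [abs_of_nonneg (by linarith : 0 ≤ r - r')]
theorem kap_core (I : Fin 2 → Fin d) {σ M0 : ℝ} (hσ : 0 < σ) (hσ1 : σ ≤ 1) (hM0 : 0 ≤ M0) : ∃ C : ℝ, 0 ≤ C ∧ ∀ r r' η : ℝ, 0 < r → 0 < η → |r-r'| ≤ r/2 →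
   ∀ A A' : Mtx d, SB σ (√r) A → SB σ (√r') A' → (∀ k l, |(A'-A) k l| ≤ M0 * |r-r'|) → ∀ x x', ‖x-x'‖ ≤ (√r+‖x‖)/2 →
   |eX (-(η*r)) * (kf I A x).re - eX (-(η*r')) * (kf I A' x').re| ≤ C * (‖x-x'‖ + √|r-r'|) * ((√r+‖x‖)^(d+3))⁻¹ := by
  obtain ⟨C1, hC1, h1⟩ := kf_diff I (half_pos hσ) (by linarith)
  obtain ⟨C2, hC2, h2⟩ := kf_bound 2 I (half_pos hσ) (by linarith)
  refine ⟨C1*(M0+1) + 2^(d+4)*C2*2, by positivity, fun r r' η hr hη hrr A A' hA hA' hM x x' hx => ?_⟩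
  have hb := abs_le.1 hrr
  have g1 : SB (σ/2) (√r) A := hA.weak hσ hr (by linarith) (by linarith)
  have g2 : SB (σ/2) (√r) A' := hA'.weak hσ hr (by linarith) (by linarith)
  have hρ : 0 < √r := sqrt_pos.2 hr
  have a1 := h1 (√r) hρ A A' g1 g2 _ hM x x' hx
  have a2 := h2 (√r) hρ A' g2 x'
  rw [sq_sqrt hr.le] at a2
  have a3 := exp_diff hη hr hrr
  have hy0 : 0 < √r + ‖x‖ := by positivity
  have hy1 : (√r + ‖x‖)/2 ≤ √r + ‖x'‖ := by
    have := norm_sub_norm_le x x'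
    linarith
  have hD : |r-r'| ≤ √|r-r'| * (√r + ‖x‖) := by
    have b1 : √|r-r'| ≤ √r + ‖x‖ := (sqrt_le_sqrt (by linarith : |r-r'| ≤ r)).trans (by linarith [norm_nonneg x])
    calc _ = √|r-r'| * √|r-r'| := (Real.mul_self_sqrt (abs_nonneg _)).symm
      _ ≤ _ := by gcongr
  have hX : 0 ≤ ‖x-x'‖ := norm_nonneg _
  generalize √|r-r'| = w at *
  generalize √r + ‖x‖ = y at *
  generalize √r + ‖x'‖ = y' at *
  generalize ‖x-x'‖ = X at *
  have hre1 : |(kf I A x).re - (kf I A' x').re| ≤ ‖kf I A x - kf I A' x'‖ := by rw [← sub_re]; exact abs_re_le_norm _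
  have hre2 : |(kf I A' x').re| ≤ ‖kf I A' x'‖ := abs_re_le_norm _
  generalize ‖kf I A x - kf I A' x'‖ = P at *
  generalize ‖kf I A' x'‖ = P' at *
  generalize hE : |eX (-(η*r)) - eX (-(η*r'))| = E at *
  have hE0 : 0 ≤ E := hE ▸ abs_nonneg _
  have hP' : 0 ≤ P' := (abs_nonneg _).trans hre2
  have hP : 0 ≤ P := (abs_nonneg _).trans hre1
  have step : |eX (-(η*r)) * (kf I A x).re - eX (-(η*r')) * (kf I A' x').re| ≤ P + E * P' := by
    have : eX (-(η*r)) * (kf I A x).re - eX (-(η*r')) * (kf I A' x').re = eX (-(η*r)) * ((kf I A x).re - (kf I A' x').re) + (eX (-(η*r)) - eX (-(η*r'))) * (kf I A' x').re := by ring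
    rw [this]
    refine (abs_add_le _ _).trans ?_
    rw [abs_mul, abs_mul, hE]
    refine add_le_add ?_ (mul_le_mul_of_nonneg_left hre2 hE0)
    rw [abs_of_pos (exp_pos _)]
    refine (mul_le_of_le_one_left (abs_nonneg _) (exp_le_one_iff.2 ?_)).trans hre1
    have := mul_pos hη hr
    linarith
  refine step.trans ?_
  have e1 : y^(d+4) * P ≤ C1*(M0+1)*((X+w)*y) := by
    refine a1.trans ?_
    rw [mul_assoc]
    refine mul_le_mul_of_nonneg_left ?_ hC1
    have hXn : 0 ≤ X * y := by positivity
    nlinarith [abs_nonneg (r-r')]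
  have e2 : y^(d+4) * (E * P') ≤ 2^(d+4)*C2*2*((X+w)*y) := by
    calc _ = (2*(y/2))^(d+4) * (E * P') := by ring
      _ ≤ (2*y')^(d+4) * (E*P') := by gcongr
      _ = 2^(d+4) * E * (y'^(d+4) * P') := by ring
      _ ≤ 2^(d+4) * E * (C2 * r) := by gcongr
      _ = 2^(d+4) * C2 * (E * r) := by ring
      _ ≤ 2^(d+4) * C2 * (2 * ((X+w)*y)) := by
          refine mul_le_mul_of_nonneg_left (a3.trans ?_) (by positivity)
          nlinarith
      _ = _ := by ring
  rw [← div_eq_mul_inv, le_div_iff₀ (by positivity)]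
  have : (P + E*P') * y^(d+3) * y ≤ ((C1 * (M0 + 1) + 2 ^ (d + 4) * C2 * 2) * (X + w)) * y := by
    rw [pow_succ] at e1 e2
    nlinarith
  exact le_of_mul_le_mul_right this hy0

end

def AA {d : ℕ} (a : ℝ → Mtx d) (ε t s : ℝ) : Mtx d := Matrix.of fun i j => 4*rPi^2*(∫ τ in t..s, a τ i j) + if i = j then ε else 0

def kap {d : ℕ} (a : ℝ → Mtx d) (ε η : ℝ) (I : Fin 2 → Fin d) (t s : ℝ) (x : Spc d) : ℝ := if t < s then eX (-(η*(s-t+ε))) * (kf I (AA a ε t s) x).re else 0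

def sg (δ : ℝ) : ℝ := √(δ/40)

section
variable {d : ℕ}
lemma pi_le : 4*rPi^2 ≤ 40 := by nlinarith [Real.pi_lt_d2, pi_pos]
lemma one_le_pi : 1 ≤ 4*rPi^2 := by nlinarith [Real.pi_gt_three]
lemma inS_bd {δ : ℝ} (hδ : 0 < δ) {A : Mtx d} (h : inS d δ A) (i j : Fin d) : |A i j| ≤ δ⁻¹ := by
  have q : ∀ ξ : Fin d → ℝ, ∑ i, ∑ j, A i j * ξ i * ξ j = ξ ⬝ᵥ A.mulVec ξ := by
    intro ξ
    simp only [dotProduct, mulVec, mul_sum]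
    refine sum_congr rfl fun i _ => sum_congr rfl fun j _ => by ring
  have n : ∀ ξ : Fin d → ℝ, ∑ i, ξ i ^ 2 = ξ ⬝ᵥ ξ := by intro ξ; simp [dotProduct, sq]
  have h1 := h.2 (Pi.single i 1 + Pi.single j 1)
  have h2 := h.2 (Pi.single i 1 - Pi.single j 1)
  have hs : A j i = A i j := h.1.apply i j
  rw [q, n] at h1 h2
  simp only [add_dotProduct, sub_dotProduct, dotProduct_add, dotProduct_sub, Matrix.mulVec_add, Matrix.mulVec_sub, single_one_dotProduct, Matrix.mulVec_single_one, Matrix.col_apply, Pi.single_apply, Pi.add_apply, Pi.sub_apply] at h1 h2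
  have hi := inv_pos.2 hδ
  rw [abs_le]
  by_cases hij : i = j
  · subst hij
    simp at h1
    constructor <;> nlinarith
  · have hji : ¬ j = i := fun h => hij h.symm
    simp [hij, hji] at h1 h2
    constructor <;> nlinarith
lemma ent_meas {a : ℝ → Mtx d} (ha : Measurable a) (i j : Fin d) : Measurable fun t => a t i j := (measurable_pi_apply j).comp ((measurable_pi_apply i).comp ha)
lemma ent_ii {a : ℝ → Mtx d} (ha : Measurable a) {δ : ℝ} (hδ : 0 < δ) (h : ∀ t, inS d δ (a t)) (i j : Fin d) (t s : ℝ) : IntervalIntegrable (fun τ => a τ i j) volume t s := by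
  refine (intervalIntegrable_const (c := δ⁻¹) (μ := volume) (a := t) (b := s)).mono_fun (ent_meas ha i j).aestronglyMeasurable ?_
  refine evAll fun τ => ?_
  simp only [norm_eq_abs]
  rw [abs_of_pos (inv_pos.2 hδ)]
  exact inS_bd hδ (h τ) i j
lemma QQ_AA {a : ℝ → Mtx d} (ha : Measurable a) {δ : ℝ} (hδ : 0 < δ) (h : ∀ t, inS d δ (a t)) (ε t s : ℝ) (ξ : Spc d) :
   QQ (AA a ε t s) ξ = 4*rPi^2 * (∫ τ in t..s, QQ (a τ) ξ) + ε * ‖ξ‖^2 := by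
  have h1 : (∫ τ in t..s, QQ (a τ) ξ) = ∑ i, ∑ j, (∫ τ in t..s, a τ i j) * ξ i * ξ j := by
    unfold QQ
    rw [intervalIntegral.integral_finsetSum]
    · refine sum_congr rfl fun i _ => ?_
      rw [intervalIntegral.integral_finsetSum]
      · refine sum_congr rfl fun j _ => ?_
        rw [intervalIntegral.integral_mul_const, intervalIntegral.integral_mul_const]
      · exact fun j _ => ((ent_ii ha hδ h i j t s).mul_const _).mul_const _
    · intro i _
      have := IntervalIntegrable.sum (μ := volume) (a := t) (b := s) Finset.univ (f := fun j τ => a τ i j * ξ i * ξ j) fun j _ => ((ent_ii ha hδ h i j t s).mul_const _).mul_const _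
      have e : (∑ j, fun τ => a τ i j * ξ i * ξ j) = fun τ => ∑ j, a τ i j * ξ i * ξ j := by ext τ; simp
      rwa [e] at this
  rw [h1, EuclideanSpace.real_norm_sq_eq, QQ]
  simp only [AA, of_apply, add_mul, sum_add_distrib, mul_sum]
  congr 1
  · refine sum_congr rfl fun i _ => sum_congr rfl fun j _ => by ring
  · simp [sq, mul_assoc]
lemma QQa {a : Mtx d} {δ : ℝ} (h : inS d δ a) (ξ : Spc d) : δ * ‖ξ‖^2 ≤ QQ a ξ ∧ QQ a ξ ≤ δ⁻¹ * ‖ξ‖^2 := by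
  rw [EuclideanSpace.real_norm_sq_eq]
  exact h.2 ξ
lemma QQ_ii {a : ℝ → Mtx d} (ha : Measurable a) {δ : ℝ} (hδ : 0 < δ) (h : ∀ t, inS d δ (a t)) (ξ : Spc d) (t s : ℝ) : IntervalIntegrable (fun τ => QQ (a τ) ξ) volume t s := by
  have hm : Measurable fun τ => QQ (a τ) ξ := by
    unfold QQ
    refine Finset.measurable_fun_sum _ fun i _ => Finset.measurable_fun_sum _ fun j _ => ((ent_meas ha i j).mul_const _).mul_const _
  refine (intervalIntegrable_const (c := δ⁻¹ * ‖ξ‖^2) (μ := volume) (a := t) (b := s)).mono_fun hm.aestronglyMeasurable ?_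
  refine evAll fun τ => ?_
  have := QQa (h τ) ξ
  have h0 : 0 ≤ δ * ‖ξ‖^2 := by positivity
  simp only [norm_eq_abs]
  rw [abs_of_nonneg (h0.trans this.1), abs_of_nonneg (by positivity)]
  exact this.2
lemma SB_AA {a : ℝ → Mtx d} (ha : Measurable a) {δ : ℝ} (hδ : 0 < δ) (hδ1 : δ ≤ 1) (h : ∀ t, inS d δ (a t)) {ε t s : ℝ} (hε : 0 < ε) (hts : t ≤ s) :
   SB (sg δ) (√(s-t+ε)) (AA a ε t s) := by
  refine ⟨?_, fun ξ => ?_⟩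
  · ext i j
    simp only [AA, Matrix.transpose_apply, of_apply]
    have : ∀ τ, a τ j i = a τ i j := fun τ => (h τ).1.apply i j
    simp_rw [this, eq_comm]
  · rw [QQ_AA ha hδ h]
    have hX := sq_nonneg ‖ξ‖
    have l1 := intervalIntegral.integral_mono_on hts intervalIntegrable_const (QQ_ii ha hδ h ξ t s) fun τ _ => (QQa (h τ) ξ).1
    have l2 := intervalIntegral.integral_mono_on hts (QQ_ii ha hδ h ξ t s) intervalIntegrable_const fun τ _ => (QQa (h τ) ξ).2
    rw [intervalIntegral.integral_const, smul_eq_mul] at l1 l2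
    have hr : 0 ≤ s - t + ε := by linarith
    have hst : 0 ≤ s - t := by linarith
    have hp1 := pi_le
    have hp2 := one_le_pi
    rw [mul_pow, mul_pow, mul_pow, div_pow, sq_sqrt hr, sg, sq_sqrt (by positivity)]
    generalize ‖ξ‖^2 = X at *
    generalize 4*rPi^2 = P at *
    have hd1 : 1 ≤ δ⁻¹ := (one_le_inv₀ hδ).2 hδ1
    constructor
    · have : (s-t)*(δ*X) ≤ P * ∫ τ in t..s, QQ (a τ) ξ := by
        have : 0 ≤ (s-t)*(δ*X) := by positivity
        nlinarith
      have : δ/40*(s-t+ε)*X ≤ (s-t)*(δ*X) + ε * X := by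
        have e1 : 0 ≤ (s-t)*(δ*X) := by positivity
        have e2 : 0 ≤ ε*X := by positivity
        nlinarith
      linarith
    · have : (s-t+ε)/(δ/40) = 40*δ⁻¹*(s-t+ε) := by field_simp
      rw [this]
      have : P * ∫ τ in t..s, QQ (a τ) ξ ≤ 40 * ((s-t)*(δ⁻¹*X)) := by
        have : 0 ≤ (s-t)*(δ⁻¹*X) := by positivity
        nlinarith
      have e2 : 0 ≤ ε*X := by positivity
      nlinarith
lemma AA_diff {a : ℝ → Mtx d} (ha : Measurable a) {δ : ℝ} (hδ : 0 < δ) (h : ∀ t, inS d δ (a t)) (ε t s t' s' : ℝ) (k l : Fin d) :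
    |(AA a ε t' s' - AA a ε t s) k l| ≤ 40*δ⁻¹*(|s-s'|+|t-t'|) := by
  have e : (AA a ε t' s' - AA a ε t s) k l = 4*rPi^2*((∫ τ in s..s', a τ k l) + ∫ τ in t'..t, a τ k l) := by
    have := intervalIntegral.integral_add_adjacent_intervals (ent_ii ha hδ h k l t' t) (ent_ii ha hδ h k l t s')
    have := intervalIntegral.integral_add_adjacent_intervals (ent_ii ha hδ h k l t s) (ent_ii ha hδ h k l s s')
    simp only [AA, Matrix.sub_apply, of_apply]
    linear_combination (-(4*rPi^2)) * (intervalIntegral.integral_add_adjacent_intervals (ent_ii ha hδ h k l t' t) (ent_ii ha hδ h k l t s')) + (-(4*rPi^2)) *  this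
  have b : ∀ u v : ℝ, |∫ τ in u..v, a τ k l| ≤ δ⁻¹ * |v-u| := fun u v => by
    rw [← norm_eq_abs]
    exact intervalIntegral.norm_integral_le_of_norm_le_const fun τ _ => inS_bd hδ (h τ) k l
  rw [e, abs_mul, abs_of_nonneg (by positivity : 0 ≤ 4*rPi^2), mul_assoc (40:ℝ)]
  refine mul_le_mul pi_le ?_ (abs_nonneg _) (by norm_num)
  refine (abs_add_le _ _).trans ?_
  rw [mul_add, abs_sub_comm s s']
  exact add_le_add (b _ _) (b _ _)
lemma AA_cont {a : ℝ → Mtx d} (ha : Measurable a) {δ : ℝ} (hδ : 0 < δ) (h : ∀ t, inS d δ (a t)) (ε : ℝ) (k l : Fin d) :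
    Continuous fun z : ℝ × ℝ => AA a ε z.1 z.2 k l := by
  have hF := intervalIntegral.continuous_primitive (fun u v => ent_ii ha hδ h k l u v) 0
  have : (fun z : ℝ × ℝ => AA a ε z.1 z.2 k l) = fun z : ℝ × ℝ => 4*rPi^2*((∫ τ in (0:ℝ)..z.2, a τ k l) - (∫ τ in (0:ℝ)..z.1, a τ k l)) + if k = l then ε else 0 := by
    ext z
    rw [intervalIntegral.integral_interval_sub_left (ent_ii ha hδ h k l _ _) (ent_ii ha hδ h k l _ _)]; rfl
  rw [this]
  have a1 := hF.comp (continuous_fst (X := ℝ) (Y := ℝ))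
  have a2 := hF.comp (continuous_snd (X := ℝ) (Y := ℝ))
  exact ((a2.sub a1).const_mul _).add continuous_const
lemma QAA_cont {a : ℝ → Mtx d} (ha : Measurable a) {δ : ℝ} (hδ : 0 < δ) (h : ∀ t, inS d δ (a t)) (ε : ℝ) :
    Continuous fun z : (ℝ × ℝ) × Spc d => QQ (AA a ε z.1.1 z.1.2) z.2 := by
  unfold QQ
  refine continuous_finsetSum _ fun i _ => continuous_finsetSum _ fun j _ => ?_
  have := (AA_cont ha hδ h ε i j).comp (continuous_fst (X := ℝ × ℝ) (Y := Spc d))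
  exact (this.mul (by fun_prop)).mul (by fun_prop)
lemma kap_meas {a : ℝ → Mtx d} (ha : Measurable a) {δ : ℝ} (hδ : 0 < δ) (h : ∀ t, inS d δ (a t)) (ε η : ℝ) (I : Fin 2 → Fin d) :
    Measurable fun z : ℝ × ℝ × Spc d => kap a ε η I z.1 z.2.1 z.2.2 := by
  unfold kap
  refine Measurable.ite (measurableSet_lt measurable_fst (measurable_fst.comp measurable_snd)) ?_ measurable_const
  refine Measurable.mul (by fun_prop) (Complex.measurable_re.comp ?_)
  have : StronglyMeasurable fun w : (ℝ × ℝ × Spc d) × Spc d => ki I (AA a ε w.1.1 w.1.2.1) w.1.2.2 w.2 := by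
    refine Continuous.stronglyMeasurable ?_
    have a1 := mon_cont I
    have a2 := (QAA_cont ha hδ h ε).comp (by fun_prop : Continuous fun w : (ℝ × ℝ × Spc d) × Spc d => (((w.1.1, w.1.2.1), w.2) : (ℝ × ℝ) × Spc d))
    simp only [comp_def] at a2
    unfold ki ee
    fun_prop
  exact this.integral_prod_right.measurable
end

section
variable {d : ℕ}
lemma sg_pos {δ : ℝ} (hδ : 0 < δ) : 0 < sg δ := sqrt_pos.2 (by positivity)
lemma sg_le {δ : ℝ} (hδ1 : δ ≤ 1) : sg δ ≤ 1 := by unfold sg; rw [Real.sqrt_le_one]; linarith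
lemma rp (y : ℝ) (hy : 0 ≤ y) (k : ℕ) : y^(-((d:ℝ)+k)) = (y^(d+k))⁻¹ := by rw [Real.rpow_neg hy, ← Nat.cast_add, rpow_natCast]
lemma exp_abs_int {η : ℝ} (hη : 0 < η) : ∫⁻ s : ℝ, eR (eX (-(η*|s|))) ≠ ∞ := by
  have h : Integrable fun s : ℝ => eX (-(η*|s|)) := by
    have h0 : Integrable fun s : ℝ => (1+‖s‖)^(-(2:ℝ)) := integrable_one_add_norm (by simp)
    refine (h0.const_mul (2 * (1+η⁻¹)^2 * eX 1)).mono' (by fun_prop) (evAll fun s => ?_)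
    rw [norm_of_nonneg (exp_nonneg _), norm_eq_abs, Real.rpow_neg (by positivity), ← div_eq_mul_inv, le_div_iff₀ (by positivity), Real.rpow_two]
    have a := abs_nonneg s
    have h1 := pow_div_factorial_le_exp (1+η*|s|) (by positivity) 2
    have h2 : eX (1+η*|s|) * eX (-(η*|s|)) = eX 1 := by rw [← Real.exp_add]; ring_nf
    have h3 : 1+|s| ≤ (1+η⁻¹)*(1+η*|s|) := by
      have : η⁻¹*η = 1 := inv_mul_cancel₀ hη.ne'
      have e : (1+η⁻¹)*(1+η*|s|) = 1 + η⁻¹ + η*|s| + (η⁻¹*η)*|s| := by ring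
      rw [e, this]
      have : 0 ≤ η⁻¹ + η*|s| := by positivity
      linarith
    norm_num at h1
    calc _ ≤ eX (-(η*|s|)) * ((1+η⁻¹)*(1+η*|s|))^2 := by gcongr
      _ = (1+η⁻¹)^2 * eX (-(η*|s|)) * (1+η*|s|)^2 := by ring
      _ ≤ (1+η⁻¹)^2 * eX (-(η*|s|)) * (2 * eX (1+η*|s|)) := by gcongr; linarith
      _ = 2 * (1+η⁻¹)^2 * (eX (1+η*|s|) * eX (-(η*|s|))) := by ring
      _ = _ := by rw [h2]
  exact (h.lintegral_lt_top).ne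
lemma dec_int {ρ : ℝ} (hρ : 0 < ρ) : ∫⁻ x : Spc d, eR (((ρ+‖x‖)^(d+2))⁻¹) ≠ ∞ := by
  have h0 : Integrable fun x : Spc d => (1+‖x‖)^(-((d:ℝ)+(2:ℕ))) := integrable_one_add_norm (by simp)
  have h : Integrable fun x : Spc d => ((ρ+‖x‖)^(d+2))⁻¹ := by
    refine (h0.const_mul ((1+ρ⁻¹)^(d+2))).mono' (Continuous.aestronglyMeasurable ?_) (evAll fun x => ?_)
    · refine Continuous.inv₀ (by fun_prop) fun x => by positivity
    · rw [rp _ (by positivity), norm_of_nonneg (by positivity), ← div_eq_mul_inv, le_div_iff₀ (by positivity), inv_mul_le_iff₀ (by positivity), ← mul_pow]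
      gcongr
      have : ρ⁻¹*ρ = 1 := inv_mul_cancel₀ hρ.ne'
      have h2 : 0 ≤ ρ⁻¹*‖x‖ := by positivity
      nlinarith [norm_nonneg x]
  exact (h.lintegral_lt_top).ne
lemma kap_g3 {a : ℝ → Mtx d} {ε η C : ℝ} (hη : 0 < η) (hε : 0 < ε) (hC : 0 ≤ C) (I : Fin 2 → Fin d)
   (hk : ∀ t s x, t < s → (√(s-t+ε)+‖x‖)^(d+2) * ‖kf I (AA a ε t s) x‖ ≤ C) :
   ∃ C3 : EE, C3 ≠ ∞ ∧ (∀ t, ∫⁻ s, ∫⁻ x, ‖kap a ε η I t s x‖ₑ ≤ C3) ∧ (∀ s, ∫⁻ t, ∫⁻ x, ‖kap a ε η I t s x‖ₑ ≤ C3) := by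
  have hρ : 0 < √ε := sqrt_pos.2 hε
  have b : ∀ t s x, ‖kap a ε η I t s x‖ₑ ≤ eR (eX (-(η*|t-s|))) * (eR C * eR (((√ε+‖x‖)^(d+2))⁻¹)) := by
    intro t s x
    rw [← ENNReal.ofReal_mul hC, ← ENNReal.ofReal_mul (exp_nonneg _)]
    refine enorm_le_of_abs ?_
    unfold kap
    split_ifs with h
    · rw [abs_mul, abs_of_pos (exp_pos _)]
      refine mul_le_mul ?_ ?_ (abs_nonneg _) (exp_nonneg _)
      · refine exp_le_exp.2 ?_
        rw [abs_of_neg (by linarith)]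
        nlinarith
      · refine (abs_re_le_norm _).trans ?_
        rw [← div_eq_mul_inv, le_div_iff₀ (by positivity), mul_comm]
        refine le_trans ?_ (hk t s x h)
        gcongr
        linarith
    · rw [abs_zero]; positivity
  have bx : ∀ t s, ∫⁻ x, ‖kap a ε η I t s x‖ₑ ≤ eR (eX (-(η*|t-s|))) * (eR C * ∫⁻ x : Spc d, eR (((√ε+‖x‖)^(d+2))⁻¹)) := by
    intro t s
    refine (lintegral_mono (b t s)).trans ?_
    rw [lintegral_const_mul' _ _ ofReal_ne_top, lintegral_const_mul' _ _ ofReal_ne_top]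
  have hf : (eR C * ∫⁻ x : Spc d, eR (((√ε+‖x‖)^(d+2))⁻¹)) ≠ ∞ := mul_ne_top ofReal_ne_top (dec_int hρ)
  refine ⟨(∫⁻ s : ℝ, eR (eX (-(η*|s|)))) * (eR C * ∫⁻ x : Spc d, eR (((√ε+‖x‖)^(d+2))⁻¹)), mul_ne_top (exp_abs_int hη) hf, fun t => ?_, fun s => ?_⟩
  · refine (lintegral_mono (bx t)).trans ?_
    rw [lintegral_mul_const' _ _ hf, lintegral_sub_left_eq_self (fun s : ℝ => eR (eX (-(η*|s|)))) t]
  · refine (lintegral_mono fun t => bx t s).trans ?_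
    rw [lintegral_mul_const' _ _ hf, lintegral_sub_right_eq_self (fun s : ℝ => eR (eX (-(η*|s|)))) s]
theorem kap_ker {δ : ℝ} (hδ : 0 < δ) (hδ1 : δ ≤ 1) (I : Fin 2 → Fin d) : ∃ C : ℝ, ∀ a : ℝ → Mtx d, Measurable a → (∀ t, inS d δ (a t)) →
   ∀ ε η, 0 < ε → 0 < η → Ker d C (kap a ε η I) := by
  obtain ⟨C1, hC1, h1⟩ := kf_bound 0 I (sg_pos hδ) (sg_le hδ1)
  obtain ⟨C2, hC2, h2⟩ := kap_core I (sg_pos hδ) (sg_le hδ1) (by positivity : 0 ≤ 40*δ⁻¹)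
  refine ⟨C1 + C2, fun a ha h ε η hε hη => ?_⟩
  have hk : ∀ t s x, t < s → (√(s-t+ε)+‖x‖)^(d+2) * ‖kf I (AA a ε t s) x‖ ≤ C1 := by
    intro t s x hts
    have := h1 (√(s-t+ε)) (sqrt_pos.2 (by linarith)) _ (SB_AA ha hδ hδ1 h hε hts.le) x
    simpa using this
  have hle : ∀ t s : ℝ, t < s → √|t-s| ≤ √(s-t+ε) := fun t s hts => sqrt_le_sqrt (by rw [abs_of_neg (by linarith)]; linarith)
  have main : ∀ t s t' s' : ℝ, ∀ x x' : Spc d, t < s → t' < s' → |s-s'|+|t-t'| ≤ |t-s|/2 → (s = s' ∨ t = t') → ‖x-x'‖≤(√|t-s|+‖x‖)/2 → |kap a ε η I t s x - kap a ε η I t' s' x'| ≤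
     (C1+C2)*(‖x-x'‖+√(|s-s'|+|t-t'|))*(√|t-s|+‖x‖)^(-((d:ℝ)+(3:ℕ))) := by
    intro t s t' s' x x' hts hts' hss hor hx
    have hrr : |s-t+ε-(s'-t'+ε)| = |s-s'|+|t-t'| := by
      rcases hor with rfl | rfl
      · rw [sub_self, abs_zero, zero_add, abs_sub_comm t t']; congr 1; ring
      · rw [sub_self, abs_zero, add_zero]; congr 1; ring
    have := h2 (s-t+ε) (s'-t'+ε) η (by linarith) hη ?_ _ _ (SB_AA ha hδ hδ1 h hε hts.le) (SB_AA ha hδ hδ1 h hε hts'.le) (fun k l => by rw [hrr]; exact AA_diff ha hδ h ε t s t' s' k l) x x' (hx.trans (by linarith [hle t s hts]))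
    · unfold kap
      rw [if_pos hts, if_pos hts', rp _ (by positivity)]
      refine this.trans ?_
      rw [hrr]
      have hpos : 0 < √|t-s| := sqrt_pos.2 (abs_pos.2 (by linarith))
      have := hle t s hts
      gcongr
      linarith
    · rw [hrr]
      refine hss.trans ?_
      rw [abs_of_neg (by linarith)]; linarith
  have zero : ∀ t s x, ¬ t < s → kap a ε η I t s x = 0 := fun t s x hh => if_neg hh
  have triv : ∀ (w y : ℝ) (x x' : Spc d) (k : ℝ), 0 ≤ y → 0 ≤ (C1+C2)*(‖x-x'‖+√w)*y^k := by intros; positivity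
  refine ⟨kap_meas ha hδ h ε η I, fun t s x => ?_, fun t s s' x x' hs hx => ?_, fun t s t' x x' hs hx => ?_, kap_g3 hη hε hC1 I hk⟩
  · have := rp (d := d) (√|t-s|+‖x‖) (by positivity) 2
    push_cast at this
    rw [this]
    by_cases hts : t < s
    · rw [kap, if_pos hts, abs_mul, abs_of_pos (exp_pos _)]
      refine (mul_le_of_le_one_left (abs_nonneg _) (exp_le_one_iff.2 (by nlinarith))).trans ((abs_re_le_norm _).trans ?_)
      have hpos : 0 < √|t-s| := sqrt_pos.2 (abs_pos.2 (by linarith))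
      rw [← div_eq_mul_inv, le_div_iff₀ (by positivity), mul_comm]
      refine le_trans ?_ ((hk t s x hts).trans (by linarith))
      have := hle t s hts
      gcongr
    · rw [zero _ _ _ hts, abs_zero]; positivity
  · by_cases hts : t < s
    · have : t < s' := by
        rw [abs_of_neg (by linarith : t - s < 0)] at hs
        have := abs_le.1 hs
        linarith
      have := main t s t s' x x' hts this (by simpa using hs) (Or.inr rfl) hx
      push_cast at this
      simpa using this
    · have : ¬ t < s' := by
        push Not at hts ⊢
        rw [abs_of_nonneg (by linarith : 0 ≤ t - s)] at hs
        have := abs_le.1 hs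
        linarith
      rw [zero _ _ _ hts, zero _ _ _ this, sub_self, abs_zero]
      exact triv _ _ _ _ _ (by positivity)
  · by_cases hts : t < s
    · have : t' < s := by
        rw [abs_of_neg (by linarith : t - s < 0)] at hs
        have := abs_le.1 hs
        linarith
      have := main t s t' s x x' hts this (by simpa using hs) (Or.inl rfl) hx
      push_cast at this
      simpa using this
    · have : ¬ t' < s := by
        push Not at hts ⊢
        rw [abs_of_nonneg (by linarith : 0 ≤ t - s)] at hs
        have := abs_le.1 hs
        linarith
      rw [zero _ _ _ hts, zero _ _ _ this, sub_self, abs_zero]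
      exact triv _ _ _ _ _ (by positivity)
end

section
variable {d : ℕ}
lemma ee_conj (x ξ : Spc d) : (starRingEnd ℂ) (ee x ξ) = ee (-x) ξ := by
  unfold ee
  rw [← Complex.exp_conj]
  congr 1
  rw [map_mul, Complex.conj_ofReal, Complex.conj_I, inner_neg_right]
  push_cast; ring
lemma ee_symm (x ξ : Spc d) : ee x ξ = ee ξ x := by unfold ee; rw [real_inner_comm]
lemma ee_add (x y ξ : Spc d) : ee (x+y) ξ = ee x ξ * ee y ξ := by unfold ee; rw [← Complex.exp_add, inner_add_right]; congr 1; push_cast; ring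
lemma ee_sub (x y ξ : Spc d) : ee (x-y) ξ = ee x ξ * ee (-y) ξ := by rw [sub_eq_add_neg, ee_add]
lemma ee_neg (x ξ : Spc d) : ee (-x) ξ = ee x (-ξ) := by unfold ee; rw [inner_neg_left, inner_neg_right]
lemma ee_cont2 : Continuous fun z : Spc d × Spc d => ee z.1 z.2 := by unfold ee; fun_prop

def GG (ε : ℝ) (w : Spc d) : ℝ := (rPi/ε)^((d:ℝ)/2) * eX (-(rPi^2/ε)*‖w‖^2)
lemma GG_eq {ε : ℝ} (hε : 0 < ε) (w : Spc d) : ∫ x : Spc d, ((eX (-ε*‖x‖^2) : ℝ):ℂ) * ee x w = ((GG ε w : ℝ):ℂ) := by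
  have := GaussianFourier.integral_cexp_neg_mul_sq_norm_add (b := (ε:ℂ)) (by simpa using hε) (2*rPi*Complex.I) w
  rw [finrank_euclideanSpace_fin] at this
  convert this using 1
  · congr 1; ext x
    unfold ee
    rw [ofReal_exp, ← Complex.exp_add]
    congr 1; push_cast; ring
  · unfold GG
    push_cast
    congr 1
    · rw [Complex.ofReal_cpow (by positivity)]; push_cast; rfl
    · congr 1
      have : (ε:ℂ) ≠ 0 := by exact_mod_cast hε.ne'
      field_simp
      ring_nf
      simp
lemma GG_int {ε : ℝ} (hε : 0 < ε) : ∫⁻ w : Spc d, eR (GG ε w) = 1 := by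
  have hb : 0 < rPi^2/ε := by positivity
  have h := GaussianFourier.integral_rexp_neg_mul_sq_norm (V := Spc d) hb
  rw [finrank_euclideanSpace_fin] at h
  have hpos : 0 < (rPi/(rPi^2/ε))^((d:ℝ)/2) := by positivity
  have hi : Integrable fun w : Spc d => eX (-(rPi^2/ε)*‖w‖^2) := by
    by_contra hc
    rw [integral_undef hc] at h
    exact hpos.ne h
  unfold GG
  rw [← ofReal_integral_eq_lintegral_ofReal (hi.const_mul _) (evAll fun w => by positivity), integral_const_mul, h, ← mul_rpow (by positivity) (by positivity)]
  have : rPi/ε * (rPi/(rPi^2/ε)) = 1 := by field_simp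
  rw [this]; simp
lemma GG_nonneg {ε : ℝ} (hε : 0 < ε) (w : Spc d) : 0 ≤ GG ε w := by unfold GG; positivity
lemma GG_cont (ε : ℝ) : Continuous (GG (d := d) ε) := by unfold GG; fun_prop

def FF (g : Spc d → ℂ) (x : Spc d) : ℂ := ∫ ξ, g ξ * ee x ξ
lemma gexp_int {ε : ℝ} (hε : 0 < ε) : Integrable fun x : Spc d => eX (-ε*‖x‖^2) := by
  have := gint (d := d) 0 (sqrt_pos.2 hε)
  refine this.congr (evAll fun x => ?_)
  simp only [pow_zero, one_mul, mul_pow, sq_sqrt hε.le]; ring_nf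
lemma planch1 {g : Spc d → ℂ} (hg : Integrable g) {ε : ℝ} (hε : 0 < ε) :
   (Integrable fun x => eX (-ε*‖x‖^2) * normSq (FF g x)) ∧ (((∫ x, eX (-ε*‖x‖^2) * normSq (FF g x) : ℝ)):ℂ) = ∫ p : Spc d × Spc d, g p.1 * (starRingEnd ℂ) (g p.2) * ((GG ε (p.1-p.2):ℝ):ℂ) := by
  let F : Spc d → Spc d × Spc d → ℂ := fun x p => ((eX (-ε*‖x‖^2) : ℝ):ℂ) * ((g p.1 * ee x p.1) * (starRingEnd ℂ) (g p.2 * ee x p.2))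
  have hF : Integrable (uncurry F) ((volume : Measure (Spc d)).prod ((volume : Measure (Spc d)).prod (volume : Measure (Spc d)))) := by
    have h1 : Integrable (fun z : Spc d × Spc d × Spc d => ((eX (-ε*‖z.1‖^2) : ℝ):ℂ) * (g z.2.1 * (starRingEnd ℂ) (g z.2.2))) ((volume : Measure (Spc d)).prod ((volume : Measure (Spc d)).prod (volume : Measure (Spc d)))) := by
      have hc : Integrable fun p => (starRingEnd ℂ) (g p) := Complex.conjCLE.toContinuousLinearMap.integrable_comp hg
      exact (gexp_int hε).ofReal.mul_prod (hg.mul_prod hc)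
    have h2 : Continuous fun z : Spc d × Spc d × Spc d => ee z.1 z.2.1 * ee (-z.1) z.2.2 := by unfold ee; fun_prop
    refine (h1.mul_bdd (c := 1) (f := fun z : Spc d × Spc d × Spc d => ((eX (-ε*‖z.1‖^2) : ℝ):ℂ) * (g z.2.1 * (starRingEnd ℂ) (g z.2.2))) h2.aestronglyMeasurable (evAll fun z => ?_)).congr (evAll fun z => ?_)
    · rw [norm_mul, norm_ee, norm_ee, one_mul]
    · simp only [uncurry, F, map_mul, ee_conj]; ring
  have e1 : ∀ x, ∫ p, F x p ∂(volume.prod volume) = ((eX (-ε*‖x‖^2) * normSq (FF g x) : ℝ):ℂ) := by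
    intro x
    simp only [F]
    rw [integral_const_mul, integral_prod_mul (fun ξ => g ξ * ee x ξ) (fun ξ => (starRingEnd ℂ) (g ξ * ee x ξ)), integral_conj]
    rw [← FF, Complex.mul_conj]; push_cast; rfl
  refine ⟨?_, ?_⟩
  · have := hF.integral_prod_left
    simp only [uncurry] at this
    simp_rw [e1] at this
    exact this.re
  · rw [← integral_complex_ofReal]
    simp_rw [← e1]
    rw [integral_integral_swap hF]
    refine integral_congr_ae (evAll fun p => ?_)
    simp only [F]
    rw [← GG_eq hε, ← integral_const_mul]
    congr 1; ext x
    simp only [map_mul, ee_conj]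
    rw [ee_symm x (p.1-p.2), ee_sub, ee_symm p.1, ee_symm (-p.2), ← ee_neg x]
    ring
lemma planch2 {g : Spc d → ℂ} (hg : Integrable g) {ε : ℝ} (hε : 0 < ε) :
   ∫⁻ x, eR (eX (-ε*‖x‖^2)) * ‖FF g x‖ₑ^2 ≤ ∫⁻ ξ, ‖g ξ‖ₑ^2 := by
  obtain ⟨h1, h2⟩ := planch1 hg hε
  have e1 : ∫⁻ x, eR (eX (-ε*‖x‖^2)) * ‖FF g x‖ₑ^2 = eR (∫ x, eX (-ε*‖x‖^2) * normSq (FF g x)) := by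
    rw [ofReal_integral_eq_lintegral_ofReal h1 (evAll fun x => mul_nonneg (exp_nonneg _) (Complex.normSq_nonneg _))]
    refine lintegral_congr fun x => ?_
    rw [ENNReal.ofReal_mul (exp_nonneg _), Complex.normSq_eq_norm_sq, ENNReal.ofReal_pow (norm_nonneg _), ofReal_norm]
  have e2 : eR (∫ x, eX (-ε*‖x‖^2) * normSq (FF g x)) ≤ ∫⁻ p : Spc d × Spc d, ‖g p.1‖ₑ * ‖g p.2‖ₑ * eR (GG ε (p.1-p.2)) := by
    have : eR (∫ x, eX (-ε*‖x‖^2) * normSq (FF g x)) ≤ ‖(((∫ x, eX (-ε*‖x‖^2) * normSq (FF g x) : ℝ)):ℂ)‖ₑ := by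
      rw [← ofReal_norm, norm_real]
      exact ofReal_le_ofReal (le_abs_self _)
    refine this.trans ?_
    rw [h2]
    refine (enorm_integral_le_lintegral_enorm _).trans (le_of_eq ?_)
    refine lintegral_congr fun p => ?_
    rw [enorm_mul, enorm_mul]
    congr 1
    · congr 1
      rw [← ofReal_norm, RCLike.norm_conj, ofReal_norm]
    · rw [← ofReal_norm, norm_real, norm_of_nonneg (GG_nonneg hε _)]
  rw [e1]
  refine e2.trans ?_
  have hgm : AEMeasurable (fun ξ => ‖g ξ‖ₑ^2) volume := hg.1.enorm.pow_const 2
  have hGm : Measurable fun p : Spc d × Spc d => eR (GG ε (p.1-p.2)) := (((GG_cont ε).comp (by fun_prop : Continuous fun p : Spc d × Spc d => p.1-p.2)).measurable).ennreal_ofReal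
  have s1 : ∫⁻ p : Spc d × Spc d, ‖g p.1‖ₑ^2 * eR (GG ε (p.1-p.2)) = ∫⁻ ξ, ‖g ξ‖ₑ^2 := by
    rw [Measure.volume_eq_prod, lintegral_prod (fun p : Spc d × Spc d => ‖g p.1‖ₑ^2 * eR (GG ε (p.1-p.2))) (((hgm.comp_fst).mul hGm.aemeasurable))]
    refine lintegral_congr fun ξ => ?_
    simp only
    rw [lintegral_const_mul' _ _ (by simp), lintegral_sub_left_eq_self (fun y => eR (GG ε y)), GG_int hε, mul_one]
  have s2 : ∫⁻ p : Spc d × Spc d, ‖g p.2‖ₑ^2 * eR (GG ε (p.1-p.2)) = ∫⁻ ξ, ‖g ξ‖ₑ^2 := by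
    rw [Measure.volume_eq_prod, lintegral_prod_symm (fun p : Spc d × Spc d => ‖g p.2‖ₑ^2 * eR (GG ε (p.1-p.2))) (((hgm.comp_snd).mul hGm.aemeasurable))]
    refine lintegral_congr fun ξ => ?_
    simp only
    rw [lintegral_const_mul' _ _ (by simp), lintegral_sub_right_eq_self (fun y => eR (GG ε y)), GG_int hε, mul_one]
  have h2 : 2 * ∫⁻ p : Spc d × Spc d, ‖g p.1‖ₑ * ‖g p.2‖ₑ * eR (GG ε (p.1-p.2)) ≤ 2 * ∫⁻ ξ, ‖g ξ‖ₑ^2 := by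
    calc _ = ∫⁻ p : Spc d × Spc d, 2 * (‖g p.1‖ₑ * ‖g p.2‖ₑ * eR (GG ε (p.1-p.2))) := (lintegral_const_mul' _ _ (by simp)).symm
      _ ≤ ∫⁻ p : Spc d × Spc d, (‖g p.1‖ₑ^2 * eR (GG ε (p.1-p.2)) + ‖g p.2‖ₑ^2 * eR (GG ε (p.1-p.2))) := by
        refine lintegral_mono fun p => ?_
        rw [← add_mul, ← mul_assoc]
        refine mul_le_mul_left ?_ _
        rw [← ofReal_norm, ← ofReal_norm, ← ENNReal.ofReal_mul (norm_nonneg _), ← ENNReal.ofReal_pow (norm_nonneg _), ← ENNReal.ofReal_pow (norm_nonneg _), ← ofReal_add (by positivity) (by positivity),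
          show (2:EE) = eR 2 by simp, ← ENNReal.ofReal_mul (by norm_num)]
        exact ofReal_le_ofReal (by nlinarith [sq_nonneg (‖g p.1‖ - ‖g p.2‖)])
      _ = _ := by rw [lintegral_add_left' (f := fun p : Spc d × Spc d => ‖g p.1‖ₑ^2 * eR (GG ε (p.1-p.2))) ((hgm.comp_fst).mul hGm.aemeasurable), s1, s2, two_mul]
  exact (ENNReal.mul_le_mul_iff_right (by simp) (by simp)).1 h2
lemma FF_cont {g : Spc d → ℂ} (hg : Integrable g) : Continuous (FF g) := by
  unfold FF
  refine continuous_of_dominated (bound := fun ξ => ‖g ξ‖) (fun x => hg.1.mul (ee_cont x).aestronglyMeasurable) (fun x => evAll fun ξ => by rw [norm_mul, norm_ee, mul_one]) hg.norm ?_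
  refine evAll fun ξ => ?_
  have := (ee_cont2 (d := d)).comp (by fun_prop : Continuous fun x : Spc d => (x, ξ))
  exact continuous_const.mul this
theorem planch (g : Spc d → ℂ) : ∫⁻ x, ‖FF g x‖ₑ^2 ≤ ∫⁻ ξ, ‖g ξ‖ₑ^2 := by
  by_cases hg : Integrable g
  · have hlim : ∀ x : Spc d, Filter.Tendsto (fun n : ℕ => eR (eX (-(1/((n:ℝ)+1))*‖x‖^2)) * ‖FF g x‖ₑ^2) atTop (nhds (‖FF g x‖ₑ^2)) := by
      intro x
      have h1 : Filter.Tendsto (fun n : ℕ => eX (-(1/((n:ℝ)+1))*‖x‖^2)) atTop (nhds (eX (-0*‖x‖^2))) := (continuous_exp.tendsto _).comp ((tendsto_one_div_add_atTop_nhds_zero_nat.neg).mul_const _)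
      have h2 := ENNReal.tendsto_ofReal h1
      have h3 := ENNReal.Tendsto.mul_const (b := ‖FF g x‖ₑ^2) h2 (Or.inr (by simp))
      simpa using h3
    calc _ = ∫⁻ x, liminf (fun n : ℕ => eR (eX (-(1/((n:ℝ)+1))*‖x‖^2)) * ‖FF g x‖ₑ^2) atTop := lintegral_congr fun x => (hlim x).liminf_eq.symm
      _ ≤ liminf (fun n : ℕ => ∫⁻ x, eR (eX (-(1/((n:ℝ)+1))*‖x‖^2)) * ‖FF g x‖ₑ^2) atTop := by
        refine lintegral_liminf_le fun n => ?_
        have := (FF_cont hg).measurable.enorm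
        fun_prop
      _ ≤ _ := by refine Filter.liminf_le_of_frequently_le' (Filter.Frequently.of_forall fun n => planch2 hg (by positivity))
  · have : ∀ x, FF g x = 0 := by
      intro x
      refine integral_undef fun hc => hg ?_
      have := hc.mul_bdd (c := 1) (f := fun ξ => g ξ * ee x ξ) (g := fun ξ => ee (-x) ξ) (ee_cont (-x)).aestronglyMeasurable (evAll fun ξ => (norm_ee _ _).le)
      refine this.congr (evAll fun ξ => ?_)
      simp only
      rw [mul_assoc, ← ee_add]; simp [ee]
    simp [this]
end

section
variable {d : ℕ}
lemma schur2 {k : ℝ → ℝ → EE} (hk : Measurable fun z : ℝ × ℝ => k z.1 z.2) {F : ℝ → EE} (hF : Measurable F) {K : EE} (hK : K ≠ 0)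
   (h1 : ∀ t, ∫⁻ s, k t s ≤ K) (h2 : ∀ s, ∫⁻ t, k t s ≤ K) : ∫⁻ t, (∫⁻ s, k t s * F s)^(2:ℝ) ≤ K^(2:ℝ) * ∫⁻ s, F s^(2:ℝ) := by
  by_cases hf : ∫⁻ s, F s^(2:ℝ) = ∞
  · rw [hf, mul_top (by simp [hK])]; exact le_top
  have := mschur (Sg := Unit) (m := Measure.dirac ()) (ν := (volume : Measure ℝ)) (q := 2) (by norm_num) (k := fun t _ s => k t s) (f := fun _ s => F s)
    (F := fun _ => (∫⁻ s, F s^(2:ℝ))^(1/(2:ℝ))) (H := fun _ => K) (hk.comp (by fun_prop : Measurable fun z : ℝ × Unit × ℝ => (z.1, z.2.2))) (hF.comp measurable_snd) measurable_const (fun _ => rfl)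
    (fun _ => rpow_ne_top_of_nonneg (by norm_num) hf) (fun _ t => h1 t) (fun _ s => h2 s)
  simp only [lintegral_dirac] at this
  refine this.trans (le_of_eq ?_)
  rw [mul_rpow_of_nonneg _ _ (by norm_num), ← ENNReal.rpow_mul]; norm_num

def tk (c b t s : ℝ) : EE := if t < s then eR (b * eX (-(c*b*(s-t)))) else 0
lemma tk_meas (c b : ℝ) : Measurable fun z : ℝ × ℝ => tk c b z.1 z.2 := by
  unfold tk
  refine Measurable.ite (measurableSet_lt measurable_fst measurable_snd) (by fun_prop) measurable_const
lemma tk_base {c b : ℝ} (hc : 0 < c) (hb : 0 ≤ b) : ∫⁻ v, tk c b 0 v ≤ eR c⁻¹ := by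
  have e : ∀ v, tk c b 0 v = (Ioi (0:ℝ)).indicator (fun v => eR (b * eX ((-(c*b))*v))) v := by intro v; unfold tk; simp only [indicator, mem_Ioi, sub_zero, neg_mul]
  simp_rw [e]
  rw [lintegral_indicator measurableSet_Ioi]
  rcases eq_or_lt_of_le hb with h | h
  · simp [← h]
  · have hn : -(c*b) < 0 := by have := mul_pos hc h; linarith
    have hi := integrableOn_exp_mul_Ioi hn 0
    rw [← ofReal_integral_eq_lintegral_ofReal (hi.const_mul b) (evAll fun v => by positivity), integral_const_mul, integral_exp_mul_Ioi hn]
    refine ofReal_le_ofReal (le_of_eq ?_)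
    simp; field_simp
lemma tk1 {c b : ℝ} (hc : 0 < c) (hb : 0 ≤ b) (t : ℝ) : ∫⁻ s, tk c b t s ≤ eR c⁻¹ := by
  have e : ∀ s, tk c b t s = tk c b 0 (s - t) := by intro s; simp [tk]
  simp_rw [e]
  rw [lintegral_sub_right_eq_self (fun v => tk c b 0 v)]
  exact tk_base hc hb
lemma tk2 {c b : ℝ} (hc : 0 < c) (hb : 0 ≤ b) (s : ℝ) : ∫⁻ t, tk c b t s ≤ eR c⁻¹ := by
  have e : ∀ t, tk c b t s = tk c b 0 (s - t) := by intro t; simp [tk]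
  simp_rw [e]
  rw [lintegral_sub_left_eq_self (fun v => tk c b 0 v)]
  exact tk_base hc hb

def Mk (a : ℝ → Mtx d) (ε η : ℝ) (I : Fin 2 → Fin d) (t s : ℝ) (ξ : Spc d) : ℝ := if t < s then eX (-(η*(s-t+ε))) * (mon I ξ * eX (-(QQ (AA a ε t s) ξ))) else 0
lemma Mk_meas {a : ℝ → Mtx d} (ha : Measurable a) {δ : ℝ} (hδ : 0 < δ) (h : ∀ t, inS d δ (a t)) (ε η : ℝ) (I : Fin 2 → Fin d) :
    Measurable fun z : ℝ × ℝ × Spc d => Mk a ε η I z.1 z.2.1 z.2.2 := by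
  unfold Mk
  refine Measurable.ite (measurableSet_lt measurable_fst (measurable_fst.comp measurable_snd)) ?_ measurable_const
  have a1 := mon_cont I
  have a2 := (QAA_cont ha hδ h ε).comp (by fun_prop : Continuous fun w : ℝ × ℝ × Spc d => (((w.1, w.2.1), w.2.2) : (ℝ × ℝ) × Spc d))
  simp only [comp_def] at a2
  refine Continuous.measurable ?_
  fun_prop
lemma Mk_bd {a : ℝ → Mtx d} (ha : Measurable a) {δ : ℝ} (hδ : 0 < δ) (hδ1 : δ ≤ 1) (h : ∀ t, inS d δ (a t)) {ε η : ℝ} (hε : 0 < ε) (hη : 0 < η) (I : Fin 2 → Fin d)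
   (t s : ℝ) (ξ : Spc d) (hts : t < s) : |Mk a ε η I t s ξ| ≤ ‖ξ‖^2 * eX (-(δ/40*(s-t+ε)*‖ξ‖^2)) := by
  rw [Mk, if_pos hts, abs_mul, abs_mul, abs_of_pos (exp_pos _), abs_of_pos (exp_pos _)]
  refine (mul_le_of_le_one_left (by positivity) (exp_le_one_iff.2 (by nlinarith))).trans ?_
  refine mul_le_mul (mon_le I ξ) (exp_le_exp.2 (neg_le_neg ?_)) (exp_nonneg _) (by positivity)
  have := ((SB_AA ha hδ hδ1 h hε hts.le).2 ξ).1
  rwa [mul_pow, mul_pow, sq_sqrt (by linarith), sg, sq_sqrt (by positivity)] at this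
lemma Mk_bd1 {a : ℝ → Mtx d} (ha : Measurable a) {δ : ℝ} (hδ : 0 < δ) (hδ1 : δ ≤ 1) (h : ∀ t, inS d δ (a t)) {ε η : ℝ} (hε : 0 < ε) (hη : 0 < η) (I : Fin 2 → Fin d)
   (t s : ℝ) (ξ : Spc d) : ‖Mk a ε η I t s ξ‖ₑ ≤ tk (δ/40) (‖ξ‖^2) t s := by
  by_cases hts : t < s
  · rw [tk, if_pos hts]
    refine enorm_le_of_abs ((Mk_bd ha hδ hδ1 h hε hη I t s ξ hts).trans ?_)
    have : 0 ≤ δ/40*ε*‖ξ‖^2 := by positivity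
    refine mul_le_mul_of_nonneg_left (exp_le_exp.2 ?_) (by positivity)
    nlinarith [this]
  · rw [tk, if_neg hts, Mk, if_neg hts]; simp
lemma Mk_bd2 {a : ℝ → Mtx d} (ha : Measurable a) {δ : ℝ} (hδ : 0 < δ) (hδ1 : δ ≤ 1) (h : ∀ t, inS d δ (a t)) {ε η : ℝ} (hε : 0 < ε) (hη : 0 < η) (I : Fin 2 → Fin d)
   (t s : ℝ) (ξ : Spc d) : |Mk a ε η I t s ξ| ≤ ‖ξ‖^2 * eX (-(√(δ/40*ε)*‖ξ‖)^2) := by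
  by_cases hts : t < s
  · refine (Mk_bd ha hδ hδ1 h hε hη I t s ξ hts).trans ?_
    rw [mul_pow, sq_sqrt (by positivity)]
    gcongr
    linarith
  · rw [Mk, if_neg hts, abs_zero]; positivity
lemma kap_Mk (a : ℝ → Mtx d) (ε η : ℝ) (I : Fin 2 → Fin d) (t s : ℝ) (x : Spc d) :
    kap a ε η I t s x = (∫ ξ, ((Mk a ε η I t s ξ : ℝ):ℂ) * ee x ξ).re := by
  unfold kap Mk
  split_ifs with h
  · rw [← re_ofReal_mul, kf, ← integral_const_mul]
    congr 2; ext ξ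
    push_cast; ring
  · simp
lemma int_supp {f : Spc d × ℝ → ℝ} (hf : Measurable f) (hR : ∃ R : ℝ, ∀ z, |f z| ≤ R) (hE : ∃ E : Set (Spc d × ℝ), MeasurableSet E ∧ volume E ≠ ∞ ∧ ∀ z ∉ E, f z = 0) : Integrable f := by
  obtain ⟨R, hR⟩ := hR
  obtain ⟨E, hE, hv, hz⟩ := hE
  have h1 : IntegrableOn f E := Measure.integrableOn_of_bounded hv hf.aestronglyMeasurable (M := R) (evAll fun z => hR z)
  exact (integrableOn_iff_integrable_of_support_subset (fun z hz' => by by_contra hc; exact hz' (hz z hc))).1 h1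

def fh (f : Spc d × ℝ → ℝ) (s : ℝ) (ξ : Spc d) : ℂ := FF (fun y => ((f (y,s):ℝ):ℂ)) (-ξ)

def hh (a : ℝ → Mtx d) (ε η : ℝ) (I : Fin 2 → Fin d) (f : Spc d × ℝ → ℝ) (t : ℝ) (ξ : Spc d) : ℂ := ∫ s, ((Mk a ε η I t s ξ : ℝ):ℂ) * fh f s ξ
lemma fh_meas {f : Spc d × ℝ → ℝ} (hf : Measurable f) : Measurable fun z : ℝ × Spc d => fh f z.1 z.2 := by
  refine StronglyMeasurable.measurable ?_
  unfold fh FF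
  refine StronglyMeasurable.integral_prod_right (f := fun (z : ℝ × Spc d) y => ((f (y,z.1):ℝ):ℂ) * ee (-z.2) y) ?_
  refine Measurable.stronglyMeasurable ?_
  have h1 : Measurable fun w : (ℝ × Spc d) × Spc d => f (w.2, w.1.1) := hf.comp (by fun_prop)
  have h2 : Continuous fun w : (ℝ × Spc d) × Spc d => ee (-w.1.2) w.2 := by unfold ee; fun_prop
  exact (Complex.measurable_ofReal.comp h1).mul h2.measurable
lemma hh_meas {a : ℝ → Mtx d} (ha : Measurable a) {δ : ℝ} (hδ : 0 < δ) (h : ∀ t, inS d δ (a t)) (ε η : ℝ) (I : Fin 2 → Fin d) {f : Spc d × ℝ → ℝ} (hf : Measurable f) : Measurable fun z : ℝ × Spc d => hh a ε η I f z.1 z.2 := by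
  refine StronglyMeasurable.measurable ?_
  unfold hh
  refine StronglyMeasurable.integral_prod_right (f := fun (z : ℝ × Spc d) s => ((Mk a ε η I z.1 s z.2:ℝ):ℂ) * fh f s z.2) ?_
  refine Measurable.stronglyMeasurable ?_
  have h1 : Measurable fun w : (ℝ × Spc d) × ℝ => Mk a ε η I w.1.1 w.2 w.1.2 := (Mk_meas ha hδ h ε η I).comp (by fun_prop : Measurable fun w : (ℝ × Spc d) × ℝ => (w.1.1, w.2, w.1.2))
  have h2 : Measurable fun w : (ℝ × Spc d) × ℝ => fh f w.2 w.1.2 := (fh_meas hf).comp (by fun_prop : Measurable fun w : (ℝ × Spc d) × ℝ => (w.2, w.1.2))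
  exact (Complex.measurable_ofReal.comp h1).mul h2
lemma rep {a : ℝ → Mtx d} (ha : Measurable a) {δ : ℝ} (hδ : 0 < δ) (hδ1 : δ ≤ 1) (h : ∀ t, inS d δ (a t)) {ε η : ℝ} (hε : 0 < ε) (hη : 0 < η) (I : Fin 2 → Fin d)
   {f : Spc d × ℝ → ℝ} (hf : Measurable f) (hfi : Integrable f) (x : Spc d) (t : ℝ) : Tk volume (KK (kap a ε η I)) f (x,t) = (FF (hh a ε η I f t) x).re := by
  let G : Spc d × ℝ → Spc d → ℂ := fun z' ξ => ((Mk a ε η I t z'.2 ξ : ℝ):ℂ) * ee (x-z'.1) ξ * ((f z':ℝ):ℂ)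
  have hc : 0 < √(δ/40*ε) := sqrt_pos.2 (by positivity)
  have hMm : Measurable fun w : (Spc d × ℝ) × Spc d => Mk a ε η I t w.1.2 w.2 := (Mk_meas ha hδ h ε η I).comp (by fun_prop : Measurable fun w : (Spc d × ℝ) × Spc d => (t, w.1.2, w.2))
  have hGm : Measurable (uncurry G) := by
    have h2 : Continuous fun w : (Spc d × ℝ) × Spc d => ee (x-w.1.1) w.2 := by unfold ee; fun_prop
    exact ((Complex.measurable_ofReal.comp hMm).mul h2.measurable).mul (Complex.measurable_ofReal.comp (hf.comp measurable_fst))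
  have hGi : Integrable (uncurry G) ((volume : Measure (Spc d × ℝ)).prod (volume : Measure (Spc d))) := by
    refine (hfi.norm.mul_prod (gint (d := d) 2 hc)).mono' hGm.aestronglyMeasurable (evAll fun w => ?_)
    simp only [uncurry, G]
    rw [norm_mul, norm_mul, norm_ee, mul_one, norm_real, norm_real, mul_comm]
    exact mul_le_mul_of_nonneg_left (Mk_bd2 ha hδ hδ1 h hε hη I _ _ _) (norm_nonneg _)
  have e1 : Tk volume (KK (kap a ε η I)) f (x,t) = ∫ z', (∫ ξ, G z' ξ).re := by
    unfold Tk KK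
    refine integral_congr_ae (evAll fun z' => ?_)
    simp only [G]
    rw [integral_mul_const, kap_Mk, mul_comm, ← re_ofReal_mul, mul_comm]
  have e2 : ∫ z', (∫ ξ, G z' ξ).re = (∫ z', ∫ ξ, G z' ξ).re := reCLM.integral_comp_comm hGi.integral_prod_left
  rw [e1, e2, integral_integral_swap hGi]
  congr 1
  unfold FF
  refine integral_congr_ae (evAll fun ξ => ?_)
  simp only [G]
  have hξ : Integrable (fun z' : Spc d × ℝ => ((Mk a ε η I t z'.2 ξ : ℝ):ℂ) * (((f z':ℝ):ℂ) * ee (-ξ) z'.1)) := by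
    refine (hfi.norm.mul_const (‖ξ‖^2 * eX (-(√(δ/40*ε)*‖ξ‖)^2))).mono' ?_ (evAll fun z' => ?_)
    · have h2 : Continuous fun w : (Spc d × ℝ) => ee (-ξ) w.1 := by unfold ee; fun_prop
      have h3 : Measurable fun w : (Spc d × ℝ) => Mk a ε η I t w.2 ξ := (Mk_meas ha hδ h ε η I).comp (by fun_prop : Measurable fun w : (Spc d × ℝ) => (t, w.2, ξ))
      exact ((Complex.measurable_ofReal.comp h3).mul ((Complex.measurable_ofReal.comp hf).mul h2.measurable)).aestronglyMeasurable
    · rw [norm_mul, norm_mul, norm_ee, mul_one, norm_real, norm_real, mul_comm]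
      exact mul_le_mul_of_nonneg_left (Mk_bd2 ha hδ hδ1 h hε hη I _ _ _) (norm_nonneg _)
  calc _ = ∫ z' : Spc d × ℝ, (((Mk a ε η I t z'.2 ξ : ℝ):ℂ) * (((f z':ℝ):ℂ) * ee (-ξ) z'.1)) * ee x ξ := by
        refine integral_congr_ae (evAll fun z' => ?_)
        simp only
        rw [ee_sub, ee_neg z'.1, ee_symm z'.1]; ring
    _ = (∫ z' : Spc d × ℝ, (((Mk a ε η I t z'.2 ξ : ℝ):ℂ) * (((f z':ℝ):ℂ) * ee (-ξ) z'.1))) * ee x ξ := integral_mul_const _ _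
    _ = _ := by
        congr 1
        rw [Measure.volume_eq_prod, integral_prod_symm (fun z' : Spc d × ℝ => (((Mk a ε η I t z'.2 ξ : ℝ):ℂ) * (((f z':ℝ):ℂ) * ee (-ξ) z'.1))) hξ]
        unfold hh
        refine integral_congr_ae (evAll fun s => ?_)
        simp only
        rw [integral_const_mul]; rfl
lemma hh_le {a : ℝ → Mtx d} (ha : Measurable a) {δ : ℝ} (hδ : 0 < δ) (hδ1 : δ ≤ 1) (h : ∀ t, inS d δ (a t)) {ε η : ℝ} (hε : 0 < ε) (hη : 0 < η) (I : Fin 2 → Fin d)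
   {f : Spc d × ℝ → ℝ} (hf : Measurable f) (ξ : Spc d) : ∫⁻ t, ‖hh a ε η I f t ξ‖ₑ^(2:ℝ) ≤ eR (δ/40)⁻¹ ^(2:ℝ) * ∫⁻ s, ‖fh f s ξ‖ₑ^(2:ℝ) := by
  have hc : 0 < δ/40 := by positivity
  have := schur2 (tk_meas (δ/40) (‖ξ‖^2)) (F := fun s => ‖fh f s ξ‖ₑ) ((fh_meas hf).comp (by fun_prop : Measurable fun s : ℝ => (s, ξ))).enorm (K := eR (δ/40)⁻¹) (by simpa using hδ) (tk1 hc (by positivity)) (tk2 hc (by positivity))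
  refine le_trans (lintegral_mono fun t => ?_) this
  refine rpow_le_rpow ?_ (by norm_num)
  refine (enorm_integral_le_lintegral_enorm _).trans (lintegral_mono fun s => ?_)
  rw [enorm_mul]
  refine mul_le_mul_left ?_ _
  refine le_trans (le_of_eq ?_) (Mk_bd1 ha hδ hδ1 h hε hη I t s ξ)
  rw [← ofReal_norm, norm_real, ofReal_norm]
theorem kap_LB {δ : ℝ} (hδ : 0 < δ) (hδ1 : δ ≤ 1) (I : Fin 2 → Fin d) {a : ℝ → Mtx d} (ha : Measurable a) (h : ∀ t, inS d δ (a t)) {ε η : ℝ} (hε : 0 < ε) (hη : 0 < η) :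
   LB (kap a ε η I) 2 (eR (δ/40)⁻¹ ^(2:ℝ)) := by
  intro f hf hR hE
  have hfi := int_supp hf hR hE
  have hfm : AEMeasurable (fun z : Spc d × ℝ => ‖f z‖ₑ^(2:ℝ)) (volume.prod volume) := (hf.enorm.pow_const _).aemeasurable
  have hKm : Measurable fun z : (Spc d × ℝ) × (Spc d × ℝ) => KK (kap a ε η I) z.1 z.2 := (kap_meas ha hδ h ε η I).comp (by fun_prop : Measurable fun z : (Spc d × ℝ) × (Spc d × ℝ) => (z.1.2, z.2.2, z.1.1 - z.2.1))
  have hTm : AEMeasurable (fun z : Spc d × ℝ => ‖Tk volume (KK (kap a ε η I)) f z‖ₑ^(2:ℝ)) (volume.prod volume) := ((meas_Tk hKm hf).enorm.pow_const _).aemeasurable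
  have hhm := hh_meas ha hδ h ε η I hf
  have hfh := fh_meas hf
  have hL : ∫⁻ z : Spc d × ℝ, ‖Tk volume (KK (kap a ε η I)) f z‖ₑ^(2:ℝ) = ∫⁻ t : ℝ, ∫⁻ x : Spc d, ‖Tk volume (KK (kap a ε η I)) f (x,t)‖ₑ^(2:ℝ) := lintegral_prod_symm (fun z : Spc d × ℝ => ‖Tk volume (KK (kap a ε η I)) f z‖ₑ^(2:ℝ)) hTm
  have hRR : ∫⁻ z : Spc d × ℝ, ‖f z‖ₑ^(2:ℝ) = ∫⁻ t : ℝ, ∫⁻ x : Spc d, ‖f (x,t)‖ₑ^(2:ℝ) := lintegral_prod_symm (fun z : Spc d × ℝ => ‖f z‖ₑ^(2:ℝ)) hfm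
  change ∫⁻ z : Spc d × ℝ, ‖Tk volume (KK (kap a ε η I)) f z‖ₑ^(2:ℝ) ≤ _ * ∫⁻ z : Spc d × ℝ, ‖f z‖ₑ^(2:ℝ)
  rw [hL, hRR]
  have s1 : ∀ t : ℝ, ∫⁻ x, ‖Tk volume (KK (kap a ε η I)) f (x,t)‖ₑ^(2:ℝ) ≤ ∫⁻ ξ, ‖hh a ε η I f t ξ‖ₑ^(2:ℝ) := by
    intro t
    have := planch (hh a ε η I f t)
    simp_rw [← ENNReal.rpow_two] at this
    refine le_trans (lintegral_mono fun x => rpow_le_rpow ?_ (by norm_num)) this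
    rw [rep ha hδ hδ1 h hε hη I hf hfi, ← ofReal_norm, ← ofReal_norm]
    exact ofReal_le_ofReal (abs_re_le_norm _)
  have s2 : ∀ s : ℝ, ∫⁻ ξ, ‖fh f s ξ‖ₑ^(2:ℝ) ≤ ∫⁻ y, ‖f (y,s)‖ₑ^(2:ℝ) := by
    intro s
    have := planch fun y => ((f (y,s):ℝ):ℂ)
    simp_rw [← ENNReal.rpow_two] at this
    unfold fh
    rw [lintegral_neg_eq_self (fun ξ => ‖FF (fun y => ((f (y,s):ℝ):ℂ)) ξ‖ₑ^(2:ℝ))]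
    refine this.trans (le_of_eq (lintegral_congr fun y => ?_))
    rw [← ofReal_norm, norm_real, ofReal_norm]
  refine (lintegral_mono s1).trans ?_
  rw [lintegral_lintegral_swap (hhm.enorm.pow_const _).aemeasurable]
  refine (lintegral_mono fun ξ => hh_le ha hδ hδ1 h hε hη I hf ξ).trans ?_
  rw [lintegral_const_mul' _ _ (by simp)]
  refine mul_le_mul_right ?_ _
  rw [lintegral_lintegral_swap ((hfh.comp measurable_swap).enorm.pow_const _).aemeasurable]
  exact lintegral_mono s2
end

section
variable {d : ℕ}
lemma Dx_eq {u : Pt d → ℝ} (hu : CinfC u) (i : Fin d) : Dx i u = fun z => fderiv ℝ u z (0, EuclideanSpace.single i 1) := by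
  ext z
  have h1 : HasFDerivAt u (fderiv ℝ u z) (z.1, z.2) := (hu.1.differentiable (by simp) z).hasFDerivAt
  have h2 : HasFDerivAt (fun y : Spc d => ((z.1, y) : Pt d)) (ContinuousLinearMap.inr ℝ ℝ (Spc d)) z.2 := hasFDerivAt_prodMk_right z.1 z.2
  have := (h1.comp z.2 h2).fderiv
  unfold Dx
  change fderiv ℝ (u ∘ fun y => (z.1, y)) z.2 _ = _
  rw [this]; simp
lemma Dt_eq {u : Pt d → ℝ} (hu : CinfC u) : Dt u = fun z => fderiv ℝ u z (1, 0) := by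
  ext z
  have h1 : HasFDerivAt u (fderiv ℝ u z) (z.1, z.2) := (hu.1.differentiable (by simp) z).hasFDerivAt
  have h2 : HasFDerivAt (fun y : ℝ => ((y, z.2) : Pt d)) (ContinuousLinearMap.inl ℝ ℝ (Spc d)) z.1 := hasFDerivAt_prodMk_left z.1 z.2
  have := (h1.comp z.1 h2).fderiv
  unfold Dt
  rw [← fderiv_apply_one_eq_deriv]
  change fderiv ℝ (u ∘ fun y => (y, z.2)) z.1 _ = _
  rw [this]; simp
lemma cinfc_fd {u : Pt d → ℝ} (hu : CinfC u) (v : Pt d) : CinfC fun z => fderiv ℝ u z v := ⟨(hu.1.fderiv_right (m := (⊤ : ℕ∞)) (by simp)).clm_apply contDiff_const, hu.2.fderiv_apply (𝕜 := ℝ) v⟩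
lemma cinfc_Dx {u : Pt d → ℝ} (hu : CinfC u) (i : Fin d) : CinfC (Dx i u) := by rw [Dx_eq hu]; exact cinfc_fd hu _
lemma cinfc_Dt {u : Pt d → ℝ} (hu : CinfC u) : CinfC (Dt u) := by rw [Dt_eq hu]; exact cinfc_fd hu _
lemma cinfc_Dxx {u : Pt d → ℝ} (hu : CinfC u) (i j : Fin d) : CinfC (Dxx i j u) := cinfc_Dx (cinfc_Dx hu j) i
lemma cinfc_bd {u : Pt d → ℝ} (hu : CinfC u) : ∃ R : ℝ, 0 < R ∧ (∀ z, |u z| ≤ R) ∧ ∀ z : Pt d, (R < |z.1| ∨ R < ‖z.2‖) → u z = 0 := by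
  obtain ⟨R1, h1⟩ := hu.2.exists_bound_of_continuous hu.1.continuous
  obtain ⟨R2, h2⟩ := hu.2.isCompact.isBounded.subset_closedBall (0 : Pt d)
  refine ⟨max 1 (max R1 R2), by positivity, fun z => (h1 z).trans (by simp), fun z hz => ?_⟩
  by_contra hc
  have := h2 (subset_tsupport u hc)
  rw [mem_closedBall_zero_iff, Prod.norm_def] at this
  have h3 : ‖z.1‖ ≤ R2 := (le_max_left _ _).trans this
  have h4 : ‖z.2‖ ≤ R2 := (le_max_right _ _).trans this
  rw [norm_eq_abs] at h3
  have h5 : R2 ≤ max 1 (max R1 R2) := by simp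
  rcases hz with hz | hz <;> linarith
lemma sl_int {u : Pt d → ℝ} (hu : CinfC u) (s : ℝ) : Integrable fun y : Spc d => u (s, y) := by
  obtain ⟨R, hR, h1, h2⟩ := cinfc_bd hu
  refine Continuous.integrable_of_hasCompactSupport (hu.1.continuous.comp (by fun_prop)) ?_
  exact HasCompactSupport.of_support_subset_isCompact (isCompact_closedBall (0 : Spc d) R) fun y hy => by
    by_contra hc
    rw [mem_closedBall_zero_iff, not_le] at hc
    exact hy (h2 (s,y) (Or.inr hc))

def sw (u : Pt d → ℝ) : Spc d × ℝ → ℝ := fun z => u (z.2, z.1)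
lemma fh_sw (u : Pt d → ℝ) (s : ℝ) (ξ : Spc d) : fh (sw u) s ξ = ∫ y, ((u (s,y):ℝ):ℂ) * ee (-ξ) y := rfl
lemma mul_ee_int {g : Spc d → ℝ} (hg : Integrable g) (x : Spc d) : Integrable fun y => ((g y:ℝ):ℂ) * ee x y := hg.ofReal.mul_bdd (c := 1) (ee_cont x).aestronglyMeasurable (evAll fun y => by rw [norm_ee])
lemma ee_fd (x y : Spc d) (v : Spc d) : HasFDerivAt (fun y => ee x y) ((ee x y) • ((((2*rPi:ℝ):ℂ) * Complex.I) • (ofRealCLM.comp (innerSL ℝ x)))) y := by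
  have h1 : HasFDerivAt (fun y : Spc d => (inner ℝ x y : ℝ)) (innerSL ℝ x) y := (innerSL ℝ x).hasFDerivAt
  have h2 := (ofRealCLM.hasFDerivAt.comp y h1)
  have h3 := (h2.const_mul (((2*rPi:ℝ):ℂ) * Complex.I)).cexp
  have e : ∀ y : Spc d, Complex.exp (((2*rPi:ℝ):ℂ) * Complex.I * (ofRealCLM ∘ fun y => (inner ℝ x y : ℝ)) y) = ee x y := by
    intro y
    unfold ee
    congr 1
    simp [real_inner_comm]; ring
  simp_rw [e] at h3
  exact h3
lemma fh_Dx {u : Pt d → ℝ} (hu : CinfC u) (i : Fin d) (s : ℝ) (ξ : Spc d) :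
    fh (sw (Dx i u)) s ξ = (((2*rPi*ξ i:ℝ):ℂ) * Complex.I) * fh (sw u) s ξ := by
  rw [fh_sw, fh_sw]
  have hdu : Differentiable ℝ fun y : Spc d => u (s,y) := (hu.1.differentiable (by simp)).comp (by fun_prop)
  have hD : ∀ y : Spc d, fderiv ℝ (fun y : Spc d => ((u (s,y):ℝ):ℂ)) y (EuclideanSpace.single i 1) = ((Dx i u (s,y):ℝ):ℂ) := by
    intro y
    have := (ofRealCLM.hasFDerivAt.comp y (hdu y).hasFDerivAt).fderiv
    change fderiv ℝ (ofRealCLM ∘ fun y : Spc d => u (s,y)) y _ = _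
    rw [this]; rfl
  have hE : ∀ y : Spc d, fderiv ℝ (fun y => ee (-ξ) y) y (EuclideanSpace.single i 1) = ee (-ξ) y * (-(((2*rPi*ξ i:ℝ):ℂ) * Complex.I)) := by
    intro y
    rw [(ee_fd (-ξ) y 0).fderiv]
    simp [EuclideanSpace.inner_single_right]
    left; ring
  have h := integral_mul_fderiv_eq_neg_fderiv_mul_of_integrable (μ := (volume : Measure (Spc d))) (f := fun y => ee (-ξ) y) (g := fun y => ((u (s,y):ℝ):ℂ)) (v := EuclideanSpace.single i 1)
    ?_ ?_ ?_ (fun y _ => (ee_fd (-ξ) y 0).differentiableAt) (fun y _ => (ofRealCLM.hasFDerivAt.comp y (hdu y).hasFDerivAt).differentiableAt)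
  · simp_rw [hD, hE] at h
    simp_rw [mul_comm _ (ee _ _)]
    rw [h, ← integral_neg, ← integral_const_mul]
    congr 1; ext y; ring
  · simp_rw [hE]
    refine ((mul_ee_int (sl_int hu s) (-ξ)).const_mul (-(((2*rPi*ξ i:ℝ):ℂ) * Complex.I))).congr (evAll fun y => ?_)
    simp only; ring
  · simp_rw [hD]
    refine ((mul_ee_int (sl_int (cinfc_Dx hu i) s) (-ξ))).congr (evAll fun y => ?_)
    simp only; ring
  · refine ((mul_ee_int (sl_int hu s) (-ξ))).congr (evAll fun y => ?_)
    simp only; ring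
lemma fh_Dxx {u : Pt d → ℝ} (hu : CinfC u) (i j : Fin d) (s : ℝ) (ξ : Spc d) :
    fh (sw (Dxx i j u)) s ξ = ((-(4*rPi^2*(ξ i * ξ j)):ℝ):ℂ) * fh (sw u) s ξ := by
  rw [Dxx, fh_Dx (cinfc_Dx hu j), fh_Dx hu]
  push_cast
  linear_combination (4*rPi^2*(ξ i * ξ j)*fh (sw u) s ξ) * Complex.I_sq
lemma fh_Dt {u : Pt d → ℝ} (hu : CinfC u) (s : ℝ) (ξ : Spc d) : HasDerivAt (fun s => fh (sw u) s ξ) (fh (sw (Dt u)) s ξ) s := by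
  obtain ⟨R, hR, h1, h2⟩ := cinfc_bd (cinfc_Dt hu)
  simp_rw [fh_sw]
  have hD : ∀ (r : ℝ) (y : Spc d), HasDerivAt (fun r => u (r, y)) (Dt u (r,y)) r := fun r y => by
    have : DifferentiableAt ℝ (fun r => u (r, y)) r := ((hu.1.differentiable (by simp)).comp (by fun_prop : Differentiable ℝ fun r : ℝ => ((r, y) : Pt d))) r
    exact this.hasDerivAt
  refine (hasDerivAt_integral_of_dominated_loc_of_deriv_le (F := fun r y => ((u (r,y):ℝ):ℂ) * ee (-ξ) y) (F' := fun r y => ((Dt u (r,y):ℝ):ℂ) * ee (-ξ) y)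
    (bound := (closedBall (0:Spc d) R).indicator fun _ => R) (s := univ) Filter.univ_mem (evAll fun r => (mul_ee_int (sl_int hu r) (-ξ)).1) (mul_ee_int (sl_int hu s) (-ξ)) (mul_ee_int (sl_int (cinfc_Dt hu) s) (-ξ)).1
    (evAll fun y r _ => ?_) ?_ (evAll fun y r _ => ?_)).2
  · rw [norm_mul, norm_ee, mul_one, norm_real, norm_eq_abs]
    by_cases hy : y ∈ closedBall (0:Spc d) R
    · rw [indicator_of_mem hy]; exact h1 _
    · rw [indicator_of_notMem hy]
      rw [mem_closedBall_zero_iff, not_le] at hy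
      rw [h2 (r,y) (Or.inr hy), abs_zero]
  · exact (integrable_indicator_iff measurableSet_closedBall).2 (integrableOn_const (by exact measure_closedBall_lt_top.ne))
  · exact ((hD r y).ofReal_comp).mul_const _

end

section
variable {d : ℕ}
lemma exp_lip {x y : ℝ} (hx : 0 ≤ x) (hy : 0 ≤ y) : |eX (-x) - eX (-y)| ≤ |x - y| := by
  have key : ∀ x y : ℝ, 0 ≤ y → eX (-y) - eX (-x) ≤ |x - y| := by
    intro x y hy
    have h1 : eX (-x) = eX (-y) * eX (-(x-y)) := by rw [← Real.exp_add]; ring_nf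
    have h2 := add_one_le_exp (-(x-y))
    have h3 : eX (-y) ≤ 1 := exp_le_one_iff.2 (by linarith)
    have h4 := exp_pos (-y)
    have h5 := le_abs_self (x-y)
    have h6 := abs_nonneg (x-y)
    rw [h1]
    nlinarith
  rw [abs_le]
  have a1 := key x y hy
  have a2 := key y x hx
  rw [abs_sub_comm y x] at a2
  constructor <;> linarith
lemma ode_real {b : ℝ → ℝ} (hb : Measurable b) {M : ℝ} (hM : ∀ s, 0 ≤ b s ∧ b s ≤ M) {w w' : ℝ → ℝ} (hw : ∀ s, HasDerivAt w (w' s) s) (hw' : Continuous w') {t T : ℝ} (htT : t ≤ T) :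
    ∫ s in t..T, eX (-∫ τ in t..s, b τ) * (w' s - b s * w s) = eX (-∫ τ in t..T, b τ) * w T - w t := by
  have hii : ∀ s r : ℝ, IntervalIntegrable b volume s r := fun s r => by
    refine (intervalIntegrable_const (c := M)).mono_fun' hb.aestronglyMeasurable (evAll fun s => ?_)
    simp only [norm_eq_abs, abs_of_nonneg (hM s).1]; exact (hM s).2
  have hM0 : 0 ≤ M := (hM 0).1.trans (hM 0).2
  have hpos : ∀ s, t ≤ s → 0 ≤ ∫ τ in t..s, b τ := fun s hs => intervalIntegral.integral_nonneg hs fun τ _ => (hM τ).1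
  have hE : AbsolutelyContinuousOnInterval (fun s => eX (-∫ τ in t..s, b τ)) t T := by
    refine LipschitzOnWith.absolutelyContinuousOnInterval (K := M.toNNReal) ?_
    refine LipschitzOnWith.of_dist_le_mul fun x hx y hy => ?_
    rw [uIcc_of_le htT] at hx hy
    rw [dist_eq, dist_eq, Real.coe_toNNReal _ hM0]
    refine (exp_lip (hpos x hx.1) (hpos y hy.1)).trans ?_
    rw [intervalIntegral.integral_interval_sub_left (hii _ _) (hii _ _), ← norm_eq_abs]
    refine (intervalIntegral.norm_integral_le_of_norm_le_const fun s _ => ?_)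
    rw [norm_eq_abs, abs_of_nonneg (hM s).1]; exact (hM s).2
  have hwd : deriv w = w' := funext fun s => (hw s).deriv
  have hwA : AbsolutelyContinuousOnInterval w t T := by
    have : ContDiff ℝ 1 w := contDiff_one_iff_deriv.2 ⟨fun s => (hw s).differentiableAt, hwd ▸ hw'⟩
    exact this.contDiffOn.absolutelyContinuousOnInterval
  have := (hE.mul hwA).integral_deriv_eq_sub
  simp only [Pi.mul_apply, intervalIntegral.integral_same, neg_zero, exp_zero, one_mul] at this
  rw [← this]
  refine intervalIntegral.integral_congr_ae ?_
  have hl : LocallyIntegrable b volume := by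
    refine (locallyIntegrable_const M).mono hb.aestronglyMeasurable (evAll fun s => ?_)
    rw [norm_eq_abs, abs_of_nonneg (hM s).1, norm_eq_abs, abs_of_nonneg hM0]; exact (hM s).2
  filter_upwards [LocallyIntegrable.ae_hasDerivAt_integral hl] with s hs _
  have h1 := ((hs t).neg.exp.mul (hw s)).deriv
  refine Eq.trans ?_ h1.symm
  simp only [Pi.neg_apply]
  ring
lemma ode_cplx {b : ℝ → ℝ} (hb : Measurable b) {M : ℝ} (hM : ∀ s, 0 ≤ b s ∧ b s ≤ M) {w w' : ℝ → ℂ} (hw : ∀ s, HasDerivAt w (w' s) s) (hw' : Continuous w') {t T : ℝ} (htT : t ≤ T) :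
    ∫ s in t..T, ((eX (-∫ τ in t..s, b τ) : ℝ):ℂ) * (w' s - b s * w s) = ((eX (-∫ τ in t..T, b τ):ℝ):ℂ) * w T - w t := by
  have hwc : Continuous w := continuous_iff_continuousAt.2 fun s => (hw s).continuousAt
  have hii : ∀ s r : ℝ, IntervalIntegrable b volume s r := fun s r => by
    refine (intervalIntegrable_const (c := M)).mono_fun' hb.aestronglyMeasurable (evAll fun s => ?_)
    simp only [norm_eq_abs, abs_of_nonneg (hM s).1]; exact (hM s).2
  have hEc : Continuous fun s => ((eX (-∫ τ in t..s, b τ) : ℝ):ℂ) := continuous_ofReal.comp (continuous_exp.comp (intervalIntegral.continuous_primitive hii t).neg)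
  have hi : IntervalIntegrable (fun s => ((eX (-∫ τ in t..s, b τ) : ℝ):ℂ) * (w' s - b s * w s)) volume t T := by
    have h1 : IntervalIntegrable (fun s => ((b s:ℝ):ℂ) * w s) volume t T := by
      have : IntervalIntegrable (fun s => ((b s:ℝ):ℂ)) volume t T := ⟨(hii t T).1.ofReal, (hii t T).2.ofReal⟩
      exact this.mul_continuousOn hwc.continuousOn
    exact ((hw'.intervalIntegrable t T).sub h1).continuousOn_mul hEc.continuousOn
  have hre := ode_real hb hM (w := fun s => (w s).re) (w' := fun s => (w' s).re) (fun s => (reCLM.hasFDerivAt.comp_hasDerivAt s (hw s))) (continuous_re.comp hw') htT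
  have him := ode_real hb hM (w := fun s => (w s).im) (w' := fun s => (w' s).im) (fun s => (imCLM.hasFDerivAt.comp_hasDerivAt s (hw s))) (Complex.continuous_im.comp hw') htT
  refine Complex.ext ?_ ?_
  · have := reCLM.intervalIntegral_comp_comm hi
    simp only [Complex.reCLM_apply] at this
    rw [← this, sub_re, re_ofReal_mul, ← hre]
    refine intervalIntegral.integral_congr fun s _ => ?_
    simp only [re_ofReal_mul, sub_re]
  · have := imCLM.intervalIntegral_comp_comm hi
    simp only [Complex.imCLM_apply] at this
    rw [← this, sub_im, im_ofReal_mul, ← him]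
    refine intervalIntegral.integral_congr fun s _ => ?_
    simp only [im_ofReal_mul, sub_im]
end

section
variable {d : ℕ}

def fe (a : ℝ → Mtx d) (η : ℝ) (u : Pt d → ℝ) : Spc d × ℝ → ℝ := fun z => sw (Dt u) z + ∑ i, ∑ j, a z.2 i j * sw (Dxx i j u) z - η * sw u z
lemma fh_int {u : Pt d → ℝ} (hu : CinfC u) (s : ℝ) (ξ : Spc d) : Integrable fun y => ((sw u (y,s):ℝ):ℂ) * ee (-ξ) y := mul_ee_int (sl_int hu s) (-ξ)
lemma fh_fe (a : ℝ → Mtx d) (η : ℝ) {u : Pt d → ℝ} (hu : CinfC u) (s : ℝ) (ξ : Spc d) :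
    fh (fe a η u) s ξ = fh (sw (Dt u)) s ξ - ((4*rPi^2*QQ (a s) ξ + η:ℝ):ℂ) * fh (sw u) s ξ := by
  have e : fh (fe a η u) s ξ = ∫ y, (((sw (Dt u) (y,s):ℝ):ℂ) * ee (-ξ) y + ∑ i, ∑ j, ((a s i j : ℝ):ℂ) * (((sw (Dxx i j u) (y,s):ℝ):ℂ) * ee (-ξ) y) - (η:ℂ) * (((sw u (y,s):ℝ):ℂ) * ee (-ξ) y)) := by
    unfold fh FF
    refine integral_congr_ae (evAll fun y => ?_)
    simp only [fe]
    push_cast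
    rw [sub_mul, add_mul, sum_mul]
    simp_rw [sum_mul, mul_assoc]
  have i3 : ∀ i j, Integrable fun y => ((a s i j : ℝ):ℂ) * (((sw (Dxx i j u) (y,s):ℝ):ℂ) * ee (-ξ) y) := fun i j => (fh_int (cinfc_Dxx hu i j) s ξ).const_mul _
  have i2 : Integrable fun y => ∑ i, ∑ j, ((a s i j : ℝ):ℂ) * (((sw (Dxx i j u) (y,s):ℝ):ℂ) * ee (-ξ) y) := integrable_finsetSum _ fun i _ => integrable_finsetSum _ fun j _ => i3 i j
  have i4 : Integrable fun y => ((sw (Dt u) (y,s):ℝ):ℂ) * ee (-ξ) y + ∑ i, ∑ j, ((a s i j : ℝ):ℂ) * (((sw (Dxx i j u) (y,s):ℝ):ℂ) * ee (-ξ) y) := (fh_int (cinfc_Dt hu) s ξ).add i2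
  rw [e, integral_sub i4 ((fh_int hu s ξ).const_mul _), integral_add (fh_int (cinfc_Dt hu) s ξ) i2, integral_finsetSum _ (fun i _ => integrable_finsetSum _ fun j _ => i3 i j), integral_const_mul]
  simp_rw [integral_finsetSum _ (fun j (_ : j ∈ Finset.univ) => i3 _ j), integral_const_mul]
  change fh (sw (Dt u)) s ξ + ∑ i, ∑ j, ((a s i j : ℝ):ℂ) * fh (sw (Dxx i j u)) s ξ - (η:ℂ) * fh (sw u) s ξ = _
  simp_rw [fh_Dxx hu]
  unfold QQ
  push_cast
  rw [add_mul, mul_sum, sum_mul, add_sub_assoc, sub_eq_add_neg (fh (sw (Dt u)) s ξ), neg_add, ← sum_neg_distrib, sub_eq_add_neg]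
  congr 2
  refine sum_congr rfl fun i _ => ?_
  rw [mul_sum, sum_mul, ← sum_neg_distrib]
  refine sum_congr rfl fun j _ => ?_
  ring
lemma hh_fe {a : ℝ → Mtx d} (ha : Measurable a) {δ : ℝ} (hδ : 0 < δ) (h : ∀ t, inS d δ (a t)) {ε η : ℝ} (hη : 0 < η) (I : Fin 2 → Fin d)
    {u : Pt d → ℝ} (hu : CinfC u) (t : ℝ) (ξ : Spc d) :
    hh a ε η I (fe a η u) t ξ = -((eX (-(η*ε)) * eX (-(ε*‖ξ‖^2)) * mon I ξ:ℝ):ℂ) * fh (sw u) t ξ := by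
  obtain ⟨R, hR, -, h2⟩ := cinfc_bd hu
  obtain ⟨R', hR', -, h2'⟩ := cinfc_bd (cinfc_Dt hu)
  have z1 : ∀ s, R < s → fh (sw u) s ξ = 0 := fun s hs => by
    rw [fh_sw]
    simp_rw [fun y : Spc d => h2 (s,y) (Or.inl (hs.trans_le (le_abs_self s)))]
    simp
  have z2 : ∀ s, R' < s → fh (sw (Dt u)) s ξ = 0 := fun s hs => by
    rw [fh_sw]
    simp_rw [fun y : Spc d => h2' (s,y) (Or.inl (hs.trans_le (le_abs_self s)))]
    simp
  let T := max t (max R R' + 1)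
  have hT1 : R < T := lt_of_lt_of_le (by linarith [le_max_left R R']) (le_max_right t _)
  have hT2 : R' < T := lt_of_lt_of_le (by linarith [le_max_right R R']) (le_max_right t _)
  have htT : t ≤ T := le_max_left _ _
  let b : ℝ → ℝ := fun s => 4*rPi^2*QQ (a s) ξ + η
  have hbm : Measurable b := by
    have hm : Measurable fun τ => QQ (a τ) ξ := by
      unfold QQ
      exact Finset.measurable_fun_sum _ fun i _ => Finset.measurable_fun_sum _ fun j _ => ((ent_meas ha i j).mul_const _).mul_const _
    exact (hm.const_mul _).add_const _
  have hbM : ∀ s, 0 ≤ b s ∧ b s ≤ 4*rPi^2*(δ⁻¹*‖ξ‖^2) + η := fun s => by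
    have q := QQa (h s) ξ
    have : 0 ≤ QQ (a s) ξ := le_trans (by positivity) q.1
    refine ⟨by positivity, ?_⟩
    have := mul_le_mul_of_nonneg_left q.2 (by positivity : 0 ≤ 4*rPi^2)
    simp only [b]; linarith
  have hw' : Continuous fun s => fh (sw (Dt u)) s ξ := continuous_iff_continuousAt.2 fun s => (fh_Dt (cinfc_Dt hu) s ξ).continuousAt
  have ode := ode_cplx hbm hbM (fun s => fh_Dt hu s ξ) hw' htT
  rw [z1 T hT1, mul_zero, zero_sub] at ode
  have hB : ∀ s, ∫ τ in t..s, b τ = 4*rPi^2*(∫ τ in t..s, QQ (a τ) ξ) + η*(s-t) := fun s => by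
    simp only [b]
    rw [intervalIntegral.integral_add ((QQ_ii ha hδ h ξ t s).const_mul _) intervalIntegrable_const, intervalIntegral.integral_const_mul, intervalIntegral.integral_const, smul_eq_mul]
    ring
  have key : ∀ s, ((Mk a ε η I t s ξ : ℝ):ℂ) * fh (fe a η u) s ξ = (Ioc t T).indicator (fun s => ((eX (-(η*ε)) * eX (-(ε*‖ξ‖^2)) * mon I ξ:ℝ):ℂ) * (((eX (-∫ τ in t..s, b τ) : ℝ):ℂ) * (fh (sw (Dt u)) s ξ - b s * fh (sw u) s ξ))) s := by
    intro s
    rw [fh_fe a η hu]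
    by_cases hs : s ∈ Ioc t T
    · rw [indicator_of_mem hs, Mk, if_pos hs.1, ← mul_assoc (Complex.ofReal _) (Complex.ofReal _), ← Complex.ofReal_mul]
      congr 2
      rw [QQ_AA ha hδ h, hB]
      have e1 : eX (-(η*(s-t+ε))) = eX (-(η*ε)) * eX (-(η*(s-t))) := by rw [← Real.exp_add]; ring_nf
      have e2 : eX (-(4*rPi^2 * (∫ τ in t..s, QQ (a τ) ξ) + ε * ‖ξ‖^2)) = eX (-(ε*‖ξ‖^2)) * eX (-(4*rPi^2 * (∫ τ in t..s, QQ (a τ) ξ))) := by rw [← Real.exp_add]; ring_nf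
      have e3 : eX (-(4*rPi^2*(∫ τ in t..s, QQ (a τ) ξ) + η*(s-t))) = eX (-(η*(s-t))) * eX (-(4*rPi^2 * (∫ τ in t..s, QQ (a τ) ξ))) := by rw [← Real.exp_add]; ring_nf
      rw [e1, e2, e3]; ring
    · rw [indicator_of_notMem hs]
      by_cases hts : t < s
      · have hs' : T < s := by by_contra hc; exact hs ⟨hts, not_lt.1 hc⟩
        rw [z1 s (hT1.trans hs'), z2 s (hT2.trans hs')]; simp
      · rw [Mk, if_neg hts]; simp
  unfold hh
  simp_rw [key]
  rw [integral_indicator measurableSet_Ioc, integral_const_mul, ← intervalIntegral.integral_of_le htT, ode]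
  ring
lemma inv_sl {v : Pt d → ℝ} (hv : CinfC v) (t : ℝ) : Integrable (fun ξ => fh (sw v) t ξ) ∧ ∀ x, FF (fun ξ => fh (sw v) t ξ) x = ((v (t,x):ℝ):ℂ) := by
  let g : Spc d → ℂ := fun y => ((v (t,y):ℝ):ℂ)
  have hgs : ContDiff ℝ (⊤ : ℕ∞) g := ofRealCLM.contDiff.comp (hv.1.comp (by fun_prop))
  obtain ⟨R, hR, -, h2⟩ := cinfc_bd hv
  have hgc : HasCompactSupport g := HasCompactSupport.of_support_subset_isCompact (isCompact_closedBall (0 : Spc d) R) fun y hy => by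
    by_contra hc
    rw [mem_closedBall_zero_iff, not_le] at hc
    exact hy (by simp only [g]; rw [h2 (t,y) (Or.inr hc)]; simp)
  let G := hgc.toSchwartzMap hgs
  have e : (fun ξ => fh (sw v) t ξ) = FourierTransform.fourier g := by
    ext ξ
    rw [fh_sw, Real.fourier_eq']
    congr 1; ext y
    rw [smul_eq_mul, mul_comm]
    congr 1
    unfold ee
    simp
  have hi : Integrable (FourierTransform.fourier g) := by
    have : FourierTransform.fourier g = ⇑(FourierTransform.fourier G) := by rw [SchwartzMap.fourier_coe]; rfl
    rw [this]; exact (FourierTransform.fourier G).integrable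
  refine ⟨e ▸ hi, fun x => ?_⟩
  have := congrFun (hgs.continuous.fourierInv_fourier_eq (hgs.continuous.integrable_of_hasCompactSupport hgc) hi) x
  rw [fourierInv_eq', ← e] at this
  rw [FF, ← show g x = ((v (t,x):ℝ):ℂ) from rfl, ← this]
  congr 1; ext ξ
  rw [smul_eq_mul, mul_comm]
  rfl
end

section
variable {d : ℕ}

def LL (q p : ℝ) (f : Spc d × ℝ → ℝ) : EE := (∫⁻ x, nq q volume f x ^ p)^(1/p)
lemma LL_mono {q p : ℝ} (hq : 1 < q) (hp : 1 < p) {f g : Spc d × ℝ → ℝ} (h : ∀ z, |f z| ≤ |g z|) : LL q p f ≤ LL q p g := by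
  unfold LL nq
  refine rpow_le_rpow (lintegral_mono fun x => rpow_le_rpow (rpow_le_rpow (lintegral_mono fun y => rpow_le_rpow ?_ (by positivity)) (by positivity)) (by positivity)) (by positivity)
  rw [← ofReal_norm, ← ofReal_norm]
  exact ofReal_le_ofReal (h _)
lemma LL_add {q p : ℝ} (hq : 1 < q) (hp : 1 < p) {f g : Spc d × ℝ → ℝ} (hf : Measurable f) (hg : Measurable g) : LL q p (fun z => f z + g z) ≤ LL q p f + LL q p g := by
  refine le_trans ?_ (lintegral_Lp_add_le (meas_nq hf).aemeasurable (meas_nq hg).aemeasurable hp.le)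
  refine rpow_le_rpow (lintegral_mono fun x => rpow_le_rpow ?_ (by positivity)) (by positivity)
  refine le_trans ?_ (lintegral_Lp_add_le (f := fun y => ‖f (x,y)‖ₑ) (g := fun y => ‖g (x,y)‖ₑ) (hf.comp measurable_prodMk_left).enorm.aemeasurable (hg.comp measurable_prodMk_left).enorm.aemeasurable hq.le)
  refine rpow_le_rpow (lintegral_mono fun y => rpow_le_rpow ?_ (by positivity)) (by positivity)
  exact enorm_add_le _ _
lemma LL_smul {q p : ℝ} (hq : 1 < q) (hp : 1 < p) (c : ℝ) (f : Spc d × ℝ → ℝ) : LL q p (fun z => c * f z) = ‖c‖ₑ * LL q p f := by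
  unfold LL nq
  have hq0 : q ≠ 0 := by linarith
  have hp0 : p ≠ 0 := by linarith
  have e : ∀ x : Spc d, ((∫⁻ y : ℝ, ‖c * f (x,y)‖ₑ^q)^(1/q))^p = ‖c‖ₑ^p * ((∫⁻ y : ℝ, ‖f (x,y)‖ₑ^q)^(1/q))^p := fun x => by
    simp_rw [enorm_mul, mul_rpow_of_nonneg _ _ (by linarith : (0:ℝ) ≤ q)]
    rw [lintegral_const_mul' _ _ (rpow_ne_top_of_nonneg (by linarith) enorm_ne_top), mul_rpow_of_nonneg _ _ (by positivity), mul_rpow_of_nonneg _ _ (by positivity), ← ENNReal.rpow_mul ‖c‖ₑ q, mul_one_div_cancel hq0, rpow_one]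
  simp_rw [e]
  rw [lintegral_const_mul' _ _ (rpow_ne_top_of_nonneg (by linarith) enorm_ne_top), mul_rpow_of_nonneg _ _ (by positivity), ← ENNReal.rpow_mul, mul_one_div_cancel hp0, rpow_one]
lemma LL_sum {q p : ℝ} (hq : 1 < q) (hp : 1 < p) {ι : Type} (s : Finset ι) {f : ι → Spc d × ℝ → ℝ} (hf : ∀ i, Measurable (f i)) : LL q p (fun z => ∑ i ∈ s, f i z) ≤ ∑ i ∈ s, LL q p (f i) := by
  classical
  induction s using induction_on with
  | empty =>
    simp only [Finset.sum_empty]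
    have := LL_smul hq hp 0 (fun _ : Spc d × ℝ => 0)
    simp at this; simp [this]
  | insert i s hi ih =>
    simp only [sum_insert hi]
    exact (LL_add hq hp (hf i) (Finset.measurable_fun_sum _ fun i _ => hf i)).trans (add_le_add le_rfl ih)
lemma LL_fatou {q p : ℝ} (hq : 1 < q) (hp : 1 < p) {F : ℕ → Spc d × ℝ → ℝ} {G : Spc d × ℝ → ℝ} (hF : ∀ n, Measurable (F n)) (h : ∀ z, Filter.Tendsto (fun n => F n z) atTop (nhds (G z))) :
    LL q p G ≤ liminf (fun n => LL q p (F n)) atTop := by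
  have hl : ∀ {r : ℝ} (hr : 0 < r) (w : ℕ → EE), (liminf w atTop)^r = liminf (fun n => w n ^ r) atTop := fun {r} hr w => by
    have := (ENNReal.orderIsoRpow r hr).liminf_apply (u := w) (f := atTop)
    exact this
  unfold LL
  rw [← hl (by positivity)]
  refine rpow_le_rpow (le_trans ?_ (lintegral_liminf_le fun n => (meas_nq (hF n)).pow_const _)) (by positivity)
  refine lintegral_mono fun x => ?_
  simp only
  rw [← hl (by positivity)]
  refine rpow_le_rpow ?_ (by positivity)
  unfold nq
  rw [← hl (by positivity)]
  refine rpow_le_rpow (le_trans ?_ (lintegral_liminf_le fun n => ((hF n).comp measurable_prodMk_left).enorm.pow_const _)) (by positivity)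
  refine lintegral_mono fun y => ?_
  refine le_of_eq (Filter.Tendsto.liminf_eq ?_).symm
  exact ((continuous_rpow_const).tendsto _).comp ((continuous_enorm.tendsto _).comp (h (x,y)))
lemma good_sw {u : Pt d → ℝ} (hu : CinfC u) : Good (volume : Measure (Spc d)) (volume : Measure ℝ) (sw u) := by
  obtain ⟨R, hR, h1, h2⟩ := cinfc_bd hu
  refine ⟨hu.1.continuous.measurable.comp measurable_swap, ⟨R, fun z => h1 _⟩, closedBall 0 R, Icc (-R) R, measurableSet_closedBall, measurableSet_Icc, measure_closedBall_lt_top.ne, by simp, fun z hz => ?_⟩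
  refine h2 (z.2, z.1) ?_
  rw [mem_closedBall_zero_iff, mem_Icc, ← abs_le, not_le, not_le] at hz
  exact hz.symm
lemma good_add {f g : Spc d × ℝ → ℝ} (hf : Good (volume : Measure (Spc d)) (volume : Measure ℝ) f) (hg : Good (volume : Measure (Spc d)) (volume : Measure ℝ) g) : Good (volume : Measure (Spc d)) (volume : Measure ℝ) (fun z => f z + g z) := by
  obtain ⟨m1, ⟨R1, b1⟩, A1, B1, a1, c1, f1, g1, z1⟩ := hf
  obtain ⟨m2, ⟨R2, b2⟩, A2, B2, a2, c2, f2, g2, z2⟩ := hg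
  refine ⟨m1.add m2, ⟨R1 + R2, fun z => (abs_add_le _ _).trans (add_le_add (b1 z) (b2 z))⟩, A1 ∪ A2, B1 ∪ B2, a1.union a2, c1.union c2, (measure_union_lt_top f1.lt_top f2.lt_top).ne, (measure_union_lt_top g1.lt_top g2.lt_top).ne, fun z hz => ?_⟩
  simp only [mem_union, not_or] at hz
  rw [z1 z (hz.imp (fun h => h.1) fun h => h.1), z2 z (hz.imp (fun h => h.2) fun h => h.2), add_zero]
lemma good_sum {ι : Type} (s : Finset ι) {f : ι → Spc d × ℝ → ℝ} (hf : ∀ i, Good (volume : Measure (Spc d)) (volume : Measure ℝ) (f i)) : Good (volume : Measure (Spc d)) (volume : Measure ℝ) (fun z => ∑ i ∈ s, f i z) := by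
  classical
  induction s using induction_on with
  | empty => exact ⟨by simp, ⟨0, by simp⟩, ∅, ∅, by simp, by simp, by simp, by simp, by simp⟩
  | insert i s hi ih => simp only [sum_insert hi]; exact good_add (hf i) ih
lemma good_mul {c f : Spc d × ℝ → ℝ} (hc : Measurable c) {M : ℝ} (hM : ∀ z, |c z| ≤ M) (hf : Good (volume : Measure (Spc d)) (volume : Measure ℝ) f) : Good (volume : Measure (Spc d)) (volume : Measure ℝ) (fun z => c z * f z) := by
  obtain ⟨m1, ⟨R1, b1⟩, A1, B1, a1, c1, f1, g1, z1⟩ := hf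
  refine ⟨hc.mul m1, ⟨M * R1, fun z => ?_⟩, A1, B1, a1, c1, f1, g1, fun z hz => by rw [z1 z hz, mul_zero]⟩
  rw [abs_mul]
  exact mul_le_mul (hM z) (b1 z) (abs_nonneg _) ((abs_nonneg _).trans (hM z))
lemma good_fe {a : ℝ → Mtx d} (ha : Measurable a) {δ : ℝ} (hδ : 0 < δ) (h : ∀ t, inS d δ (a t)) (η : ℝ) {u : Pt d → ℝ} (hu : CinfC u) :
    Good (volume : Measure (Spc d)) (volume : Measure ℝ) (fe a η u) := by
  have h1 := good_add (good_add (good_sw (cinfc_Dt hu)) (good_sum Finset.univ fun i : Fin d => good_sum Finset.univ fun j : Fin d => good_mul (c := fun z : Spc d × ℝ => a z.2 i j) ((ent_meas ha i j).comp measurable_snd) (fun z => inS_bd hδ (h z.2) i j) (good_sw (cinfc_Dxx hu i j))))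
    (good_mul (c := fun _ => -η) measurable_const (fun _ => le_rfl) (good_sw hu))
  have : fe a η u = fun z => sw (Dt u) z + ∑ i, ∑ j, a z.2 i j * sw (Dxx i j u) z + -η * sw u z := by ext z; simp only [fe]; ring
  rw [this]; exact h1
lemma Good.LL_ne_top {q p : ℝ} (hq : 1 < q) (hp : 1 < p) {f : Spc d × ℝ → ℝ} (hf : Good (volume : Measure (Spc d)) (volume : Measure ℝ) f) : LL q p f ≠ ∞ := rpow_ne_top_of_nonneg (by positivity) (hf.nq_int hq (by linarith))

end

section
variable {d : ℕ}
lemma T_fe {a : ℝ → Mtx d} (ha : Measurable a) {δ : ℝ} (hδ : 0 < δ) (hδ1 : δ ≤ 1) (h : ∀ t, inS d δ (a t)) {ε η : ℝ} (hε : 0 < ε) (hη : 0 < η) (i j : Fin d)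
    {u : Pt d → ℝ} (hu : CinfC u) (x : Spc d) (t : ℝ) :
    Tk volume (KK (kap a ε η ![i,j])) (fe a η u) (x,t) = (FF (fun ξ => (((4*rPi^2)⁻¹ * (eX (-(η*ε)) * eX (-(ε*‖ξ‖^2))):ℝ):ℂ) * fh (sw (Dxx i j u)) t ξ) x).re := by
  obtain ⟨m, b, A, B, hA, hB, fA, fB, hz⟩ := good_fe ha hδ h η hu
  have hfi : Integrable (fe a η u) := by
    refine int_supp m b ⟨A ×ˢ B, hA.prod hB, ?_, fun z hz' => hz z ?_⟩
    · rw [Measure.volume_eq_prod, Measure.prod_prod]; exact mul_ne_top fA fB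
    · by_contra hc; push Not at hc; exact hz' ⟨hc.1, hc.2⟩
  rw [rep ha hδ hδ1 h hε hη _ m hfi]
  congr 2
  ext ξ
  rw [hh_fe ha hδ h hη _ hu, fh_Dxx hu]
  have : mon ![i,j] ξ = ξ i * ξ j := by simp [mon, Fin.prod_univ_two]
  rw [this]
  have hpi : ((rPi:ℝ):ℂ) ≠ 0 := by exact_mod_cast Real.pi_ne_zero
  push_cast
  field_simp
lemma T_lim {a : ℝ → Mtx d} (ha : Measurable a) {δ : ℝ} (hδ : 0 < δ) (hδ1 : δ ≤ 1) (h : ∀ t, inS d δ (a t)) (i j : Fin d)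
    {u : Pt d → ℝ} (hu : CinfC u) (x : Spc d) (t : ℝ) {ε : ℕ → ℝ} (hε : ∀ n, 0 < ε n) (hl : Filter.Tendsto ε atTop (nhds 0)) :
    Filter.Tendsto (fun n => Tk volume (KK (kap a (ε n) (ε n) ![i,j])) (fe a (ε n) u) (x,t)) atTop (nhds ((4*rPi^2)⁻¹ * Dxx i j u (t,x))) := by
  have hv := cinfc_Dxx hu i j
  obtain ⟨hi, hF⟩ := inv_sl hv t
  simp_rw [T_fe ha hδ hδ1 h (hε _) (hε _) i j hu x t]
  have e : (4*rPi^2)⁻¹ * Dxx i j u (t,x) = (FF (fun ξ => (((4*rPi^2)⁻¹ * (eX (-(0*0)) * eX (-(0*‖ξ‖^2))):ℝ):ℂ) * fh (sw (Dxx i j u)) t ξ) x).re := by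
    simp only [zero_mul, neg_zero, exp_zero, mul_one]
    have : FF (fun ξ => (((4*rPi^2)⁻¹:ℝ):ℂ) * fh (sw (Dxx i j u)) t ξ) x = (((4*rPi^2)⁻¹:ℝ):ℂ) * FF (fun ξ => fh (sw (Dxx i j u)) t ξ) x := by unfold FF; rw [← integral_const_mul]; congr 1; ext ξ; ring
    rw [this, hF x, ← Complex.ofReal_mul, Complex.ofReal_re]
  rw [e]
  refine (continuous_re.tendsto _).comp ?_
  unfold FF
  refine tendsto_integral_of_dominated_convergence (fun ξ => (4*rPi^2)⁻¹ * ‖fh (sw (Dxx i j u)) t ξ‖) (fun n => ?_) (hi.norm.const_mul _) (fun n => evAll fun ξ => ?_) (evAll fun ξ => ?_)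
  · refine (AEStronglyMeasurable.mul ?_ hi.1).mul (ee_cont x).aestronglyMeasurable
    refine Continuous.aestronglyMeasurable ?_
    fun_prop
  · rw [norm_mul, norm_mul, norm_ee, mul_one, norm_real, norm_eq_abs, abs_of_nonneg (by positivity)]
    refine mul_le_mul_of_nonneg_right ?_ (norm_nonneg _)
    have h1 : eX (-(ε n * ε n)) ≤ 1 := exp_le_one_iff.2 (by nlinarith [hε n])
    have h2 : eX (-(ε n * ‖ξ‖^2)) ≤ 1 := exp_le_one_iff.2 (by have := hε n; simp only [Left.neg_nonpos_iff]; positivity)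
    exact mul_le_of_le_one_right (by positivity) (mul_le_one₀ h1 (exp_nonneg _) h2)
  · refine Filter.Tendsto.mul_const _ (Filter.Tendsto.mul_const _ ((continuous_ofReal.tendsto _).comp ?_))
    have hc : Continuous fun e : ℝ => (4*rPi^2)⁻¹ * (eX (-(e*e)) * eX (-(e*‖ξ‖^2))) := by fun_prop
    exact (hc.tendsto 0).comp hl
theorem D2_bound (hd : 1 ≤ d) {δ : ℝ} (hδ : 0 < δ) (hδ1 : δ ≤ 1) {p q : ℝ} (hp : 1 < p) (hq : 1 < q) (i j : Fin d) :
    ∃ N : EE, N ≠ ∞ ∧ ∀ a : ℝ → Mtx d, Measurable a → (∀ t, inS d δ (a t)) → ∀ u : Pt d → ℝ, CinfC u →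
      LL q p (sw (Dxx i j u)) ≤ N * LL q p (fe a 0 u) := by
  obtain ⟨C, hC⟩ := kap_ker (d := d) hδ hδ1 ![i,j]
  have hA2 : eR (δ/40)⁻¹ ^(2:ℝ) ≠ ∞ := rpow_ne_top_of_nonneg (by norm_num) ofReal_ne_top
  obtain ⟨N, hN, hK⟩ := ker_bound hd C hA2 hp hq
  have hN' : N^(1/p) ≠ ∞ := rpow_ne_top_of_nonneg (by positivity) hN
  refine ⟨‖4*rPi^2‖ₑ * N^(1/p), mul_ne_top enorm_ne_top hN', fun a ha h u hu => ?_⟩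
  let ε : ℕ → ℝ := fun n => 1/((n:ℝ)+1)
  have hε : ∀ n, 0 < ε n := fun n => by simp only [ε]; positivity
  have hl : Filter.Tendsto ε atTop (nhds 0) := tendsto_one_div_add_atTop_nhds_zero_nat
  have hf0 := good_fe ha hδ h 0 hu
  have hus := good_sw hu
  have hKm : ∀ n, Measurable fun z : (Spc d × ℝ) × (Spc d × ℝ) => KK (kap a (ε n) (ε n) ![i,j]) z.1 z.2 := fun n => (kap_meas ha hδ h _ _ _).comp (by fun_prop : Measurable fun z : (Spc d × ℝ) × (Spc d × ℝ) => (z.1.2, z.2.2, z.1.1 - z.2.1))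
  have b1 : ∀ n, LL q p (Tk volume (KK (kap a (ε n) (ε n) ![i,j])) (fe a (ε n) u)) ≤ N^(1/p) * (LL q p (fe a 0 u) + ‖-ε n‖ₑ * LL q p (sw u)) := by
    intro n
    have k := hK _ (hC a ha h (ε n) (ε n) (hε n) (hε n)) (kap_LB hδ hδ1 _ ha h (hε n) (hε n)) (fe a (ε n) u) (good_fe ha hδ h (ε n) hu)
    have k2 : LL q p (Tk volume (KK (kap a (ε n) (ε n) ![i,j])) (fe a (ε n) u)) ≤ N^(1/p) * LL q p (fe a (ε n) u) := by
      unfold LL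
      rw [← mul_rpow_of_nonneg _ _ (by positivity)]
      exact rpow_le_rpow k (by positivity)
    refine k2.trans (mul_le_mul_right ?_ _)
    rw [← LL_smul hq hp]
    refine le_trans (le_of_eq ?_) (LL_add hq hp hf0.meas (hus.meas.const_mul _))
    congr 1; ext z; simp only [fe]; ring
  have b2 := LL_fatou hq hp (F := fun n => Tk volume (KK (kap a (ε n) (ε n) ![i,j])) (fe a (ε n) u)) (G := fun z => (4*rPi^2)⁻¹ * sw (Dxx i j u) z) (fun n => meas_Tk (hKm n) (good_fe ha hδ h (ε n) hu).meas)
    (fun z => T_lim ha hδ hδ1 h i j hu z.1 z.2 hε hl)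
  have b3 : Filter.Tendsto (fun n => N^(1/p) * (LL q p (fe a 0 u) + ‖-ε n‖ₑ * LL q p (sw u))) atTop (nhds (N^(1/p) * (LL q p (fe a 0 u) + ‖-(0:ℝ)‖ₑ * LL q p (sw u)))) := by
    refine ENNReal.Tendsto.const_mul (Filter.Tendsto.const_add _ (ENNReal.Tendsto.mul_const ?_ (Or.inr (hus.LL_ne_top hq hp)))) (Or.inr hN')
    exact (continuous_enorm.tendsto _).comp hl.neg
  have b4 := b2.trans ((Filter.liminf_le_liminf (evAll b1)).trans b3.liminf_eq.le)
  simp only [neg_zero, enorm_zero, zero_mul, add_zero] at b4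
  rw [LL_smul hq hp] at b4
  have e : LL q p (sw (Dxx i j u)) = ‖4*rPi^2‖ₑ * (‖(4*rPi^2)⁻¹‖ₑ * LL q p (sw (Dxx i j u))) := by rw [← mul_assoc, ← enorm_mul, mul_inv_cancel₀ (by positivity)]; simp
  rw [e, mul_assoc]
  exact mul_le_mul_right b4 _
end

section
variable {d : ℕ}
lemma mixed_LL {q p : ℝ} (hq : 1 < q) (hp : 1 < p) {f : Pt d → ℝ} (hf : Good (volume : Measure (Spc d)) (volume : Measure ℝ) (sw f)) :
    mixedNorm q p f = (LL q p (sw f)).toReal := by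
  have e1 : ∀ x : Spc d, (∫ t : ℝ, |f (t,x)|^q) = (nq q volume (sw f) x ^ q).toReal := fun x => by
    rw [nq_pow hq, integral_eq_lintegral_of_nonneg_ae (evAll fun t => by positivity)]
    · congr 1
      refine lintegral_congr fun t => ?_
      rw [← ofReal_rpow_of_nonneg (abs_nonneg _) (by linarith), ← norm_eq_abs, ofReal_norm]; rfl
    · have hm : Measurable fun t : ℝ => f (t,x) := hf.meas.comp (measurable_prodMk_left (x := x))
      have : Measurable fun t : ℝ => |f (t,x)| := by simpa using hm.norm
      exact (this.pow_const q).aestronglyMeasurable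
  have e2 : ∀ x : Spc d, (∫ t : ℝ, |f (t,x)|^q)^(p/q) = (nq q volume (sw f) x ^ p).toReal := fun x => by
    rw [e1, toReal_rpow, ← ENNReal.rpow_mul]
    congr 2; field_simp
  unfold mixedNorm
  simp_rw [e2]
  rw [integral_toReal ((meas_nq hf.meas).pow_const p).aemeasurable (evAll fun x => ENNReal.rpow_lt_top_of_nonneg (by linarith) (hf.nq_ne_top hq x)), toReal_rpow]
  rfl
lemma mnorm_le (m : Fin d → Fin d → ℝ) : mnorm m ≤ ∑ i, ∑ j, |m i j| := by
  unfold mnorm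
  refine sqrt_le_iff.2 ⟨by positivity, ?_⟩
  have h1 : ∀ (g : Fin d → ℝ), (∀ i, 0 ≤ g i) → ∑ i, g i ^2 ≤ (∑ i, g i)^2 := fun g hg => Finset.sum_sq_le_sq_sum_of_nonneg fun i _ => hg i
  refine le_trans (sum_le_sum fun i _ => ?_) (h1 (fun i => ∑ j, |m i j|) fun i => by positivity)
  refine le_trans (le_of_eq ?_) (h1 (fun j => |m i j|) fun i => by positivity)
  simp
lemma good_of_le {f g : Spc d × ℝ → ℝ} (hf : Good (volume : Measure (Spc d)) (volume : Measure ℝ) f) (hg : Measurable g) (h : ∀ z, |g z| ≤ |f z|) : Good (volume : Measure (Spc d)) (volume : Measure ℝ) g := by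
  obtain ⟨_, ⟨R, hR⟩, A, B, hA, hB, fA, fB, hz⟩ := hf
  refine ⟨hg, ⟨R, fun z => (h z).trans (hR z)⟩, A, B, hA, hB, fA, fB, fun z hz' => ?_⟩
  have := h z
  rw [hz z hz', abs_zero] at this
  exact abs_nonpos_iff.1 this
lemma good_abs {f : Spc d × ℝ → ℝ} (hf : Good (volume : Measure (Spc d)) (volume : Measure ℝ) f) : Good (volume : Measure (Spc d)) (volume : Measure ℝ) fun z => |f z| := good_of_le hf (by simpa using hf.meas.norm) fun z => by simp
lemma mn_abs (u : Pt d → ℝ) (z : Spc d × ℝ) : |sw (fun z => mnorm fun i j => Dxx i j u z) z| ≤ |(∑ i, ∑ j, |sw (Dxx i j u) z|)| := by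
  have h0 : 0 ≤ sw (fun z => mnorm fun i j => Dxx i j u z) z := sqrt_nonneg _
  rw [abs_of_nonneg h0, abs_of_nonneg (by positivity)]
  exact mnorm_le _
lemma good_S {u : Pt d → ℝ} (hu : CinfC u) : Good (volume : Measure (Spc d)) (volume : Measure ℝ) fun z => ∑ i, ∑ j, |sw (Dxx i j u) z| := good_sum _ fun i => good_sum _ fun j => good_abs (good_sw (cinfc_Dxx hu i j))
lemma good_mnorm {u : Pt d → ℝ} (hu : CinfC u) : Good (volume : Measure (Spc d)) (volume : Measure ℝ) (sw fun z => mnorm fun i j => Dxx i j u z) := by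
  refine good_of_le (good_S hu) ?_ (mn_abs u)
  unfold sw mnorm
  refine Measurable.sqrt (Finset.measurable_fun_sum _ fun i _ => Finset.measurable_fun_sum _ fun j _ => ?_)
  exact (good_sw (cinfc_Dxx hu i j)).meas.pow_const 2
lemma LL_abs {q p : ℝ} (hq : 1 < q) (hp : 1 < p) (f : Spc d × ℝ → ℝ) : LL q p (fun z => |f z|) ≤ LL q p f := LL_mono hq hp fun z => by simp
lemma LL_S {q p : ℝ} (hq : 1 < q) (hp : 1 < p) {u : Pt d → ℝ} (hu : CinfC u) : LL q p (fun z => ∑ i, ∑ j, |sw (Dxx i j u) z|) ≤ ∑ i, ∑ j, LL q p (sw (Dxx i j u)) := by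
  have hm : ∀ i j, Measurable fun z => |sw (Dxx i j u) z| := fun i j => (good_abs (good_sw (cinfc_Dxx hu i j))).meas
  refine (LL_sum hq hp _ fun i => Finset.measurable_fun_sum _ fun j _ => hm i j).trans (sum_le_sum fun i _ => ?_)
  exact (LL_sum hq hp _ fun j => hm i j).trans (sum_le_sum fun j _ => LL_abs hq hp _)
lemma LL_Dt {q p : ℝ} (hq : 1 < q) (hp : 1 < p) {a : ℝ → Mtx d} (ha : Measurable a) {δ : ℝ} (hδ : 0 < δ) (h : ∀ t, inS d δ (a t)) {u : Pt d → ℝ} (hu : CinfC u) :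
    LL q p (sw (Dt u)) ≤ LL q p (fe a 0 u) + ‖δ⁻¹‖ₑ * LL q p (fun z => ∑ i, ∑ j, |sw (Dxx i j u) z|) := by
  have hf := good_fe ha hδ h 0 hu
  rw [← LL_smul hq hp]
  refine le_trans (LL_mono hq hp fun z => ?_) ((LL_add hq hp (good_abs hf).meas ((good_S hu).meas.const_mul δ⁻¹)).trans (add_le_add (LL_abs hq hp _) le_rfl))
  rw [abs_of_nonneg (a := _ + _) (by positivity)]
  have e : sw (Dt u) z = fe a 0 u z - ∑ i, ∑ j, a z.2 i j * sw (Dxx i j u) z := by simp only [fe]; ring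
  rw [e]
  refine (abs_sub _ _).trans (add_le_add le_rfl ?_)
  rw [mul_sum]
  refine (abs_sum_le_sum_abs _ _).trans (sum_le_sum fun i _ => ?_)
  rw [mul_sum]
  refine (abs_sum_le_sum_abs _ _).trans (sum_le_sum fun j _ => ?_)
  rw [abs_mul]
  exact mul_le_mul_of_nonneg_right (inS_bd hδ (h z.2) i j) (abs_nonneg _)
end

theorem stmt6 (d : ℕ) (hd : 1 ≤ d) (δ : ℝ) (hδ0 : 0 < δ) (hδ1 : δ ≤ 1)
    (p q : ℝ) (hp : 1 < p) (hq : 1 < q) :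
    ∃ N : ℝ, 0 < N ∧
      ∀ a : ℝ → Matrix (Fin d) (Fin d) ℝ, Measurable a → (∀ t, inS d δ (a t)) →
      ∀ u : Pt d → ℝ, CinfC u →
        mixedNorm q p (Dt u) + mixedNorm q p (fun z => mnorm fun i j => Dxx i j u z) ≤
          N * mixedNorm q p (fun z => Dt u z + ∑ i, ∑ j, a z.1 i j * Dxx i j u z) := by
  choose N hN hB using fun i j : Fin d => D2_bound hd hδ0 hδ1 hp hq i j
  let S : ℝ≥0∞ := ∑ i, ∑ j, N i j
  have hS : S ≠ ∞ := ENNReal.sum_ne_top.2 fun i _ => ENNReal.sum_ne_top.2 fun j _ => hN i j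
  let K : ℝ≥0∞ := 1 + ‖δ⁻¹‖ₑ * S + S
  have hK : K ≠ ∞ := ENNReal.add_ne_top.2 ⟨ENNReal.add_ne_top.2 ⟨by simp, ENNReal.mul_ne_top enorm_ne_top hS⟩, hS⟩
  have hK0 : K ≠ 0 := by simp [K]
  refine ⟨K.toReal, ENNReal.toReal_pos hK0 hK, fun a ha h u hu => ?_⟩
  have hfe : sw (fun z => Dt u z + ∑ i, ∑ j, a z.1 i j * Dxx i j u z) = fe a 0 u := by
    ext z; simp only [fe, zero_mul, sub_zero]; rfl
  have hf := good_fe ha hδ0 h 0 hu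
  rw [mixed_LL hq hp (good_sw (cinfc_Dt hu)), mixed_LL hq hp (good_mnorm hu), mixed_LL hq hp (hfe ▸ hf), hfe, ← ENNReal.toReal_mul,
    ← ENNReal.toReal_add ((good_sw (cinfc_Dt hu)).LL_ne_top hq hp) ((good_mnorm hu).LL_ne_top hq hp)]
  refine ENNReal.toReal_mono (ENNReal.mul_ne_top hK (hf.LL_ne_top hq hp)) ?_
  have s1 : LL q p (fun z => ∑ i, ∑ j, |sw (Dxx i j u) z|) ≤ S * LL q p (fe a 0 u) := by
    refine (LL_S hq hp hu).trans ?_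
    simp only [S, Finset.sum_mul]
    exact Finset.sum_le_sum fun i _ => Finset.sum_le_sum fun j _ => hB i j a ha h u hu
  have s2 := (LL_mono hq hp (mn_abs u)).trans s1
  refine (add_le_add ((LL_Dt hq hp ha hδ0 h hu).trans (add_le_add le_rfl (mul_le_mul_right s1 _))) s2).trans (le_of_eq ?_)
  simp only [K]; ring
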